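/- (Selberg's theorem) A positive proportion of the non-trivial zeros of ζ lie on the critical line; quantitatively, there exist constants c > 0 and T₀ such that for all T ≥ T₀, N₀(T) ≥ c·T·log T, where N₀(T) is the number of zeros ρ = 1/2 + it of ζ with 0 < t < T. -/

import Mathlib

namespace Sel
open MeasureTheory FourierTransform SchwartzMap
open scoped ContDiff

theorem planch {f : ℝ → ℂ} (h1 : Integrable f) (h2 : MemLp f 2) :
    Integrable (fun t => ‖𝓕 f t‖ ^ 2) ∧ ∫ t, ‖𝓕 f t‖ ^ 2 = ∫ t, ‖f t‖ ^ 2 := by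
  set F := h2.toLp f with hF
  have hcont : Continuous (𝓕 f) := VectorFourier.fourierIntegral_continuous
    Real.continuous_fourierChar (by fun_prop) h1
  have key : ∀ᵐ x, 𝓕 f x = (𝓕 F : Lp ℂ 2 (volume : Measure ℝ)) x := by
    apply ae_eq_of_integral_contDiff_smul_eq hcont.locallyIntegrable
      ((Lp.memLp _).locallyIntegrable (by norm_num))
    intro g hg1 hg2
    have hg3 : HasCompactSupport (fun x => (g x : ℂ)) := hg2.comp_left (g := ((↑) : ℝ → ℂ)) (by simp)
    have hg4 : ContDiff ℝ ∞ (fun x => (g x : ℂ)) := Complex.ofRealCLM.contDiff.comp hg1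
    set G : 𝓢(ℝ, ℂ) := hg3.toSchwartzMap hg4 with hG
    have e := congrArg (fun d => d G) (Lp.fourier_toTemperedDistribution_eq F)
    simp only [TemperedDistribution.fourier_apply, Lp.toTemperedDistribution_apply] at e
    have hGx : ∀ x, G x = (g x : ℂ) := fun x => rfl
    simp only [hGx] at e
    have e2 : ∫ x, g x • (𝓕 F : Lp ℂ 2 (volume : Measure ℝ)) x = ∫ x, (g x : ℂ) • (𝓕 F : Lp ℂ 2 (volume : Measure ℝ)) x := by
      simp
    rw [e2, ← e]
    have e3 := VectorFourier.integral_fourierIntegral_smul_eq_flip (L := innerₗ ℝ) (μ := volume)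
      (ν := volume) (f := f) (g := fun x => (g x : ℂ)) (e := Real.fourierChar)
      Real.continuous_fourierChar (by fun_prop) h1 (G.integrable)
    have e4 : ∫ x, g x • 𝓕 f x = ∫ x, 𝓕 f x • (g x : ℂ) := by
      congr 1; ext x; simp [mul_comm]
    rw [e4]
    refine Eq.trans e3 ?_
    rw [flip_innerₗ]
    apply integral_congr_ae
    filter_upwards [h2.coeFn_toLp] with x hx
    rw [hF, hx, smul_eq_mul, smul_eq_mul, mul_comm]
    rfl
  have hm : MemLp (𝓕 f) 2 := (memLp_congr_ae key).2 (Lp.memLp _)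
  refine ⟨by simpa using hm.integrable_norm_pow (by norm_num), ?_⟩
  have hn := Lp.inner_fourier_eq F F
  rw [L2.inner_def, L2.inner_def] at hn
  have a1 : ∫ a, inner ℂ ((𝓕 F : Lp ℂ 2 (volume : Measure ℝ)) a) ((𝓕 F : Lp ℂ 2 (volume : Measure ℝ)) a)
      = ((∫ t, ‖𝓕 f t‖ ^ 2 : ℝ) : ℂ) := by
    rw [← integral_complex_ofReal]
    apply integral_congr_ae
    filter_upwards [key] with x hx
    rw [← hx, inner_self_eq_norm_sq_to_K]; simp
  have a2 : ∫ a, inner ℂ (F a) (F a) = ((∫ t, ‖f t‖ ^ 2 : ℝ) : ℂ) := by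
    rw [← integral_complex_ofReal]
    apply integral_congr_ae
    filter_upwards [h2.coeFn_toLp] with x hx
    rw [hF, hx, inner_self_eq_norm_sq_to_K]; simp
  rw [a1, a2] at hn
  exact_mod_cast hn
end Sel

namespace Sel
open MeasureTheory Set Filter Topology Complex

theorem rmul_cpow {r : ℝ} (hr : 0 < r) {z : ℂ} (hz : z ≠ 0) (s : ℂ) :
    ((r:ℂ) * z) ^ s = (r:ℂ) ^ s * z ^ s := by
  have hr' : (r:ℂ) ≠ 0 := by exact_mod_cast hr.ne'
  rw [cpow_def_of_ne_zero (mul_ne_zero hr' hz), log_ofReal_mul hr hz, ofReal_log hr.le,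
    add_mul, exp_add, ← cpow_def_of_ne_zero hr', ← cpow_def_of_ne_zero hz]

theorem gi_conv {s k : ℂ} (hs : 0 < s.re) (hk : 0 < k.re) :
    IntegrableOn (fun t : ℝ => (t:ℂ) ^ (s - 1) * cexp (-k * t)) (Ioi 0) := by
  have h := mellinConvergent_of_isBigO_rpow_exp (f := fun t : ℝ => cexp (-k * t)) (s := s) (b := 0)
    (a := k.re) hk ((show Continuous (fun t : ℝ => cexp (-k * t)) by fun_prop).locallyIntegrable.locallyIntegrableOn _) ?_ ?_ hs
  · simpa [MellinConvergent] using h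
  · apply Asymptotics.IsBigO.of_bound 1
    filter_upwards with t
    simp [Complex.norm_exp]
  · apply Asymptotics.IsBigO.of_bound 1
    filter_upwards [self_mem_nhdsWithin] with t ht
    have : 0 < t := ht
    simp [Complex.norm_exp]
    positivity

theorem gi {s k : ℂ} (hs : 0 < s.re) (hk : 0 < k.re) :
    ∫ t : ℝ in Ioi 0, (t:ℂ) ^ (s - 1) * cexp (-k * t) = k ^ (-s) * Gamma s := by
  set U : Set ℂ := {z | 0 < z.re}
  have hU : IsOpen U := isOpen_lt continuous_const continuous_re
  have hA : AnalyticOnNhd ℂ (fun k : ℂ => ∫ t : ℝ in Ioi 0, (t:ℂ) ^ (s - 1) * cexp (-k * t)) U := by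
    apply DifferentiableOn.analyticOnNhd _ hU
    intro k0 hk0
    have hk0' : 0 < k0.re := hk0
    apply DifferentiableAt.differentiableWithinAt
    have hb := gi_conv (s := s + 1) (k := ((k0.re / 2 : ℝ) : ℂ)) (by simp; linarith) (by simp; linarith)
    have := hasDerivAt_integral_of_dominated_loc_of_deriv_le (μ := volume.restrict (Ioi (0:ℝ)))
      (F := fun (k : ℂ) (t : ℝ) => (t:ℂ) ^ (s - 1) * cexp (-k * t))
      (F' := fun (k : ℂ) (t : ℝ) => (t:ℂ) ^ (s - 1) * (cexp (-k * t) * (-t)))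
      (x₀ := k0) (s := Metric.ball k0 (k0.re / 2))
      (bound := fun t => ‖(t:ℂ) ^ (s + 1 - 1) * cexp (-((k0.re / 2 : ℝ) : ℂ) * t)‖)
      (Metric.ball_mem_nhds _ (by linarith)) ?_ (gi_conv hs hk0) ?_ ?_ hb.norm ?_
    · exact this.2.differentiableAt
    · filter_upwards [hU.mem_nhds hk0] with k hk using (gi_conv hs hk).aestronglyMeasurable
    · apply AEStronglyMeasurable.congr ((gi_conv hs hk0).aestronglyMeasurable.mul
        (g := fun t : ℝ => (-t : ℂ)) (by fun_prop))
      filter_upwards with t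
      simp [mul_assoc]
    · filter_upwards [ae_restrict_mem measurableSet_Ioi] with t ht k hk
      have ht' : (0:ℝ) < t := ht
      have e : (t:ℂ) ^ (s + 1 - 1) = (t:ℂ) ^ (s - 1) * t := by
        rw [show s + 1 - 1 = (s - 1) + 1 by ring, cpow_add _ _ (by exact_mod_cast ht'.ne'), cpow_one]
      rw [e, norm_mul, norm_mul, norm_mul, norm_mul, norm_neg, mul_assoc]
      rw [mul_comm ‖(t:ℂ)‖]
      gcongr ?_ * (?_ * ?_)
      rw [Complex.norm_exp, Complex.norm_exp]
      apply Real.exp_le_exp.2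
      rw [Metric.mem_ball, dist_eq_norm] at hk
      have := (abs_re_le_norm (k - k0)).trans hk.le
      rw [abs_le] at this
      simp at this ⊢
      nlinarith
    · filter_upwards with t k hk
      apply HasDerivAt.const_mul
      have : HasDerivAt (fun k : ℂ => -k * t) (-t : ℂ) k := by
        simpa using (hasDerivAt_id k).neg.mul_const (t:ℂ)
      exact this.cexp
  have hB : AnalyticOnNhd ℂ (fun k : ℂ => k ^ (-s) * Gamma s) U := by
    apply DifferentiableOn.analyticOnNhd _ hU
    intro k hk
    apply DifferentiableAt.differentiableWithinAt
    apply DifferentiableAt.mul_const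
    exact differentiableAt_id.cpow_const (Or.inl hk)
  have hc : IsPreconnected U := (convex_halfSpace_re_gt 0).isPreconnected
  refine hA.eqOn_of_preconnected_of_frequently_eq hB hc (z₀ := 1) (by simp [U]) ?_ hk
  have hr : ∀ r : ℝ, 0 < r → ∫ t : ℝ in Ioi 0, (t:ℂ) ^ (s - 1) * cexp (-r * t) = (r:ℂ) ^ (-s) * Gamma s := by
    intro r hr
    have := integral_cpow_mul_exp_neg_mul_Ioi hs hr
    simp_rw [neg_mul]
    rw [this, one_div, inv_cpow _ _ (by rw [arg_ofReal_of_nonneg hr.le]; exact Real.pi_pos.ne), cpow_neg]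
  have ht : Tendsto (fun n : ℕ => ((1 + 1 / (n + 1) : ℝ) : ℂ)) atTop (𝓝[≠] 1) := by
    rw [tendsto_nhdsWithin_iff]
    constructor
    · have := (tendsto_one_div_add_atTop_nhds_zero_nat (𝕜 := ℝ)).const_add 1
      rw [add_zero] at this
      have := (continuous_ofReal.tendsto 1).comp this
      simpa [Function.comp_def] using this
    · filter_upwards with n
      simp only [mem_compl_iff, mem_singleton_iff]
      rw [← ofReal_one, ofReal_inj]
      have : (0:ℝ) < 1 / (n+1) := by positivity
      linarith
  exact ht.frequently (Frequently.of_forall fun n => hr _ (by positivity))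

noncomputable def th (k : ℂ) (u : ℝ) : ℂ := jacobiTheta (I * k * u)

theorem th_im {k : ℂ} (hk : 0 < k.re) {u : ℝ} (hu : 0 < u) : 0 < (I * k * u).im := by
  simp; positivity

theorem th_cont {k : ℂ} (hk : 0 < k.re) : ContinuousOn (th k) (Ioi 0) := by
  intro u hu
  apply ContinuousAt.continuousWithinAt
  exact (continuousAt_jacobiTheta (th_im hk hu)).comp (f := fun u : ℝ => I * k * u) (by fun_prop)

theorem inv_re_pos {k : ℂ} (hk : 0 < k.re) : 0 < (k⁻¹).re := by
  rw [inv_re]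
  apply div_pos hk
  rw [normSq_pos]; rintro rfl; simp at hk

theorem th_feq {k : ℂ} (hk : 0 < k.re) {x : ℝ} (hx : 0 < x) :
    th k (1 / x) = ((k⁻¹) ^ (1/2 : ℂ) * ((x ^ (1/2 : ℝ) : ℝ) : ℂ)) * th k⁻¹ x := by
  have h := jacobiTheta_S_smul ⟨I * k⁻¹ * x, th_im (inv_re_pos hk) hx⟩
  rw [UpperHalfPlane.modular_S_smul] at h
  have k0 : k ≠ 0 := by rintro rfl; simp at hk
  have x0 : (x:ℂ) ≠ 0 := by exact_mod_cast hx.ne'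
  simp only at h
  rw [th, th]
  convert h using 1
  · congr 1
    have : (-(I * k⁻¹ * x))⁻¹ = I * k * (1 / x : ℝ) := by
      field_simp; push_cast; field_simp; simp
    rw [← this]
  · congr 1
    rw [show -I * (I * k⁻¹ * x) = (x : ℂ) * k⁻¹ by ring_nf; simp]
    rw [rmul_cpow hx (inv_ne_zero k0), ofReal_cpow hx.le, mul_comm]
    norm_num

theorem th_top {k : ℂ} (hk : 0 < k.re) (r : ℝ) : (fun x => th k x - 1) =O[atTop] (· ^ r) := by
  have h1 : Tendsto (fun x : ℝ => I * k * x) atTop (comap im atTop) := by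
    rw [tendsto_comap_iff]
    simpa [Function.comp_def] using tendsto_id.const_mul_atTop hk
  have h2 := isBigO_at_im_infty_jacobiTheta_sub_one.comp_tendsto h1
  refine h2.trans (Asymptotics.IsBigO.trans ?_ (isLittleO_exp_neg_mul_rpow_atTop (a := Real.pi * k.re) (by positivity) r).isBigO)
  apply Asymptotics.isBigO_of_le
  intro x
  simp [mul_assoc]

noncomputable def TP (k : ℂ) (hk : 0 < k.re) : WeakFEPair ℂ where
  f := th k
  g := th k⁻¹
  k := 1/2
  ε := (k⁻¹) ^ (1/2 : ℂ)
  f₀ := 1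
  g₀ := 1
  hf_int := (th_cont hk).locallyIntegrableOn measurableSet_Ioi
  hg_int := (th_cont (inv_re_pos hk)).locallyIntegrableOn measurableSet_Ioi
  hk := by norm_num
  hε := by
    rw [Ne, cpow_eq_zero_iff, not_and_or]; left
    intro h; have := inv_re_pos hk; simp [h] at this
  h_feq := fun x hx => th_feq hk hx
  hf_top := th_top hk
  hg_top := th_top (inv_re_pos hk)

theorem TP_Λ1 {k : ℂ} (hk : 0 < k.re) {s : ℂ} (hs : 1/2 < s.re) :
    (TP k hk).Λ s = 2 * k ^ (-s) * completedRiemannZeta (2 * s) := by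
  have h := ((TP k hk).hasMellin hs).2
  rw [← h]
  have hs0 : 0 < s.re := by linarith
  have hp : ∀ n : ℕ, 0 < ((Real.pi * (n + 1) ^ 2 * k : ℂ)).re := by
    intro n
    rw [show (Real.pi * (n + 1) ^ 2 * k : ℂ) = ((Real.pi * (n+1)^2 : ℝ) : ℂ) * k by push_cast; ring, re_ofReal_mul]
    positivity
  have key : HasSum (fun n : ℕ => ∫ t : ℝ in Ioi 0, 2 * ((t:ℂ) ^ (s - 1) * cexp (-(Real.pi * (n + 1) ^ 2 * k) * t)))
      (mellin (fun x => th k x - 1) s) := by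
    have := hasSum_integral_of_summable_integral_norm (μ := volume.restrict (Ioi (0:ℝ)))
      (F := fun (n : ℕ) (t : ℝ) => 2 * ((t:ℂ) ^ (s - 1) * cexp (-(Real.pi * (n + 1) ^ 2 * k) * t)))
      (fun n => (gi_conv hs0 (hp n)).const_mul _) ?_
    · suffices hh : mellin (fun x => th k x - 1) s = ∫ (a : ℝ) in Ioi 0, ∑' (i : ℕ), 2 * ((a:ℂ) ^ (s - 1) * cexp (-(Real.pi * (i + 1) ^ 2 * k) * a)) by
        rw [hh]; exact this
      apply setIntegral_congr_fun measurableSet_Ioi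
      intro t ht
      have h3 := ((hasSum_nat_jacobiTheta (th_im hk ht)).mul_left (2 * (t:ℂ)^(s-1))).tsum_eq
      dsimp only
      rw [smul_eq_mul, th, show (t:ℂ) ^ (s - 1) * (jacobiTheta (I * k * t) - 1) = 2 * (t:ℂ)^(s-1) * ((jacobiTheta (I * k * t) - 1) / 2) by ring, ← h3]
      congr 1; ext n
      rw [mul_assoc]; congr 3
      ring_nf; simp; ring
    · have e : ∀ n : ℕ, ∫ t : ℝ in Ioi 0, ‖2 * ((t:ℂ) ^ (s - 1) * cexp (-(Real.pi * (n + 1) ^ 2 * k) * t))‖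
        = 2 * ((1 / (Real.pi * k.re)) ^ s.re * Real.Gamma s.re) * (1 / ((n:ℝ) + 1) ^ (2 * s.re)) := by
        intro n
        have := Real.integral_rpow_mul_exp_neg_mul_Ioi hs0 (r := Real.pi * k.re * (n+1)^2) (by positivity)
        rw [show (1 / (Real.pi * k.re * ((n:ℝ)+1)^2)) = 1 / (Real.pi * k.re) * (1 / ((n:ℝ)+1)^2) by field_simp,
          Real.mul_rpow (by positivity) (by positivity), Real.div_rpow (y := ((n:ℝ)+1)^2) (by positivity) (by positivity), Real.one_rpow,
          show (((n:ℝ)+1)^2) ^ s.re = ((n:ℝ)+1) ^ (2 * s.re) by rw [← Real.rpow_natCast, ← Real.rpow_mul (by positivity), Nat.cast_two]] at this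
        rw [show ∀ a b c : ℝ, 2 * (a * b) * c = 2 * (a * c * b) by intros; ring, ← this, ← integral_const_mul]
        apply setIntegral_congr_fun measurableSet_Ioi
        intro t ht
        dsimp only
        rw [norm_mul, norm_mul, norm_cpow_eq_rpow_re_of_pos ht, Complex.norm_exp]
        simp only [Complex.norm_ofNat, sub_re, one_re]
        congr 1; congr 1; congr 1
        rw [show (-(Real.pi * (n + 1) ^ 2 * k) * t : ℂ) = ((-(Real.pi * (n+1)^2 * t) : ℝ) : ℂ) * k by push_cast; ring, re_ofReal_mul]
        ring
      simp_rw [e]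
      apply Summable.mul_left
      have := (Real.summable_one_div_nat_rpow (p := 2 * s.re)).2 (by linarith)
      exact_mod_cast (summable_nat_add_iff 1).2 this
  rw [show mellin (fun x => (TP k hk).f x - (TP k hk).f₀) s = mellin (fun x => th k x - 1) s from rfl, ← key.tsum_eq]
  have e0 : completedRiemannZeta (2 * s) = Gammaℝ (2 * s) * riemannZeta (2 * s) := by
    rw [riemannZeta_def_of_ne_zero, mul_div_cancel₀]
    · exact Gammaℝ_ne_zero_of_re_pos (by simp; linarith)
    · rintro h; have := congrArg re h; simp at this; linarith
  have k0 : k ≠ 0 := by rintro rfl; simp at hk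
  rw [e0, zeta_eq_tsum_one_div_nat_add_one_cpow (by simp; linarith), ← tsum_mul_left, ← tsum_mul_left]
  congr 1; ext n
  rw [integral_const_mul, gi hs0 (hp n), Gammaℝ_def,
    show (Real.pi * (n + 1) ^ 2 * k : ℂ) = (Real.pi : ℂ) * ((((n : ℝ) + 1) ^ 2 : ℝ) * k) by push_cast; ring,
    rmul_cpow Real.pi_pos (mul_ne_zero (by norm_cast; positivity) k0), rmul_cpow (by positivity) k0]
  have : ((((n : ℝ) + 1) ^ 2 : ℝ) : ℂ) ^ (-s) = 1 / ((n : ℂ) + 1) ^ (2 * s) := by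
    rw [cpow_neg, one_div]
    congr 1
    rw [ofReal_pow, cpow_def_of_ne_zero (by norm_cast; positivity), cpow_def_of_ne_zero (by norm_cast)]
    congr 1
    have : log (((n:ℝ) + 1 : ℝ) ^ 2 : ℂ) = 2 * log ((n:ℂ) + 1) := by
      rw [← ofReal_pow, ← ofReal_log (by positivity), Real.log_pow]
      push_cast
      rw [ofReal_log (by positivity)]; push_cast; rfl
    rw [this]; ring
  rw [this]
  rw [show -(2 * s) / 2 = -s by ring, show 2 * s / 2 = s by ring]
  ring

theorem TP_Λ {k : ℂ} (hk : 0 < k.re) {s : ℂ} (hs : s ≠ 0) (hs2 : s ≠ 1/2) :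
    (TP k hk).Λ s = 2 * k ^ (-s) * completedRiemannZeta (2 * s) := by
  have k0 : k ≠ 0 := by rintro rfl; simp at hk
  set U : Set ℂ := ({0, 1/2} : Set ℂ)ᶜ
  have hU : IsOpen U := (Set.Finite.isClosed (by simp)).isOpen_compl
  have hmem : ∀ z ∈ U, z ≠ 0 ∧ z ≠ 1/2 := by
    intro z hz; simp only [U, mem_compl_iff, mem_insert_iff, mem_singleton_iff, not_or] at hz; exact hz
  have hc : IsPreconnected U := by
    have : Set.Countable ({0, 1/2} : Set ℂ) := by simp
    exact (this.isPathConnected_compl_of_one_lt_rank (by simp [Complex.rank_real_complex])).isConnected.isPreconnected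
  have hA : AnalyticOnNhd ℂ (TP k hk).Λ U := by
    apply DifferentiableOn.analyticOnNhd _ hU
    intro z hz
    exact ((TP k hk).differentiableAt_Λ (Or.inl (hmem z hz).1) (Or.inl (by simpa [TP] using (hmem z hz).2))).differentiableWithinAt
  have hB : AnalyticOnNhd ℂ (fun s => 2 * k ^ (-s) * completedRiemannZeta (2 * s)) U := by
    apply DifferentiableOn.analyticOnNhd _ hU
    intro z hz
    apply DifferentiableAt.differentiableWithinAt
    have h1 : DifferentiableAt ℂ (fun s : ℂ => completedRiemannZeta (2 * s)) z :=
      (differentiableAt_completedZeta (by simpa using (hmem z hz).1)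
        (by intro h; apply (hmem z hz).2; rw [← h]; ring)).comp (f := fun s : ℂ => 2 * s) z (by fun_prop)
    have h2 : DifferentiableAt ℂ (fun s : ℂ => k ^ (-s)) z :=
      (differentiableAt_id.neg).const_cpow (Or.inl k0)
    exact (h2.const_mul 2).mul h1
  refine hA.eqOn_of_preconnected_of_eventuallyEq hB hc (z₀ := 1) ?_ ?_ (show s ∈ U by simp [U, hs]; simpa using hs2)
  · simp [U]
  · have : {z : ℂ | 1/2 < z.re} ∈ 𝓝 (1:ℂ) := (isOpen_lt continuous_const continuous_re).mem_nhds (by simp; norm_num)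
    filter_upwards [this] with z hz using TP_Λ1 hk hz

theorem th_mellin {k : ℂ} (hk : 0 < k.re) {s : ℂ} (hs : 0 < s.re) (hs2 : s.re < 1/2) :
    HasMellin (fun u : ℝ => th k u - 1 - (k⁻¹) ^ (1/2 : ℂ) * ((u ^ (-(1/2) : ℝ) : ℝ) : ℂ)) s
      (2 * k ^ (-s) * completedRiemannZeta (2 * s)) := by
  have s0 : s ≠ 0 := by rintro rfl; simp at hs
  have s1 : s ≠ 1/2 := by rintro rfl; simp at hs2
  rw [← TP_Λ hk s0 s1]
  have hli : LocallyIntegrableOn (fun u : ℝ => (k⁻¹) ^ (1/2 : ℂ) * ((u ^ (-(1/2) : ℝ) : ℝ) : ℂ)) (Ioi 0) := by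
    refine ContinuousOn.locallyIntegrableOn ?_ measurableSet_Ioi
    refine continuousOn_of_forall_continuousAt (fun x (hx : 0 < x) ↦ ?_)
    have : x ≠ 0 ∨ 0 ≤ -(1/2:ℝ) := Or.inl hx.ne'
    fun_prop
  have hb : (fun u : ℝ => (k⁻¹) ^ (1/2 : ℂ) * ((u ^ (-(1/2) : ℝ) : ℝ) : ℂ)) =O[atTop] (fun u : ℝ => u ^ (-(1/2) : ℝ)) := by
    apply Asymptotics.IsBigO.of_bound ‖(k⁻¹) ^ (1/2 : ℂ)‖
    filter_upwards with u
    rw [norm_mul, norm_real]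
  have hconv : MellinConvergent (fun u : ℝ => th k u - 1 - (k⁻¹) ^ (1/2 : ℂ) * ((u ^ (-(1/2) : ℝ) : ℝ) : ℂ)) s := by
    refine mellinConvergent_of_isBigO_rpow (a := 1/2) (b := 0) ?_ ?_ hs2 ?_ hs
    · exact (((TP k hk).hf_int).sub (locallyIntegrableOn_const _)).sub hli
    · exact (th_top hk _).sub hb
    · have h := (TP k hk).hf_zero 0
      have h2 : (fun _ : ℝ => (1:ℂ)) =O[𝓝[>] 0] (fun x : ℝ => x ^ (0:ℝ)) := by
        apply Asymptotics.isBigO_of_le; intro x; simp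
      have h3 := h.sub h2
      rw [neg_zero]
      refine h3.congr_left ?_
      intro x; simp [TP]; ring
  refine ⟨hconv, ?_⟩
  have hm := (TP k hk).isStrongFEPair_toStrongFEPair.hasMellin s
  have h1 := hasMellin_one_Ioc hs
  have h2 : HasMellin ((Ioi 1).indicator (fun u : ℝ => (k⁻¹) ^ (1/2 : ℂ) * ((u ^ (-(1/2) : ℝ) : ℝ) : ℂ))) s
      ((k⁻¹) ^ (1/2 : ℂ) / (1/2 - s)) := by
    have hre : (s - 3/2).re < -1 := by simp; linarith
    have e : ∀ u ∈ Ioi (0:ℝ), (u:ℂ) ^ (s-1) • ((Ioi 1).indicator (fun u : ℝ => (k⁻¹) ^ (1/2 : ℂ) * ((u ^ (-(1/2) : ℝ) : ℝ) : ℂ))) u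
        = (Ioi 1).indicator (fun u : ℝ => (k⁻¹) ^ (1/2 : ℂ) * (u:ℂ) ^ (s - 3/2)) u := by
      intro u hu
      have hu' : (0:ℝ) < u := hu
      by_cases h : u ∈ Ioi (1:ℝ)
      · rw [indicator_of_mem h, indicator_of_mem h, smul_eq_mul, ofReal_cpow hu'.le,
          show s - 3/2 = (s - 1) + ((-(1/2) : ℝ) : ℂ) by push_cast; ring, cpow_add _ _ (by exact_mod_cast hu'.ne')]
        ring
      · rw [indicator_of_notMem h, indicator_of_notMem h, smul_zero]
    constructor
    · rw [MellinConvergent, integrableOn_congr_fun e measurableSet_Ioi]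
      apply Integrable.integrableOn
      rw [integrable_indicator_iff measurableSet_Ioi]
      exact ((integrableOn_Ioi_cpow_iff one_pos).2 hre).const_mul _
    · rw [mellin, setIntegral_congr_fun measurableSet_Ioi e, setIntegral_indicator measurableSet_Ioi,
        show Ioi (0:ℝ) ∩ Ioi 1 = Ioi 1 by rw [Ioi_inter_Ioi]; simp, integral_const_mul,
        integral_Ioi_cpow_of_lt hre one_pos]
      simp only [ofReal_one, one_cpow]
      rw [show s - 3/2 + 1 = -(1/2 - s) by ring, neg_div_neg_eq, mul_one_div]
  have h3 := hasMellin_add h1.1 h2.1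
  have h4 := hasMellin_sub hm.1 h3.1
  have e : mellin (fun u : ℝ => th k u - 1 - (k⁻¹) ^ (1/2 : ℂ) * ((u ^ (-(1/2) : ℝ) : ℝ) : ℂ)) s = mellin (fun t => (TP k hk).toStrongFEPair.f t -
      ((Ioc 0 1).indicator (fun _ => 1 : ℝ → ℂ) t + (Ioi 1).indicator (fun u : ℝ => (k⁻¹) ^ (1/2 : ℂ) * ((u ^ (-(1/2) : ℝ) : ℝ) : ℂ)) t)) s := by
    rw [mellin, mellin]
    refine setIntegral_congr_ae measurableSet_Ioi ?_
    have : ∀ᵐ x : ℝ, x ≠ 1 := by simp [ae_iff]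
    filter_upwards [this] with x hx hx0
    have hx0' : 0 < x := hx0
    congr 1
    show _ = (TP k hk).f_modif x - _
    rw [WeakFEPair.f_modif]
    rcases lt_or_gt_of_ne hx with h | h
    · have a1 : x ∉ Ioi (1:ℝ) := by simp; exact h.le
      have a2 : x ∈ Ioo (0:ℝ) 1 := ⟨hx0, h⟩
      have a3 : x ∈ Ioc (0:ℝ) 1 := ⟨hx0, h.le⟩
      rw [Pi.add_apply, indicator_of_notMem a1, indicator_of_notMem a1, indicator_of_mem a2, indicator_of_mem a3]
      simp [TP]; ring
    · have a1 : x ∈ Ioi (1:ℝ) := h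
      have a2 : x ∉ Ioo (0:ℝ) 1 := fun hh => by linarith [hh.2]
      have a3 : x ∉ Ioc (0:ℝ) 1 := fun hh => by linarith [hh.2]
      rw [Pi.add_apply, indicator_of_mem a1, indicator_of_mem a1, indicator_of_notMem a2, indicator_of_notMem a3]
      simp [TP]
  rw [e, h4.2, h3.2, h1.2, h2.2, WeakFEPair.Λ]
  show (TP k hk).f_modif |> fun f => mellin f s - _ = _
  simp only [WeakFEPair.Λ₀, TP]
  push_cast
  simp only [smul_eq_mul]; ring
end Sel

namespace Sel
open MeasureTheory Set Filter Topology Complex FourierTransform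

theorem four1 {f : ℝ → ℂ} (h1 : Integrable f) (h2 : MemLp f 2) :
    Integrable (fun t => ‖𝓕 f (t / (2 * Real.pi))‖ ^ 2) ∧
      ∫ t, ‖𝓕 f (t / (2 * Real.pi))‖ ^ 2 = 2 * Real.pi * ∫ t, ‖f t‖ ^ 2 := by
  obtain ⟨a, b⟩ := planch h1 h2
  have hp : (2 * Real.pi) ≠ 0 := by positivity
  refine ⟨a.comp_div hp, ?_⟩
  rw [Measure.integral_comp_div (fun t => ‖𝓕 f t‖ ^ 2), b, abs_of_pos (by positivity), smul_eq_mul]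

noncomputable def KK (h u : ℝ) : ℂ := ∫ y in (0:ℝ)..h, cexp (-I * y * u)

theorem KK_le {h : ℝ} (hh : 0 < h) (u : ℝ) : ‖KK h u‖ ≤ 3 * h / (1 + h * |u|) := by
  have a1 : ‖KK h u‖ ≤ h := by
    have := intervalIntegral.norm_integral_le_of_norm_le_const (a := 0) (b := h) (C := 1)
      (f := fun y : ℝ => cexp (-I * y * u)) (by intro y _; simp [Complex.norm_exp])
    simpa [abs_of_pos hh, KK] using this
  have a2 : |u| * ‖KK h u‖ ≤ 2 := by
    rcases eq_or_ne u 0 with rfl | hu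
    · simp
    have hc : (-I * u : ℂ) ≠ 0 := by simpa using hu
    have e : KK h u = ∫ y in (0:ℝ)..h, cexp ((-I * u) * y) := by
      rw [KK]; congr 1; ext y; ring_nf
    rw [e, integral_exp_mul_complex hc, norm_div]
    have : ‖(-I * u : ℂ)‖ = |u| := by simp
    rw [this, mul_div_cancel₀ _ (by simpa using hu)]
    refine (norm_sub_le _ _).trans ?_
    simp [Complex.norm_exp]; norm_num
  rw [le_div_iff₀ (by positivity)]
  nlinarith

theorem KK_cont (h : ℝ) : Continuous (KK h) := by
  unfold KK
  apply intervalIntegral.continuous_parametric_intervalIntegral_of_continuous'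
  fun_prop

theorem four2 {f : ℝ → ℂ} (h1 : Integrable f) (h2 : MemLp f 2) {h : ℝ} (hh : 0 < h) :
    Integrable (fun t => ‖∫ y in t..t+h, 𝓕 f (y / (2 * Real.pi))‖ ^ 2) ∧
      ∫ t, ‖∫ y in t..t+h, 𝓕 f (y / (2 * Real.pi))‖ ^ 2 ≤
        18 * Real.pi * h ^ 2 * ∫ t, ‖f t‖ ^ 2 / (1 + h * |t|) ^ 2 := by
  have hbd : ∀ u, ‖KK h u‖ ≤ 3 * h := fun u => (KK_le hh u).trans (div_le_self (by positivity) (by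
    have := abs_nonneg u; nlinarith))
  have hg1 : Integrable (fun u => KK h u * f u) :=
    h1.bdd_mul (KK_cont h).aestronglyMeasurable (c := 3 * h) (Eventually.of_forall hbd)
  have hg2 : MemLp (fun u => KK h u * f u) 2 := by
    refine MemLp.of_le_mul (c := 3 * h) h2 hg1.aestronglyMeasurable ?_
    filter_upwards with u
    rw [norm_mul]
    gcongr
    exact hbd u
  have e : ∀ t, ∫ y in t..t+h, 𝓕 f (y / (2 * Real.pi)) = 𝓕 (fun u => KK h u * f u) (t / (2 * Real.pi)) := by
    intro t
    have hF : ∀ (g : ℝ → ℂ) (y : ℝ), 𝓕 g (y / (2 * Real.pi)) = ∫ u : ℝ, cexp (-I * y * u) * g u := by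
      intro g y
      rw [Real.fourier_real_eq_integral_exp_smul]
      congr 1; ext u
      rw [smul_eq_mul]; congr 2
      push_cast
      have : (Real.pi : ℂ) ≠ 0 := by exact_mod_cast Real.pi_ne_zero
      field_simp
    simp_rw [hF]
    rw [intervalIntegral.integral_of_le (by linarith), integral_integral_swap]
    · congr 1; ext u
      rw [integral_mul_const, ← mul_assoc]; congr 1
      rw [← intervalIntegral.integral_of_le (by linarith), KK, ← intervalIntegral.integral_const_mul]
      have := intervalIntegral.integral_comp_add_left (a := 0) (b := h) (fun y : ℝ => cexp (-I * y * u)) t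
      rw [add_zero] at this
      rw [← this]
      congr 1; ext y
      rw [← Complex.exp_add]; congr 1; push_cast; ring
    · have : IsFiniteMeasure (volume.restrict (Ioc t (t+h))) := by infer_instance
      have hint : Integrable (fun p : ℝ × ℝ => f p.2) ((volume.restrict (Ioc t (t+h))).prod volume) :=
        h1.comp_snd _
      exact hint.bdd_mul (c := 1) (f := fun p : ℝ × ℝ => cexp (-I * p.1 * p.2)) (by
        apply Continuous.aestronglyMeasurable; fun_prop) (Eventually.of_forall fun p => by simp [Complex.norm_exp])
  simp_rw [e]
  obtain ⟨a, b⟩ := four1 hg1 hg2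
  refine ⟨a, ?_⟩
  rw [b, ← integral_const_mul, ← integral_const_mul]
  have h2' : Integrable (fun u => ‖f u‖ ^ 2) := by simpa using h2.integrable_norm_pow (by norm_num)
  apply integral_mono_of_nonneg
  · filter_upwards with u; positivity
  · apply Integrable.const_mul
    refine h2'.mono' ?_ ?_
    · simp_rw [div_eq_mul_inv]
      refine h2'.aestronglyMeasurable.mul (Continuous.aestronglyMeasurable ?_)
      refine Continuous.inv₀ (by fun_prop) (fun u => ?_)
      have := abs_nonneg u; positivity
    · filter_upwards with u
      rw [Real.norm_of_nonneg (by positivity)]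
      apply div_le_self (by positivity)
      have := abs_nonneg u
      exact one_le_pow₀ (by nlinarith)
  · filter_upwards with u
    rw [norm_mul, mul_pow]
    have := pow_le_pow_left₀ (norm_nonneg _) (KK_le hh u) 2
    calc _ ≤ 2 * Real.pi * ((3 * h / (1 + h * |u|)) ^ 2 * ‖f u‖ ^ 2) := by gcongr
      _ = _ := by rw [div_pow]; ring
end Sel

namespace Sel
open MeasureTheory Set Filter Topology Complex FourierTransform
open scoped ComplexConjugate

noncomputable def FF (k : ℂ) (u : ℝ) : ℂ := th k u - 1 - (k⁻¹) ^ (1/2 : ℂ) * ((u ^ (-(1/2) : ℝ) : ℝ) : ℂ)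
noncomputable def om (k : ℂ) (y : ℝ) : ℂ := (1/2 : ℂ) * FF k (y ^ (2:ℝ))
noncomputable def HH (k : ℂ) (β : ℕ → ℝ) (N : ℕ) (x : ℝ) : ℂ :=
  ∑ m ∈ Finset.Icc 1 N, ∑ n ∈ Finset.Icc 1 N, ((β m * β n / n : ℝ) : ℂ) * om k (((m:ℝ) / n) * x)
noncomputable def f1 (k : ℂ) (β : ℕ → ℝ) (N : ℕ) (u : ℝ) : ℂ := Real.exp (-(1/2) * u) • HH k β N (Real.exp (-u))
noncomputable def phi (β : ℕ → ℝ) (N : ℕ) (s : ℂ) : ℂ := ∑ n ∈ Finset.Icc 1 N, (β n : ℂ) * (n:ℂ) ^ (-s)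

theorem om_mellin {k : ℂ} (hk : 0 < k.re) {s : ℂ} (hs : 0 < s.re) (hs2 : s.re < 1) :
    HasMellin (om k) s ((1/2) * k ^ (-s/2) * completedRiemannZeta s) := by
  have h := th_mellin hk (s := s / 2) (by simpa using hs) (by simp; linarith)
  have c : MellinConvergent (fun y : ℝ => FF k (y ^ (2:ℝ))) s := by
    rw [MellinConvergent.comp_rpow two_ne_zero]; push_cast; exact h.1
  have e : mellin (fun y : ℝ => FF k (y ^ (2:ℝ))) s = k ^ (-s/2) * completedRiemannZeta s := by
    rw [mellin_comp_rpow]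
    have := h.2
    push_cast
    rw [show mellin (FF k) (s/2) = _ from this, abs_of_pos two_pos, real_smul]
    rw [show 2 * (s/2) = s by ring, show -(s/2) = -s/2 by ring]
    push_cast; ring
  have := hasMellin_const_smul c (1/2 : ℂ)
  rw [e, smul_eq_mul] at this
  rw [mul_assoc]
  exact this

theorem hasMellin_sum {ι : Type*} (S : Finset ι) (f : ι → ℝ → ℂ) (m : ι → ℂ) (s : ℂ)
    (h : ∀ i ∈ S, HasMellin (f i) s (m i)) : HasMellin (fun x => ∑ i ∈ S, f i x) s (∑ i ∈ S, m i) := by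
  constructor
  · simp only [MellinConvergent, Finset.smul_sum]
    exact integrable_finsetSum _ fun i hi => (h i hi).1
  · simp only [mellin, Finset.smul_sum]
    rw [integral_finsetSum _ fun i hi => (h i hi).1]
    exact Finset.sum_congr rfl fun i hi => (h i hi).2

theorem HH_mellin {k : ℂ} (hk : 0 < k.re) (β : ℕ → ℝ) (N : ℕ) (t : ℝ) :
    HasMellin (HH k β N) (1/2 + t * I) ((1/2) * k ^ (-(1/2 + t * I)/2) * completedRiemannZeta (1/2 + t * I) *
      (‖phi β N (1/2 + t * I)‖ ^ 2 : ℝ)) := by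
  set s : ℂ := 1/2 + t * I with hs
  have hre : s.re = 1/2 := by simp [hs]
  set m0 := (1/2) * k ^ (-s/2) * completedRiemannZeta s
  have h0 := om_mellin hk (s := s) (by rw [hre]; norm_num) (by rw [hre]; norm_num)
  have h1 : HasMellin (HH k β N) s (∑ m ∈ Finset.Icc 1 N, ∑ n ∈ Finset.Icc 1 N, ((β m * β n / n : ℝ) : ℂ) * ((((m:ℝ) / n : ℝ) : ℂ) ^ (-s) * m0)) := by
    apply hasMellin_sum
    intro m hm
    apply hasMellin_sum
    intro n hn
    have hp : (0:ℝ) < (m:ℝ) / n := by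
      simp only [Finset.mem_Icc] at hm hn
      have : 0 < m := by lia
      have : 0 < n := by lia
      positivity
    have c : MellinConvergent (fun x => om k (((m:ℝ) / n) * x)) s := (MellinConvergent.comp_mul_left hp).2 h0.1
    have := hasMellin_const_smul c (((β m * β n / n : ℝ) : ℂ))
    rw [mellin_comp_mul_left _ _ hp, h0.2] at this
    exact this
  convert h1 using 1
  have e : ((‖phi β N s‖ ^ 2 : ℝ) : ℂ) = phi β N s * conj (phi β N s) := by
    rw [mul_conj, normSq_eq_norm_sq]
  rw [e, phi, map_sum, Finset.sum_mul_sum, Finset.mul_sum]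
  refine Finset.sum_congr rfl fun m hm => ?_
  rw [Finset.mul_sum]
  refine Finset.sum_congr rfl fun n hn => ?_
  simp only [Finset.mem_Icc] at hm hn
  have hm0 : (0:ℝ) < m := by exact_mod_cast hm.1
  have hn0 : (0:ℝ) < n := by exact_mod_cast hn.1
  have e2 : conj ((n:ℂ) ^ (-s)) = (n:ℂ)⁻¹ * (n:ℂ) ^ s := by
    have h2 : conj ((n:ℂ) ^ (-s)) = (n:ℂ) ^ (-conj s) := by
      have := conj_cpow (n:ℂ) (-conj s) (by rw [natCast_arg]; exact Real.pi_pos.ne)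
      rw [conj_natCast] at this; rw [this]; simp
    rw [h2, show -conj s = s + (-1) by
      simp [hs, Complex.ext_iff]; norm_num, cpow_add _ _ (by exact_mod_cast hn0.ne'), cpow_neg_one]; ring
  rw [map_mul, conj_ofReal, e2]
  have e3 : (((m:ℝ) / n : ℝ) : ℂ) ^ (-s) = (m:ℂ) ^ (-s) * (n:ℂ) ^ s := by
    rw [div_eq_mul_inv, ofReal_mul, mul_cpow_ofReal_nonneg hm0.le (by positivity), ofReal_inv,
      inv_cpow _ _ (by rw [arg_ofReal_of_nonneg hn0.le]; exact Real.pi_pos.ne)]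
    simp only [ofReal_natCast]
    rw [cpow_neg (n : ℂ), inv_inv]
  rw [e3]; push_cast; ring

theorem f1_four {k : ℂ} (hk : 0 < k.re) (β : ℕ → ℝ) (N : ℕ) (t : ℝ) :
    𝓕 (f1 k β N) (t / (2 * Real.pi)) = (1/2) * k ^ (-(1/2 + t * I)/2) * completedRiemannZeta (1/2 + t * I) *
      (‖phi β N (1/2 + t * I)‖ ^ 2 : ℝ) := by
  have h := (HH_mellin hk β N t).2
  rw [mellin_eq_fourier] at h
  rw [← h]
  have h1 : (1/2 + t * I : ℂ).re = 1/2 := by simp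
  have h2 : (1/2 + t * I : ℂ).im = t := by simp
  rw [h1, h2]
  rfl

theorem f1_int {k : ℂ} (hk : 0 < k.re) (β : ℕ → ℝ) (N : ℕ) : Integrable (f1 k β N) := by
  have h := (HH_mellin hk β N 0).1
  have hi : (fun x : ℝ => Real.exp (-x)) '' univ = Ioi 0 := by
    rw [image_univ]
    ext y; simp only [Set.mem_range, Set.mem_Ioi]
    constructor
    · rintro ⟨x, rfl⟩; exact Real.exp_pos _
    · intro hy; exact ⟨-Real.log y, by simp [Real.exp_log hy]⟩
  rw [MellinConvergent, ← hi, integrableOn_image_iff_integrableOn_abs_deriv_smul MeasurableSet.univ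
    (f' := fun x => -Real.exp (-x)) (fun x _ => by simpa using ((hasDerivAt_neg x).exp))
    (fun x _ y _ hxy => by simpa using hxy), integrableOn_univ] at h
  refine h.congr (Eventually.of_forall fun x => ?_)
  dsimp only
  rw [f1, abs_neg, abs_of_pos (Real.exp_pos _)]
  rw [ofReal_zero, zero_mul, add_zero, show (1/2 - 1 : ℂ) = ((-(1/2) : ℝ) : ℂ) by push_cast; norm_num,
    ← ofReal_cpow (Real.exp_pos _).le, ← Real.exp_mul]
  rw [smul_eq_mul, real_smul, real_smul, ← mul_assoc, ← ofReal_mul, ← Real.exp_add]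
  congr 3; ring

theorem conj_th {k : ℂ} (u : ℝ) : conj (th k u) = th (conj k) u := by
  rw [th, th, jacobiTheta_eq_jacobiTheta₂, jacobiTheta_eq_jacobiTheta₂, jacobiTheta₂_conj]
  simp

theorem om_inv {k : ℂ} (hk : 0 < k.re) (hk1 : ‖k‖ = 1) {y : ℝ} (hy : 0 < y) :
    om k (1 / y) = (k⁻¹) ^ (1/2 : ℂ) * y * conj (om k y) := by
  have k0 : k ≠ 0 := by rintro rfl; simp at hk
  have hc : conj k = k⁻¹ := by rw [inv_def, normSq_eq_norm_sq, hk1]; simp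
  have harg : k.arg ≠ Real.pi := by
    intro h; rw [arg_eq_pi_iff] at h; linarith [h.1]
  have e1 : conj ((k⁻¹) ^ (1/2 : ℂ)) = ((k⁻¹) ^ (1/2 : ℂ))⁻¹ := by
    have h1 : conj (1/2 : ℂ) = 1/2 := by simp [Complex.ext_iff]
    have h2 := conj_cpow k (1/2) harg
    rw [h1, hc, inv_cpow _ _ harg] at h2
    rw [inv_cpow _ _ harg, map_inv₀, ← h2]
  have e2 : ((y:ℝ) ^ (2:ℝ)) ^ (-(1/2) : ℝ) = y⁻¹ := by
    rw [← Real.rpow_mul hy.le]; norm_num [Real.rpow_neg_one]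
  have e3 : ((1/y:ℝ) ^ (2:ℝ)) ^ (-(1/2) : ℝ) = y := by
    rw [← Real.rpow_mul (by positivity)]; norm_num [Real.rpow_neg_one]
  have e4 : ((1/y:ℝ) ^ (2:ℝ)) = 1 / (y ^ (2:ℝ)) := by
    rw [Real.div_rpow (by norm_num) hy.le, Real.one_rpow]
  have e5 : ((y:ℝ) ^ (2:ℝ)) ^ ((1/2) : ℝ) = y := by
    rw [← Real.rpow_mul hy.le]; norm_num
  have hε : (k⁻¹) ^ (1/2 : ℂ) ≠ 0 := by
    rw [Ne, cpow_eq_zero_iff]; simp [k0]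
  rw [om, om, FF, FF, e3, e2, e4, th_feq hk (by positivity), e5, map_mul, map_sub, map_sub, conj_th, hc,
    map_mul, e1]
  simp only [map_one, conj_ofReal]
  generalize (k⁻¹) ^ (1/2 : ℂ) = ε at hε ⊢
  have : (y:ℂ) ≠ 0 := by exact_mod_cast hy.ne'
  simp only [map_div₀, map_one, ofReal_inv]
  rw [show conj (2:ℂ) = 2 from conj_ofNat 2]
  field_simp
  ring

theorem HH_inv {k : ℂ} (hk : 0 < k.re) (hk1 : ‖k‖ = 1) (β : ℕ → ℝ) (N : ℕ) {x : ℝ} (hx : 0 < x) :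
    ‖HH k β N (1/x)‖ = x * ‖HH k β N x‖ := by
  have : HH k β N (1/x) = (k⁻¹) ^ (1/2 : ℂ) * x * conj (HH k β N x) := by
    rw [HH, HH, map_sum, Finset.mul_sum, Finset.sum_comm]
    refine Finset.sum_congr rfl fun n hn => ?_
    rw [map_sum, Finset.mul_sum]
    refine Finset.sum_congr rfl fun m hm => ?_
    simp only [Finset.mem_Icc] at hm hn
    have hm0 : (0:ℝ) < m := by exact_mod_cast hm.1
    have hn0 : (0:ℝ) < n := by exact_mod_cast hn.1
    rw [show (m:ℝ) / n * (1/x) = 1 / ((n:ℝ)/m * x) by field_simp, om_inv hk hk1 (by positivity)]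
    rw [map_mul, conj_ofReal]
    push_cast
    have : (n:ℂ) ≠ 0 := by exact_mod_cast hn0.ne'
    field_simp
  rw [this, norm_mul, norm_mul, RCLike.norm_conj, norm_real, Real.norm_of_nonneg hx.le]
  have : ‖(k⁻¹) ^ (1/2 : ℂ)‖ = 1 := by
    rw [norm_cpow_of_ne_zero (by apply inv_ne_zero; rintro rfl; simp at hk)]
    simp [hk1]
  rw [this, one_mul]

theorem f1_even {k : ℂ} (hk : 0 < k.re) (hk1 : ‖k‖ = 1) (β : ℕ → ℝ) (N : ℕ) (u : ℝ) :
    ‖f1 k β N (-u)‖ = ‖f1 k β N u‖ := by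
  have := HH_inv hk hk1 β N (Real.exp_pos u)
  rw [f1, f1, norm_smul, norm_smul, Real.norm_of_nonneg (Real.exp_pos _).le, Real.norm_of_nonneg (Real.exp_pos _).le,
    Real.exp_neg u, ← one_div, this, neg_neg, ← mul_assoc, ← Real.exp_add]
  congr 2; ring

theorem om_cont {k : ℂ} (hk : 0 < k.re) : ContinuousOn (om k) (Ioi 0) := by
  have h1 : ContinuousOn (fun y : ℝ => y ^ (2:ℝ)) (Ioi 0) :=
    (Real.continuous_rpow_const (by norm_num)).continuousOn
  have h3 : MapsTo (fun y : ℝ => y ^ (2:ℝ)) (Ioi 0) (Ioi 0) := fun y hy => Real.rpow_pos_of_pos hy _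
  have h2 : ContinuousOn (FF k) (Ioi 0) := by
    refine ((th_cont hk).sub continuousOn_const).sub ?_
    refine continuousOn_of_forall_continuousAt (fun x (hx : 0 < x) ↦ ?_)
    have : x ≠ 0 ∨ 0 ≤ -(1/2:ℝ) := Or.inl hx.ne'
    fun_prop
  exact continuousOn_const.mul (h2.comp h1 h3)

theorem HH_cont {k : ℂ} (hk : 0 < k.re) (β : ℕ → ℝ) (N : ℕ) : ContinuousOn (HH k β N) (Ioi 0) := by
  unfold HH
  refine continuousOn_finsetSum _ fun m hm => continuousOn_finsetSum _ fun n hn => ?_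
  refine continuousOn_const.mul ((om_cont hk).comp (by fun_prop) fun x hx => ?_)
  simp only [Finset.mem_Icc] at hm hn
  have hm0 : (0:ℝ) < m := by exact_mod_cast hm.1
  have hn0 : (0:ℝ) < n := by exact_mod_cast hn.1
  have : (0:ℝ) < x := hx
  show (0:ℝ) < _
  positivity

theorem om_top {k : ℂ} (hk : 0 < k.re) : om k =O[atTop] (fun x : ℝ => x⁻¹) := by
  have h1 : FF k =O[atTop] (fun u : ℝ => u ^ (-(1/2):ℝ)) := by
    refine (th_top hk _).sub ?_
    apply Asymptotics.IsBigO.of_bound ‖(k⁻¹) ^ (1/2 : ℂ)‖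
    filter_upwards with u
    rw [norm_mul, norm_real]
  have h2 := h1.comp_tendsto (tendsto_rpow_atTop (show (0:ℝ) < 2 by norm_num))
  have h3 := h2.const_mul_left (1/2 : ℂ)
  refine h3.congr' (by rfl) ?_
  filter_upwards [eventually_gt_atTop 0] with x hx
  simp only [Function.comp]
  rw [← Real.rpow_mul hx.le]; norm_num [Real.rpow_neg_one]

theorem HH_top {k : ℂ} (hk : 0 < k.re) (β : ℕ → ℝ) (N : ℕ) : HH k β N =O[atTop] (fun x : ℝ => x⁻¹) := by
  unfold HH
  refine Asymptotics.IsBigO.fun_sum fun m hm => ?_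
  refine Asymptotics.IsBigO.fun_sum fun n hn => ?_
  apply Asymptotics.IsBigO.const_mul_left
  simp only [Finset.mem_Icc] at hm hn
  have hm0 : (0:ℝ) < m := by exact_mod_cast hm.1
  have hn0 : (0:ℝ) < n := by exact_mod_cast hn.1
  have := (om_top hk).comp_tendsto ((tendsto_id (α := ℝ)).const_mul_atTop (show (0:ℝ) < (m:ℝ)/n by positivity))
  refine this.trans ?_
  apply Asymptotics.IsBigO.of_bound (((m:ℝ)/n)⁻¹)
  filter_upwards with x
  simp [mul_comm]

theorem HH_sq {k : ℂ} (hk : 0 < k.re) (β : ℕ → ℝ) (N : ℕ) :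
    IntegrableOn (fun x => ‖HH k β N x‖ ^ 2) (Ioi 1) := by
  have hc : ContinuousOn (fun x => ‖HH k β N x‖ ^ 2) (Set.Ici 1) :=
    ((HH_cont hk β N).mono (fun x hx => by have : (1:ℝ) ≤ x := hx; show (0:ℝ) < x; linarith)).norm.pow 2
  have := (hc.locallyIntegrableOn measurableSet_Ici).integrableOn_of_isBigO_atTop (μ := volume)
    (g := fun x : ℝ => x ^ (-2 : ℝ)) ?_ ?_
  · exact this.mono_set Ioi_subset_Ici_self
  · refine ((HH_top hk β N).norm_left.pow 2).congr' (by rfl) ?_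
    filter_upwards [eventually_gt_atTop 0] with x hx
    rw [Real.rpow_neg hx.le]; simp
  · exact ⟨Ioi 1, Ioi_mem_atTop 1, integrableOn_Ioi_rpow_of_lt (by norm_num) one_pos⟩

theorem f1_W {k : ℂ} (hk : 0 < k.re) (hk1 : ‖k‖ = 1) (β : ℕ → ℝ) (N : ℕ) {h : ℝ} (hh : 0 ≤ h) :
    Integrable (fun u => ‖f1 k β N u‖ ^ 2 / (1 + h * |u|) ^ 2) ∧
    ∫ u, ‖f1 k β N u‖ ^ 2 / (1 + h * |u|) ^ 2 = 2 * ∫ x in Ioi (1:ℝ), ‖HH k β N x‖ ^ 2 / (1 + h * Real.log x) ^ 2 := by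
  have hi : Real.exp '' (Ioi 0) = Ioi 1 := by
    ext y; simp only [Set.mem_image, Set.mem_Ioi]
    constructor
    · rintro ⟨x, hx, rfl⟩; exact Real.one_lt_exp_iff.2 hx
    · intro hy; exact ⟨Real.log y, Real.log_pos hy, Real.exp_log (by linarith)⟩
  have e : ∀ u ∈ Ioi (0:ℝ), |Real.exp u| • (‖HH k β N (Real.exp u)‖ ^ 2 / (1 + h * Real.log (Real.exp u)) ^ 2)
      = ‖f1 k β N u‖ ^ 2 / (1 + h * |u|) ^ 2 := by
    intro u hu
    rw [← f1_even hk hk1, f1, norm_smul, Real.log_exp, abs_of_pos (show (0:ℝ) < u from hu), neg_neg, mul_pow,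
      Real.norm_of_nonneg (Real.exp_pos _).le, ← Real.exp_nat_mul, abs_of_pos (Real.exp_pos _), smul_eq_mul, mul_div_assoc]
    congr 2; push_cast; ring
  have hg : IntegrableOn (fun x => ‖HH k β N x‖ ^ 2 / (1 + h * Real.log x) ^ 2) (Ioi 1) := by
    refine (HH_sq hk β N).mono' ?_ ?_
    · simp_rw [div_eq_mul_inv]
      refine (HH_sq hk β N).aestronglyMeasurable.mul ?_
      apply Measurable.aestronglyMeasurable
      fun_prop
    · filter_upwards [ae_restrict_mem measurableSet_Ioi] with x hx
      rw [Real.norm_of_nonneg (by positivity)]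
      apply div_le_self (by positivity)
      have := Real.log_pos hx
      exact one_le_pow₀ (by nlinarith)
  have hg2 := hg
  rw [← hi, integrableOn_image_iff_integrableOn_abs_deriv_smul measurableSet_Ioi
    (fun x _ => (Real.hasDerivAt_exp x).hasDerivWithinAt) Real.exp_injective.injOn,
    integrableOn_congr_fun e measurableSet_Ioi] at hg2
  have heven : ∀ u, ‖f1 k β N (-u)‖ ^ 2 / (1 + h * |-u|) ^ 2 = ‖f1 k β N u‖ ^ 2 / (1 + h * |u|) ^ 2 := by
    intro u; rw [f1_even hk hk1, abs_neg]
  constructor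
  · have h2 := hg2.comp_neg
    simp_rw [heven] at h2
    rw [← integrableOn_univ, ← Set.Iic_union_Ioi (a := (0:ℝ))]
    refine IntegrableOn.union ?_ hg2
    rw [integrableOn_Iic_iff_integrableOn_Iio]
    simpa using h2
  · rw [← hi, integral_image_eq_integral_abs_deriv_smul measurableSet_Ioi
      (fun x _ => (Real.hasDerivAt_exp x).hasDerivWithinAt) Real.exp_injective.injOn,
      setIntegral_congr_fun measurableSet_Ioi e, ← integral_comp_abs (f := fun u => ‖f1 k β N u‖ ^ 2 / (1 + h * |u|) ^ 2)]
    congr 1; ext u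
    rcases le_total 0 u with hu | hu
    · simp only [abs_of_nonneg hu]
    · rw [abs_of_nonpos hu, f1_even hk hk1, abs_neg, abs_of_nonpos hu]

theorem f1_memLp {k : ℂ} (hk : 0 < k.re) (hk1 : ‖k‖ = 1) (β : ℕ → ℝ) (N : ℕ) : MemLp (f1 k β N) 2 := by
  rw [memLp_two_iff_integrable_sq_norm (f1_int hk β N).aestronglyMeasurable]
  simpa using (f1_W hk hk1 β N le_rfl).1
end Sel

namespace Sel
open MeasureTheory Set Filter Topology Complex

noncomputable def ww (h x : ℝ) : ℝ := ((1 + h * Real.log x) ^ 2)⁻¹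

theorem ww_pos {h x : ℝ} (hh : 0 ≤ h) (hx : 1 ≤ x) : 0 < ww h x ∧ ww h x ≤ 1 := by
  have := Real.log_nonneg hx
  have : 0 ≤ h * Real.log x := by positivity
  exact ⟨by unfold ww; positivity, inv_le_one_of_one_le₀ (one_le_pow₀ (by linarith))⟩

theorem ww_meas (h : ℝ) : Measurable (ww h) := by unfold ww; fun_prop

theorem osc {h : ℝ} (hh : 0 ≤ h) {z : ℂ} (hz : 0 < z.re) :
    ‖∫ x in Ioi (1:ℝ), (ww h x : ℂ) * cexp (-z * (x:ℂ) ^ 2)‖ ≤ Real.exp (-z.re) / ‖z‖ := by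
  have hz0 : z ≠ 0 := by rintro rfl; simp at hz
  have hzn : 0 < ‖z‖ := norm_pos_iff.2 hz0
  set W : ℝ → ℝ := fun x => ww h x / (2 * x) with hW
  set W' : ℝ → ℝ := fun x => -((2 * h / (x * (1 + h * Real.log x) ^ 3)) * (2 * x) + ww h x * 2) / (2 * x) ^ 2 with hW'
  have hl : ∀ x : ℝ, 1 ≤ x → 0 < 1 + h * Real.log x := fun x hx => by
    have := Real.log_nonneg hx; positivity
  have hd : ∀ x : ℝ, 1 ≤ x → HasDerivAt W (W' x) x := by
    intro x hx
    have hx0 : 0 < x := by linarith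
    have h0 := hl x hx
    have h1 : HasDerivAt (fun x => 1 + h * Real.log x) (h * x⁻¹) x :=
      ((Real.hasDerivAt_log hx0.ne').const_mul h).const_add 1
    have h2 := (h1.pow 2).inv (pow_ne_zero 2 h0.ne')
    have h3 := h2.div ((hasDerivAt_id x).const_mul 2) (by simp; positivity)
    refine h3.congr_deriv ?_
    simp only [hW', ww, id, Pi.pow_apply, Pi.inv_apply]
    field_simp
    ring
  have hneg : ∀ x ∈ Ioi (1:ℝ), W' x ≤ 0 := by
    intro x hx
    have hx1 : (1:ℝ) < x := hx
    have h0 := hl x hx1.le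
    have := (ww_pos hh hx1.le).1
    have : 0 ≤ ((2 * h / (x * (1 + h * Real.log x) ^ 3)) * (2 * x) + ww h x * 2) / (2 * x) ^ 2 := by positivity
    simp only [hW', neg_div]; linarith
  have htop : Tendsto W atTop (𝓝 0) := by
    refine squeeze_zero' (g := fun x : ℝ => x⁻¹) ?_ ?_ tendsto_inv_atTop_zero
    · filter_upwards [eventually_ge_atTop 1] with x hx
      have := (ww_pos hh hx).1
      simp only [hW]; positivity
    · filter_upwards [eventually_ge_atTop 1] with x hx
      have := (ww_pos hh hx)
      simp only [hW]
      rw [div_le_iff₀ (by positivity)]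
      have : x⁻¹ * (2 * x) = 2 := by field_simp
      rw [this]; linarith
  have hWi := integrableOn_Ioi_deriv_of_nonpos (hd 1 le_rfl).continuousAt.continuousWithinAt
    (fun x hx => hd x (le_of_lt hx)) hneg htop
  have hWI := integral_Ioi_of_hasDerivAt_of_nonpos (hd 1 le_rfl).continuousAt.continuousWithinAt
    (fun x hx => hd x (le_of_lt hx)) hneg htop
  have hW1 : W 1 = 1/2 := by simp [hW, ww]
  set v : ℝ → ℂ := fun x => -(cexp (-z * (x:ℂ) ^ 2) / z) with hv
  set v' : ℝ → ℂ := fun x => 2 * x * cexp (-z * (x:ℂ) ^ 2) with hv'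
  have hvd : ∀ x : ℝ, HasDerivAt v (v' x) x := by
    intro x
    have h1 : HasDerivAt (fun x : ℝ => -z * (x:ℂ) ^ 2) (-z * (2 * x)) x := by
      have := ((hasDerivAt_id x).ofReal_comp.pow 2).const_mul (-z)
      simpa using this
    have := (h1.cexp.div_const z).neg
    refine this.congr_deriv ?_
    simp only [hv']; field_simp
  have hvn : ∀ x : ℝ, 1 ≤ x → ‖v x‖ ≤ Real.exp (-z.re) / ‖z‖ := by
    intro x hx
    simp only [hv]
    rw [norm_neg, norm_div, norm_exp]
    have : (-z * (x:ℂ) ^ 2).re = -(z.re * x ^ 2) := by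
      rw [← ofReal_pow, re_mul_ofReal]; simp
    rw [this]
    gcongr
    nlinarith [mul_le_mul_of_nonneg_left (one_le_pow₀ hx : 1 ≤ x ^ 2) hz.le]
  have hvc : Continuous v := continuous_iff_continuousAt.2 fun x => (hvd x).continuousAt
  have hWc : ContinuousOn W (Ioi 1) := fun x hx => (hd x (le_of_lt hx)).continuousAt.continuousWithinAt
  have e : ∀ x ∈ Ioi (1:ℝ), (ww h x : ℂ) * cexp (-z * (x:ℂ) ^ 2) = (W x : ℂ) * v' x := by
    intro x hx
    have hx1 : (1:ℝ) < x := hx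
    have : (x:ℂ) ≠ 0 := by exact_mod_cast (by positivity : x ≠ 0)
    simp only [hW, hv']; push_cast; field_simp
  have i1 : IntegrableOn (fun x : ℝ => (W x : ℂ) * v' x) (Ioi 1) := by
    rw [← integrableOn_congr_fun e measurableSet_Ioi]
    refine Integrable.mono (integrable_cexp_neg_mul_sq hz).integrableOn ?_ ?_
    · refine (measurable_ofReal.comp (ww_meas h)).aestronglyMeasurable.mul ?_
      exact (by fun_prop : Continuous fun x : ℝ => cexp (-z * (x:ℂ) ^ 2)).aestronglyMeasurable
    · filter_upwards [ae_restrict_mem measurableSet_Ioi] with x hx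
      have := ww_pos hh (le_of_lt hx)
      rw [norm_mul, norm_real, Real.norm_of_nonneg this.1.le]
      exact mul_le_of_le_one_left (norm_nonneg _) this.2
  have i2 : IntegrableOn (fun x : ℝ => (W' x : ℂ) * v x) (Ioi 1) := by
    refine Integrable.mul_bdd (c := Real.exp (-z.re) / ‖z‖) hWi.ofReal hvc.aestronglyMeasurable ?_
    filter_upwards [ae_restrict_mem measurableSet_Ioi] with x hx
    exact hvn x (le_of_lt hx)
  have ibp := integral_Ioi_mul_deriv_eq_deriv_mul (a := 1) (u := fun x => (W x : ℂ)) (u' := fun x => (W' x : ℂ)) (v := v) (v' := v')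
    (a' := (W 1 : ℂ) * v 1) (b' := 0) (fun x hx => (hd x (le_of_lt hx)).ofReal_comp) (fun x _ => hvd x) i1 i2 ?_ ?_
  · rw [setIntegral_congr_fun measurableSet_Ioi e, ibp]
    have b1 : ‖(W 1 : ℂ) * v 1‖ ≤ 1/2 * (Real.exp (-z.re) / ‖z‖) := by
      rw [norm_mul, norm_real, hW1]
      have := hvn 1 le_rfl
      norm_num at this ⊢
      linarith
    have b2 : ‖∫ x in Ioi (1:ℝ), (W' x : ℂ) * v x‖ ≤ 1/2 * (Real.exp (-z.re) / ‖z‖) := by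
      have : (1/2 : ℝ) * (Real.exp (-z.re) / ‖z‖) = ∫ x in Ioi (1:ℝ), -W' x * (Real.exp (-z.re) / ‖z‖) := by
        rw [integral_mul_const, integral_neg, hWI, hW1]; ring
      rw [this]
      refine norm_integral_le_of_norm_le (hWi.neg.mul_const _) ?_
      filter_upwards [ae_restrict_mem measurableSet_Ioi] with x hx
      rw [norm_mul, norm_real, Real.norm_of_nonpos (hneg x hx)]
      exact mul_le_mul_of_nonneg_left (hvn x (le_of_lt hx)) (by linarith [hneg x hx])
    calc _ ≤ ‖(0:ℂ) - (W 1 : ℂ) * v 1‖ + ‖∫ x in Ioi (1:ℝ), (W' x : ℂ) * v x‖ := norm_sub_le _ _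
      _ ≤ _ := by rw [zero_sub, norm_neg]; linarith
  · exact ((continuous_ofReal.tendsto _).comp ((hd 1 le_rfl).continuousAt.tendsto.mono_left nhdsWithin_le_nhds)).mul
      ((hvc.tendsto 1).mono_left nhdsWithin_le_nhds)
  · have h1 : Tendsto (fun x : ℝ => (W x : ℂ)) atTop (𝓝 0) := by
      simpa [Function.comp_def] using (continuous_ofReal.tendsto 0).comp htop
    refine h1.zero_mul_isBoundedUnder_le ?_
    refine isBoundedUnder_of_eventually_le (a := Real.exp (-z.re) / ‖z‖) ?_
    filter_upwards [eventually_ge_atTop 1] with x hx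
    exact hvn x hx
end Sel

namespace Sel
open MeasureTheory Set Filter Topology Complex
open scoped ComplexConjugate

noncomputable def EE (b d : ℕ) : ℝ := (b:ℝ) ^ (-(5/4):ℝ) * (d:ℝ) ^ (-(5/4):ℝ)

theorem EE_nonneg (b d : ℕ) : 0 ≤ EE b d := by unfold EE; positivity

theorem EE_summable : Summable fun p : ℕ × ℕ => EE p.1 p.2 := by
  have h : Summable fun n : ℕ => (n:ℝ) ^ (-(5/4):ℝ) := Real.summable_nat_rpow.2 (by norm_num)
  exact h.mul_of_nonneg h (fun _ => by positivity) (fun _ => by positivity)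

noncomputable def C0 : ℝ := ∑' p : ℕ × ℕ, EE p.1 p.2

theorem C0_nonneg : 0 ≤ C0 := tsum_nonneg fun _ => EE_nonneg _ _

theorem EE_inj (S : Finset (ℕ × ℕ)) (g : ℕ × ℕ → ℕ × ℕ) (hg : Set.InjOn g S) :
    ∑ i ∈ S, EE (g i).1 (g i).2 ≤ C0 := by
  rw [← Finset.sum_image (f := fun p => EE p.1 p.2) hg]
  exact EE_summable.sum_le_tsum _ fun _ _ => EE_nonneg _ _

theorem offsum (p q : ℕ) (hp : 1 ≤ p) (hq : 1 ≤ q) (S : Finset (ℕ × ℕ)) :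
    ∑ i ∈ S, (if i.1 * p = i.2 * q then 0 else EE (min (i.1 * p) (i.2 * q)) (max (i.1 * p) (i.2 * q) - min (i.1 * p) (i.2 * q))) ≤ 2 * C0 := by
  have h1 : ∀ i ∈ S, (if i.1 * p = i.2 * q then 0 else EE (min (i.1 * p) (i.2 * q)) (max (i.1 * p) (i.2 * q) - min (i.1 * p) (i.2 * q)))
    = (if i.2 * q < i.1 * p then EE (i.2 * q) (i.1 * p - i.2 * q) else 0) +
      (if i.1 * p < i.2 * q then EE (i.1 * p) (i.2 * q - i.1 * p) else 0) := by
    intro i _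
    rcases lt_trichotomy (i.1 * p) (i.2 * q) with h | h | h
    · simp [h, h.ne, h.le, not_lt.2 h.le]
    · simp [h]
    · simp [h, h.ne', h.le, not_lt.2 h.le]
  rw [Finset.sum_congr rfl h1, Finset.sum_add_distrib, ← Finset.sum_filter, ← Finset.sum_filter, two_mul]
  refine add_le_add (EE_inj _ (fun i => (i.2 * q, i.1 * p - i.2 * q)) ?_) (EE_inj _ (fun i => (i.1 * p, i.2 * q - i.1 * p)) ?_)
  all_goals
    rintro ⟨i, i'⟩ hi ⟨j, j'⟩ hj hij
    simp only [Finset.coe_filter, Set.mem_ofPred_eq] at hi hj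
    simp only [Prod.mk.injEq] at hij ⊢
    obtain ⟨e1, e2⟩ := hij
    have e3 : i * p = j * p := by omega
    have e4 : i' * q = j' * q := by omega
    exact ⟨Nat.eq_of_mul_eq_mul_right hp e3, Nat.eq_of_mul_eq_mul_right hq e4⟩

theorem offterm {a D : ℝ} {A B : ℕ} {z : ℂ} (ha : 0 < a) (hD : 1 ≤ D) (hB : 1 ≤ B) (hAB : B < A)
    (hre : a * (A:ℝ) ^ 2 / D ^ 2 ≤ z.re) (him : ((A:ℝ) ^ 2 - (B:ℝ) ^ 2) / D ^ 2 ≤ |z.im|) :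
    Real.exp (-z.re) / ‖z‖ ≤ a ^ (-(1/4):ℝ) * D ^ 3 * EE B (A - B) := by
  have hB0 : (1:ℝ) ≤ B := by exact_mod_cast hB
  have hA0 : (B:ℝ) + 1 ≤ A := by exact_mod_cast hAB
  have hA1 : (0:ℝ) < A := by linarith
  set d : ℝ := (A:ℝ) - B with hd
  have hd1 : 1 ≤ d := by linarith
  have hdd : (((A - B : ℕ)) : ℝ) = d := by rw [Nat.cast_sub hAB.le]
  set y := a * (A:ℝ) ^ 2 / D ^ 2 with hy
  have hy0 : 0 < y := by positivity
  have e1 : Real.exp (-z.re) ≤ y ^ (-(1/4):ℝ) := by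
    have : y ^ (1/4:ℝ) ≤ Real.exp y := by
      rw [Real.rpow_def_of_pos hy0, Real.exp_le_exp]
      have := Real.log_le_sub_one_of_pos hy0
      by_cases h : 0 ≤ Real.log y <;> nlinarith
    rw [Real.rpow_neg hy0.le]
    calc Real.exp (-z.re) ≤ Real.exp (-y) := by gcongr
      _ = (Real.exp y)⁻¹ := Real.exp_neg _
      _ ≤ _ := by gcongr
  have e2 : y ^ (-(1/4):ℝ) ≤ a ^ (-(1/4):ℝ) * (A:ℝ) ^ (-(1/2):ℝ) * D := by
    rw [hy, div_eq_mul_inv, Real.mul_rpow (by positivity) (by positivity), Real.mul_rpow ha.le (by positivity)]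
    rw [← Real.rpow_natCast, ← Real.rpow_mul hA1.le, ← Real.rpow_natCast D, ← Real.rpow_neg (by linarith), ← Real.rpow_mul (by linarith)]
    norm_num
    gcongr
    calc D ^ (1/2:ℝ) ≤ D ^ (1:ℝ) := Real.rpow_le_rpow_of_exponent_le hD (by norm_num)
      _ = D := Real.rpow_one D
  have hdA : 0 < d * A / D ^ 2 := by positivity
  have e3 : d * A / D ^ 2 ≤ ‖z‖ := by
    refine le_trans ?_ (him.trans (abs_im_le_norm z))
    gcongr
    nlinarith
  have e4 : (A:ℝ) ^ (-(1/2):ℝ) * (A:ℝ)⁻¹ ≤ (B:ℝ) ^ (-(5/4):ℝ) * d ^ (-(1/4):ℝ) := by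
    have : (A:ℝ) ^ (-(1/2):ℝ) * (A:ℝ)⁻¹ = (A:ℝ) ^ (-(5/4):ℝ) * (A:ℝ) ^ (-(1/4):ℝ) := by
      rw [← Real.rpow_neg_one, ← Real.rpow_add hA1, ← Real.rpow_add hA1]; norm_num
    rw [this]
    exact mul_le_mul (Real.rpow_le_rpow_of_nonpos (by linarith) (by linarith) (by norm_num))
      (Real.rpow_le_rpow_of_nonpos (by linarith) (by linarith) (by norm_num)) (by positivity) (by positivity)
  have e5 : d ^ (-(5/4):ℝ) = d ^ (-(1/4):ℝ) * d⁻¹ := by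
    rw [← Real.rpow_neg_one, ← Real.rpow_add (by linarith)]; norm_num
  calc Real.exp (-z.re) / ‖z‖ ≤ (a ^ (-(1/4):ℝ) * (A:ℝ) ^ (-(1/2):ℝ) * D) / (d * A / D ^ 2) := by
        gcongr; exact e1.trans e2
    _ = a ^ (-(1/4):ℝ) * D ^ 3 * ((A:ℝ) ^ (-(1/2):ℝ) * (A:ℝ)⁻¹) * d⁻¹ := by field_simp
    _ ≤ a ^ (-(1/4):ℝ) * D ^ 3 * ((B:ℝ) ^ (-(5/4):ℝ) * d ^ (-(1/4):ℝ)) * d⁻¹ := by gcongr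
    _ = _ := by rw [EE, hdd, e5]; ring

theorem gauss_ww {h : ℝ} (hh : 0 ≤ h) {z : ℂ} (hz : 0 < z.re) {c : ℝ} (hc : 1 ≤ c) :
    IntegrableOn (fun x : ℝ => (ww h x : ℂ) * cexp (-z * (x:ℂ) ^ 2)) (Ioi c) := by
  refine Integrable.mono (integrable_cexp_neg_mul_sq hz).integrableOn ?_ ?_
  · refine (measurable_ofReal.comp (ww_meas h)).aestronglyMeasurable.mul ?_
    exact (by fun_prop : Continuous fun x : ℝ => cexp (-z * (x:ℂ) ^ 2)).aestronglyMeasurable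
  · filter_upwards [ae_restrict_mem measurableSet_Ioi] with x hx
    have := ww_pos hh (hc.trans (le_of_lt hx))
    rw [norm_mul, norm_real, Real.norm_of_nonneg this.1.le]
    exact mul_le_of_le_one_left (norm_nonneg _) this.2

theorem gauss_wwr {h : ℝ} (hh : 0 ≤ h) {z : ℝ} (hz : 0 < z) {c : ℝ} (hc : 1 ≤ c) :
    IntegrableOn (fun x : ℝ => ww h x * Real.exp (-z * x ^ 2)) (Ioi c) := by
  have := (gauss_ww hh (z := z) (by simpa using hz) hc).re
  refine this.congr (Eventually.of_forall fun x => ?_)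
  dsimp only
  rw [← ofReal_pow, ← ofReal_neg, ← ofReal_mul, ← ofReal_exp, ← ofReal_mul]
  exact ofReal_re _

theorem expand {ι : Type*} (P : Finset ι) (B y : ι → ℝ) {k : ℂ} (hk : 0 < k.re) (hy : ∀ i ∈ P, 0 < y i)
    {h : ℝ} (hh : 0 ≤ h) :
    IntegrableOn (fun x : ℝ => ww h x * ‖∑ i ∈ P, (B i : ℂ) * cexp (-(Real.pi * k * y i ^ 2) * (x:ℂ) ^ 2)‖ ^ 2) (Ioi 1) ∧
    ∫ x in Ioi (1:ℝ), ww h x * ‖∑ i ∈ P, (B i : ℂ) * cexp (-(Real.pi * k * y i ^ 2) * (x:ℂ) ^ 2)‖ ^ 2 ≤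
      ∑ i ∈ P, ∑ j ∈ P, if y i = y j then B i * B j * ∫ x in Ioi (1:ℝ), ww h x * Real.exp (-(2 * Real.pi * k.re * y i ^ 2) * x ^ 2)
        else |B i| * |B j| * (Real.exp (-(Real.pi * (k * y i ^ 2 + conj k * y j ^ 2)).re) / ‖Real.pi * (k * y i ^ 2 + conj k * y j ^ 2)‖) := by
  set z : ι → ι → ℂ := fun i j => Real.pi * (k * y i ^ 2 + conj k * y j ^ 2) with hz
  have hzre : ∀ i j, (z i j).re = Real.pi * k.re * (y i ^ 2 + y j ^ 2) := by
    intro i j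
    simp only [hz]
    rw [re_ofReal_mul, ← ofReal_pow, ← ofReal_pow, add_re, re_mul_ofReal, re_mul_ofReal, conj_re]; ring
  have hzpos : ∀ i ∈ P, ∀ j ∈ P, 0 < (z i j).re := by
    intro i hi j hj
    have := hy i hi
    have := hy j hj
    have := Real.pi_pos
    rw [hzre]; positivity
  have e : ∀ x : ℝ, ww h x * ‖∑ i ∈ P, (B i : ℂ) * cexp (-(Real.pi * k * y i ^ 2) * (x:ℂ) ^ 2)‖ ^ 2 =
      (∑ i ∈ P, ∑ j ∈ P, ((B i * B j : ℝ) : ℂ) * ((ww h x : ℂ) * cexp (-z i j * (x:ℂ) ^ 2))).re := by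
    intro x
    have : ((ww h x * ‖∑ i ∈ P, (B i : ℂ) * cexp (-(Real.pi * k * y i ^ 2) * (x:ℂ) ^ 2)‖ ^ 2 : ℝ) : ℂ) =
      (∑ i ∈ P, ∑ j ∈ P, ((B i * B j : ℝ) : ℂ) * ((ww h x : ℂ) * cexp (-z i j * (x:ℂ) ^ 2))) := by
      rw [ofReal_mul, ← normSq_eq_norm_sq, ← mul_conj, map_sum, Finset.sum_mul_sum, Finset.mul_sum]
      refine Finset.sum_congr rfl fun i _ => ?_
      rw [Finset.mul_sum]
      refine Finset.sum_congr rfl fun j _ => ?_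
      rw [map_mul, ← exp_conj, conj_ofReal]
      have : cexp (-z i j * (x:ℂ) ^ 2) = cexp (-(Real.pi * k * y i ^ 2) * (x:ℂ) ^ 2) * cexp (conj (-(Real.pi * k * y j ^ 2) * (x:ℂ) ^ 2)) := by
        rw [← Complex.exp_add]; congr 1
        simp only [hz, map_mul, map_neg, map_pow, conj_ofReal]; ring
      rw [this]; push_cast; ring
    rw [← this, ofReal_re]
  have hint : ∀ i ∈ P, ∀ j ∈ P, Integrable (fun x : ℝ => ((B i * B j : ℝ) : ℂ) * ((ww h x : ℂ) * cexp (-z i j * (x:ℂ) ^ 2))) (volume.restrict (Ioi 1)) :=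
    fun i hi j hj => (gauss_ww hh (hzpos i hi j hj) le_rfl).const_mul _
  have hint2 : Integrable (fun x : ℝ => ∑ i ∈ P, ∑ j ∈ P, ((B i * B j : ℝ) : ℂ) * ((ww h x : ℂ) * cexp (-z i j * (x:ℂ) ^ 2))) (volume.restrict (Ioi 1)) :=
    integrable_finsetSum _ fun i hi => integrable_finsetSum _ fun j hj => hint i hi j hj
  refine ⟨by simp_rw [e]; exact hint2.re, ?_⟩
  simp_rw [e]
  have : ∫ x in Ioi (1:ℝ), (∑ i ∈ P, ∑ j ∈ P, ((B i * B j : ℝ) : ℂ) * ((ww h x : ℂ) * cexp (-z i j * (x:ℂ) ^ 2))).re =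
    (∫ x in Ioi (1:ℝ), (∑ i ∈ P, ∑ j ∈ P, ((B i * B j : ℝ) : ℂ) * ((ww h x : ℂ) * cexp (-z i j * (x:ℂ) ^ 2)))).re := integral_re hint2
  rw [this, integral_finsetSum _ fun i hi => integrable_finsetSum _ fun j hj => hint i hi j hj, re_sum]
  refine Finset.sum_le_sum fun i hi => ?_
  rw [integral_finsetSum _ fun j hj => hint i hi j hj, re_sum]
  refine Finset.sum_le_sum fun j hj => ?_
  rw [integral_const_mul, re_ofReal_mul]
  split_ifs with hij
  · apply le_of_eq
    congr 1
    rw [← ofReal_re (∫ x in Ioi (1:ℝ), ww h x * Real.exp (-(2 * Real.pi * k.re * y i ^ 2) * x ^ 2)), ← integral_complex_ofReal]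
    congr 2
    ext x
    push_cast
    congr 3
    simp only [hz, ← hij]
    rw [← add_mul, add_conj]; push_cast; ring
  · rw [← abs_mul]
    refine (le_abs_self _).trans ?_
    rw [abs_mul]
    gcongr
    exact (abs_re_le_norm _).trans (osc hh (hzpos i hi j hj))
end Sel

namespace Sel
open MeasureTheory Set Filter Topology

theorem gsum_le {s : ℝ} (hs : 0 < s) (R : ℕ) : ∑ r ∈ Finset.Icc 1 R, Real.exp (-s * (r:ℝ) ^ 2) ≤ √(Real.pi / s) / 2 := by
  have hanti : AntitoneOn (fun x : ℝ => Real.exp (-s * x ^ 2)) (Icc ((0:ℕ):ℝ) ((R:ℕ):ℝ)) := by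
    intro x hx y hy hxy
    have hx0 : (0:ℝ) ≤ x := by simpa using hx.1
    have := pow_le_pow_left₀ hx0 hxy 2
    exact Real.exp_le_exp.2 (by nlinarith)
  have := hanti.sum_le_integral_Ico (Nat.zero_le R)
  have e : ∑ r ∈ Finset.Icc 1 R, Real.exp (-s * (r:ℝ) ^ 2) = ∑ i ∈ Finset.Ico 0 R, Real.exp (-s * ((i+1:ℕ):ℝ) ^ 2) := by
    rw [← Finset.sum_image (s := Finset.Ico 0 R) (g := fun i => i + 1) (f := fun r : ℕ => Real.exp (-s * (r:ℝ) ^ 2)) (fun x _ y _ h => by simpa using h)]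
    congr 1; ext i; simp only [Finset.mem_image, Finset.mem_Ico, Finset.mem_Icc]
    constructor
    · intro h; exact ⟨i - 1, by omega, by omega⟩
    · rintro ⟨j, hj, rfl⟩; omega
  rw [e, ← integral_gaussian_Ioi]
  refine this.trans ?_
  rw [intervalIntegral.integral_of_le (by simp)]
  exact setIntegral_mono_set (integrable_exp_neg_mul_sq hs).integrableOn
    (Eventually.of_forall fun x => (Real.exp_pos _).le) (LE.le.eventuallyLE (fun x hx => by simpa using hx.1))

theorem gsum_ge {s0 : ℝ} (hs0 : 0 < s0) : ∃ R0 : ℕ, ∀ R ≥ R0, ∀ s ≥ s0,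
    √(Real.pi / s) / 2 - 2 ≤ ∑ r ∈ Finset.Icc 1 R, Real.exp (-s * (r:ℝ) ^ 2) := by
  have ht : Tendsto (fun R : ℕ => ∫ x in Ioi ((R:ℝ) + 1), Real.exp (-s0 * x ^ 2)) atTop (𝓝 0) := by
    have h1 : Tendsto (fun R : ℝ => ∫ x in (0:ℝ)..R, Real.exp (-s0 * x ^ 2)) atTop (𝓝 (∫ x in Ioi (0:ℝ), Real.exp (-s0 * x ^ 2))) :=
      intervalIntegral_tendsto_integral_Ioi 0 (integrable_exp_neg_mul_sq hs0).integrableOn tendsto_id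
    have h2 : Tendsto (fun R : ℕ => (R:ℝ) + 1) atTop atTop := tendsto_atTop_add_const_right _ _ tendsto_natCast_atTop_atTop
    have h3 := (h1.comp h2).const_sub (∫ x in Ioi (0:ℝ), Real.exp (-s0 * x ^ 2))
    rw [sub_self] at h3
    refine h3.congr fun R => ?_
    simp only [Function.comp]
    rw [sub_eq_iff_eq_add, add_comm, intervalIntegral.integral_interval_add_Ioi (integrable_exp_neg_mul_sq hs0).integrableOn (integrable_exp_neg_mul_sq hs0).integrableOn]
  obtain ⟨R0, hR0⟩ := eventually_atTop.1 (ht.eventually (gt_mem_nhds one_pos))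
  refine ⟨R0, fun R hR s hs => ?_⟩
  have hsp : 0 < s := by linarith
  have hI := integrable_exp_neg_mul_sq hsp
  have hanti : AntitoneOn (fun x : ℝ => Real.exp (-s * x ^ 2)) (Icc ((1:ℕ):ℝ) ((R + 1:ℕ):ℝ)) := by
    intro x hx y hy hxy
    have hx0 : (1:ℝ) ≤ x := by simpa using hx.1
    have := pow_le_pow_left₀ (by linarith) hxy 2
    exact Real.exp_le_exp.2 (by nlinarith)
  have h1 := hanti.integral_le_sum_Ico (by omega)
  rw [← integral_gaussian_Ioi, ← intervalIntegral.integral_interval_add_Ioi (b := 1) hI.integrableOn hI.integrableOn,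
    ← intervalIntegral.integral_interval_add_Ioi (a := 1) (b := (R:ℝ) + 1) hI.integrableOn hI.integrableOn]
  have h2 : ∫ x in Ioi ((R:ℝ) + 1), Real.exp (-s * x ^ 2) ≤ 1 := by
    refine le_trans ?_ (hR0 R hR).le
    refine setIntegral_mono hI.integrableOn (integrable_exp_neg_mul_sq hs0).integrableOn fun x => ?_
    exact Real.exp_le_exp.2 (by nlinarith [sq_nonneg x])
  have h3 : ∫ x in (0:ℝ)..1, Real.exp (-s * x ^ 2) ≤ 1 := by
    have : ∫ x in (0:ℝ)..1, Real.exp (-s * x ^ 2) ≤ ∫ x in (0:ℝ)..1, (1:ℝ) := by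
      refine intervalIntegral.integral_mono_on zero_le_one hI.intervalIntegrable (by simp) fun x _ => ?_
      exact Real.exp_le_one_iff.2 (by nlinarith [sq_nonneg x])
    simpa using this
  have h4 : Finset.Ico 1 (R+1) = Finset.Icc 1 R := by ext; simp
  rw [h4] at h1
  push_cast at h1
  linarith

theorem diagpair {p1 p2 r1 r2 : ℕ} (hp1 : 1 ≤ p1) (hp2 : 1 ≤ p2) (hr1 : 1 ≤ r1) (hr2 : 1 ≤ r2) (M : ℕ) (f : ℝ → ℝ) :
    ∑ m ∈ Finset.Icc 1 M, ∑ n ∈ Finset.Icc 1 M, (if (m:ℝ) * ((p1:ℝ)/p2) = n * ((r1:ℝ)/r2) then f (m * ((p1:ℝ)/p2)) else 0) =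
    ∑ r ∈ Finset.Icc 1 (M / max (p2 * r1 / Nat.gcd (p1 * r2) (p2 * r1)) (p1 * r2 / Nat.gcd (p1 * r2) (p2 * r1))),
      f (r * ((p1 * r1 : ℝ) / Nat.gcd (p1 * r2) (p2 * r1))) := by
  have hq0 : 0 < Nat.gcd (p1 * r2) (p2 * r1) := Nat.gcd_pos_of_pos_left _ (by positivity)
  obtain ⟨P, Q, hcop, hP, hQ⟩ := Nat.exists_coprime (p1 * r2) (p2 * r1)
  set q := Nat.gcd (p1 * r2) (p2 * r1) with hq
  have hP0 : 0 < P := Nat.pos_of_ne_zero (by rintro rfl; have : 0 < p1 * r2 := by positivity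
                                             omega)
  have hQ0 : 0 < Q := Nat.pos_of_ne_zero (by rintro rfl; have : 0 < p2 * r1 := by positivity
                                             omega)
  have hPd : p1 * r2 / q = P := by rw [hP]; exact Nat.mul_div_cancel _ hq0
  have hQd : p2 * r1 / q = Q := by rw [hQ]; exact Nat.mul_div_cancel _ hq0
  rw [hPd, hQd]
  have hp2' : (0:ℝ) < p2 := by exact_mod_cast hp2
  have hr2' : (0:ℝ) < r2 := by exact_mod_cast hr2
  have hq' : (0:ℝ) < q := by exact_mod_cast hq0
  have hiff : ∀ m n : ℕ, (m:ℝ) * ((p1:ℝ)/p2) = n * ((r1:ℝ)/r2) ↔ m * P = n * Q := by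
    intro m n
    have : (m:ℝ) * ((p1:ℝ)/p2) = n * ((r1:ℝ)/r2) ↔ m * (p1 * r2) = n * (p2 * r1) := by
      rw [← mul_div_assoc, ← mul_div_assoc, div_eq_div_iff hp2'.ne' hr2'.ne']
      rw [← @Nat.cast_inj ℝ]; push_cast
      constructor <;> intro h <;> linarith
    rw [this, hP, hQ, ← mul_assoc, ← mul_assoc]
    exact ⟨fun h => Nat.eq_of_mul_eq_mul_right hq0 h, fun h => by rw [h]⟩
  have hval : ∀ r : ℕ, ((r * Q : ℕ):ℝ) * ((p1:ℝ)/p2) = r * ((p1 * r1 : ℝ) / q) := by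
    intro r
    have : (p2:ℝ) * r1 = Q * q := by exact_mod_cast hQ
    push_cast
    field_simp
    linear_combination (-r : ℝ) * this
  rw [← Finset.sum_product', ← Finset.sum_filter]
  symm
  refine Finset.sum_nbij (fun r => (r * Q, r * P)) ?_ ?_ ?_ ?_
  · intro r hr
    rw [Finset.mem_Icc, Nat.le_div_iff_mul_le (by positivity)] at hr
    simp only [Finset.mem_filter, Finset.mem_product, Finset.mem_Icc, hiff]
    have h1 : r * Q ≤ r * max Q P := by gcongr; exact le_max_left _ _
    have h2 : r * P ≤ r * max Q P := by gcongr; exact le_max_right _ _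
    have h3 : 1 ≤ r * Q := Nat.mul_pos hr.1 hQ0
    have h4 : 1 ≤ r * P := Nat.mul_pos hr.1 hP0
    refine ⟨⟨⟨h3, by omega⟩, h4, by omega⟩, by ring⟩
  · intro r _ r' _ h
    simp only [Prod.mk.injEq] at h
    exact Nat.eq_of_mul_eq_mul_right hQ0 h.1
  · rintro ⟨m, n⟩ h
    simp only [Finset.coe_filter, Finset.mem_product, Finset.mem_Icc, hiff, Set.mem_ofPred_eq] at h
    obtain ⟨⟨⟨h1, h2⟩, h3, h4⟩, h5⟩ := h
    have : Q ∣ m := (Nat.Coprime.dvd_of_dvd_mul_right hcop.symm (Dvd.intro_left n h5.symm))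
    obtain ⟨r, rfl⟩ := this
    have h6 : n = r * P := Nat.eq_of_mul_eq_mul_right hQ0 (by rw [← h5]; ring)
    subst h6
    refine ⟨r, ?_, by simp only [Prod.mk.injEq, and_true]; ring⟩
    simp only [Finset.coe_Icc, Set.mem_Icc]
    rw [Nat.le_div_iff_mul_le (by positivity)]
    refine ⟨Nat.pos_of_ne_zero (by rintro rfl; simp at h1), ?_⟩
    rcases le_total Q P with h | h
    · rwa [max_eq_right h]
    · rw [max_eq_left h, mul_comm]; exact h2
  · intro r _
    rw [hval]

theorem diag_nonneg {ι : Type*} (P : Finset ι) (B y : ι → ℝ) (f : ℝ → ℝ) (hf : ∀ v, 0 ≤ f v) :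
    0 ≤ ∑ i ∈ P, ∑ j ∈ P, if y i = y j then B i * B j * f (y i) else 0 := by
  classical
  have : ∑ i ∈ P, ∑ j ∈ P, (if y i = y j then B i * B j * f (y i) else 0) =
      ∑ v ∈ P.image y, f v * (∑ i ∈ P with y i = v, B i) ^ 2 := by
    rw [← Finset.sum_fiberwise_of_maps_to (s := P) (t := P.image y) (g := y) (fun i hi => Finset.mem_image_of_mem y hi)]
    refine Finset.sum_congr rfl fun v _ => ?_
    rw [sq, Finset.sum_mul_sum, Finset.mul_sum]
    refine Finset.sum_congr rfl fun i hi => ?_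
    rw [Finset.mem_filter] at hi
    rw [Finset.mul_sum, Finset.sum_filter]
    refine Finset.sum_congr rfl fun j hj => ?_
    rw [hi.2]
    by_cases h : v = y j
    · simp [h]; ring
    · simp [h, Ne.symm h]
  rw [this]
  exact Finset.sum_nonneg fun v _ => mul_nonneg (hf v) (sq_nonneg _)
end Sel

namespace Sel
open MeasureTheory Set Filter Topology

noncomputable def QQ {ι : Type*} (P : Finset ι) (B y : ι → ℝ) (a x : ℝ) : ℝ :=
  ∑ i ∈ P, ∑ j ∈ P, if y i = y j then B i * B j * Real.exp (-(2 * Real.pi * a * y i ^ 2) * x ^ 2) else 0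

theorem QQ_nonneg {ι : Type*} (P : Finset ι) (B y : ι → ℝ) (a x : ℝ) : 0 ≤ QQ P B y a x :=
  diag_nonneg P B y (fun v => Real.exp (-(2 * Real.pi * a * v ^ 2) * x ^ 2)) fun _ => (Real.exp_pos _).le

theorem int_ite {X : Type*} [MeasurableSpace X] {μ : Measure X} {f : X → ℝ} {c : ℝ} (p : Prop) [Decidable p]
    (hf : Integrable f μ) : Integrable (fun x => if p then c * f x else 0) μ ∧
      ∫ x, (if p then c * f x else 0) ∂μ = if p then c * ∫ x, f x ∂μ else 0 := by
  split_ifs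
  · exact ⟨hf.const_mul _, integral_const_mul _ _⟩
  · simp

theorem dbl_int {ι X : Type*} [MeasurableSpace X] {μ : Measure X} (P : Finset ι) (B y : ι → ℝ) (g : ι → X → ℝ)
    (hg : ∀ i ∈ P, Integrable (g i) μ) :
    Integrable (fun x => ∑ i ∈ P, ∑ j ∈ P, if y i = y j then B i * B j * g i x else 0) μ ∧
    ∫ x, (∑ i ∈ P, ∑ j ∈ P, if y i = y j then B i * B j * g i x else 0) ∂μ =
      ∑ i ∈ P, ∑ j ∈ P, if y i = y j then B i * B j * ∫ x, g i x ∂μ else 0 := by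
  have h1 : ∀ i ∈ P, ∀ j ∈ P, Integrable (fun x => if y i = y j then B i * B j * g i x else 0) μ :=
    fun i hi j _ => (int_ite _ (hg i hi)).1
  have h2 : ∀ i ∈ P, Integrable (fun x => ∑ j ∈ P, if y i = y j then B i * B j * g i x else 0) μ :=
    fun i hi => integrable_finsetSum _ (h1 i hi)
  refine ⟨integrable_finsetSum _ h2, ?_⟩
  rw [integral_finsetSum _ h2]
  refine Finset.sum_congr rfl fun i hi => ?_
  rw [integral_finsetSum _ (h1 i hi)]
  exact Finset.sum_congr rfl fun j _ => (int_ite _ (hg i hi)).2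

theorem mul_QQ {ι : Type*} (P : Finset ι) (B y : ι → ℝ) (a x c : ℝ) : c * QQ P B y a x =
    ∑ i ∈ P, ∑ j ∈ P, if y i = y j then B i * B j * (c * Real.exp (-(2 * Real.pi * a * y i ^ 2) * x ^ 2)) else 0 := by
  rw [QQ, Finset.mul_sum]
  refine Finset.sum_congr rfl fun i _ => ?_
  rw [Finset.mul_sum]
  refine Finset.sum_congr rfl fun j _ => ?_
  split_ifs
  · ring
  · simp

theorem ww_int {h x0 : ℝ} (hh : 0 ≤ h) (hx0 : 1 ≤ x0) : IntervalIntegrable (fun x => ww h x * x⁻¹) volume 1 x0 ∧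
    ∫ x in (1:ℝ)..x0, ww h x * x⁻¹ = Real.log x0 / (1 + h * Real.log x0) := by
  have hl : ∀ x : ℝ, 1 ≤ x → 0 < 1 + h * Real.log x := fun x hx => by
    have := Real.log_nonneg hx; positivity
  have hc : ContinuousOn (fun x => ww h x * x⁻¹) (uIcc 1 x0) := by
    rw [uIcc_of_le hx0]
    unfold ww
    intro x hx
    have h1 := hl x hx.1
    have h2 : x ≠ 0 := by linarith [hx.1]
    have h3 : (1 + h * Real.log x) ^ 2 ≠ 0 := by positivity
    apply ContinuousAt.continuousWithinAt
    fun_prop (disch := assumption)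
  refine ⟨hc.intervalIntegrable, ?_⟩
  rw [intervalIntegral.integral_eq_sub_of_hasDerivAt (f := fun x => Real.log x / (1 + h * Real.log x)) ?_ hc.intervalIntegrable]
  · simp
  · intro x hx
    rw [uIcc_of_le hx0] at hx
    have h1 := hl x hx.1
    have h2 : x ≠ 0 := by linarith [hx.1]
    have := (Real.hasDerivAt_log h2).div (((Real.hasDerivAt_log h2).const_mul h).const_add 1) h1.ne'
    refine this.congr_deriv ?_
    rw [ww]; field_simp; ring

theorem diag_int {ι : Type*} (P : Finset ι) (B y : ι → ℝ) (hy : ∀ i ∈ P, 0 < y i) {a h x0 τ c1 c2 : ℝ} (ha : 0 < a)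
    (hh : 0 ≤ h) (hx0 : 1 ≤ x0) (hτ : 0 < τ) (hc2 : 0 ≤ c2)
    (hpt : ∀ x ∈ Ioc 1 x0, QQ P B y a x ≤ c1 / x + c2) :
    (∑ i ∈ P, ∑ j ∈ P, if y i = y j then B i * B j * ∫ x in Ioi (1:ℝ), ww h x * Real.exp (-(2 * Real.pi * a * y i ^ 2) * x ^ 2) else 0)
    ≤ c1 * (Real.log x0 / (1 + h * Real.log x0)) + c2 * x0 + ww h x0 * x0 ^ (-τ) *
      ((2 * Real.pi * a) ^ (-(τ + 1) / 2) * (1/2) * Real.Gamma ((τ + 1) / 2)) *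
      ∑ i ∈ P, ∑ j ∈ P, if y i = y j then B i * B j * y i ^ (-(τ + 1)) else 0 := by
  have hpi := Real.pi_pos
  have hb : ∀ i ∈ P, 0 < 2 * Real.pi * a * y i ^ 2 := fun i hi => by have := hy i hi; positivity
  have hx00 : 0 < x0 := by linarith
  have h1 := dbl_int P B y (fun i x => ww h x * Real.exp (-(2 * Real.pi * a * y i ^ 2) * x ^ 2)) (μ := volume.restrict (Ioi 1))
    fun i hi => gauss_wwr hh (hb i hi) le_rfl
  have h2 := dbl_int P B y (fun i x => x ^ τ * Real.exp (-(2 * Real.pi * a * y i ^ 2) * x ^ 2)) (μ := volume.restrict (Ioi 0))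
    fun i hi => integrableOn_rpow_mul_exp_neg_mul_sq (hb i hi) (by linarith)
  simp_rw [← mul_QQ] at h1 h2
  rw [← h1.2]
  have hu : Ioi (1:ℝ) = Ioc 1 x0 ∪ Ioi x0 := (Ioc_union_Ioi_eq_Ioi hx0).symm
  have hi1 : IntegrableOn (fun x => ww h x * QQ P B y a x) (Ioi 1) := h1.1
  have hi2 : IntegrableOn (fun x => x ^ τ * QQ P B y a x) (Ioi 0) := h2.1
  rw [hu, setIntegral_union (Ioc_disjoint_Ioi le_rfl) measurableSet_Ioi (hi1.mono_set Ioc_subset_Ioi_self) (hi1.mono_set (Ioi_subset_Ioi hx0))]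
  refine add_le_add ?_ ?_
  · have hi3 := (ww_int hh hx0).1
    rw [intervalIntegrable_iff_integrableOn_Ioc_of_le hx0] at hi3
    calc ∫ x in Ioc 1 x0, ww h x * QQ P B y a x ≤ ∫ x in Ioc 1 x0, (c1 * (ww h x * x⁻¹) + c2) := by
          refine setIntegral_mono_on (hi1.mono_set Ioc_subset_Ioi_self) ((hi3.const_mul _).add (by simp)) measurableSet_Ioc fun x hx => ?_
          have := ww_pos hh hx.1.le
          have h3 := mul_le_mul_of_nonneg_left (hpt x hx) this.1.le
          have : ww h x * c2 ≤ 1 * c2 := by gcongr; exact this.2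
          calc _ ≤ _ := h3
            _ = c1 * (ww h x * x⁻¹) + ww h x * c2 := by ring
            _ ≤ _ := by linarith
      _ = c1 * (Real.log x0 / (1 + h * Real.log x0)) + c2 * (x0 - 1) := by
          rw [integral_add (hi3.const_mul _) (by simp), integral_const_mul, ← intervalIntegral.integral_of_le hx0, (ww_int hh hx0).2]
          simp [hx0]; ring
      _ ≤ _ := by nlinarith
  · have e : ∑ i ∈ P, ∑ j ∈ P, (if y i = y j then B i * B j * ∫ x in Ioi (0:ℝ), x ^ τ * Real.exp (-(2 * Real.pi * a * y i ^ 2) * x ^ 2) else 0)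
        = ((2 * Real.pi * a) ^ (-(τ + 1) / 2) * (1/2) * Real.Gamma ((τ + 1) / 2)) *
      ∑ i ∈ P, ∑ j ∈ P, if y i = y j then B i * B j * y i ^ (-(τ + 1)) else 0 := by
      rw [Finset.mul_sum]
      refine Finset.sum_congr rfl fun i hi => ?_
      rw [Finset.mul_sum]
      refine Finset.sum_congr rfl fun j hj => ?_
      have := integral_rpow_mul_exp_neg_mul_rpow two_pos (show -1 < τ by linarith) (hb i hi)
      simp_rw [Real.rpow_two] at this
      rw [this, Real.mul_rpow (by positivity) (by positivity), ← Real.rpow_natCast (y i), ← Real.rpow_mul (hy i hi).le]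
      split_ifs
      · rw [show ((2:ℕ):ℝ) * (-(τ + 1) / 2) = -(τ + 1) by push_cast; ring]; ring
      · simp
    rw [mul_assoc, ← e, ← h2.2, ← integral_const_mul]
    have hc0 : 0 ≤ ww h x0 * x0 ^ (-τ) := mul_nonneg (ww_pos hh hx0).1.le (by positivity)
    calc ∫ x in Ioi x0, ww h x * QQ P B y a x ≤ ∫ x in Ioi x0, ww h x0 * x0 ^ (-τ) * (x ^ τ * QQ P B y a x) := by
          refine setIntegral_mono_on (hi1.mono_set (Ioi_subset_Ioi hx0)) ((hi2.mono_set (Ioi_subset_Ioi hx00.le)).const_mul _) measurableSet_Ioi fun x hx => ?_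
          have hx' : x0 < x := hx
          have hq := QQ_nonneg P B y a x
          have f1 : ww h x ≤ ww h x0 := by
            have := Real.log_nonneg hx0
            have := Real.log_le_log hx00 hx'.le
            unfold ww; gcongr
          have f2 : 1 ≤ x0 ^ (-τ) * x ^ τ := by
            rw [Real.rpow_neg hx00.le, ← div_eq_inv_mul, one_le_div (by positivity)]
            exact Real.rpow_le_rpow hx00.le hx'.le hτ.le
          have := (ww_pos hh hx0).1
          calc ww h x * QQ P B y a x ≤ ww h x0 * QQ P B y a x := by gcongr
            _ = ww h x0 * 1 * QQ P B y a x := by ring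
            _ ≤ ww h x0 * (x0 ^ (-τ) * x ^ τ) * QQ P B y a x := by gcongr
            _ = _ := by ring
      _ ≤ _ := by
          refine setIntegral_mono_set (hi2.const_mul _) ?_ (LE.le.eventuallyLE (Ioi_subset_Ioi hx00.le))
          filter_upwards [ae_restrict_mem measurableSet_Ioi] with x hx
          have : 0 < x := hx
          exact mul_nonneg hc0 (mul_nonneg (by positivity) (QQ_nonneg P B y a x))
end Sel

namespace Sel
open MeasureTheory Set Filter Topology Complex
open scoped ComplexConjugate

noncomputable def pp (N : ℕ) : Finset (ℕ × ℕ) := Finset.Icc 1 N ×ˢ Finset.Icc 1 N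
noncomputable def BB (β : ℕ → ℝ) (p : ℕ × ℕ) : ℝ := β p.1 * β p.2 / p.2
noncomputable def cc (p r : ℕ × ℕ) : ℝ := ((p.1:ℝ) * r.1) / (Nat.gcd (p.1 * r.2) (p.2 * r.1) : ℕ)
noncomputable def yy (i : (ℕ × ℕ) × ℕ) : ℝ := i.2 * ((i.1.1:ℝ) / i.1.2)
noncomputable def SS (β : ℕ → ℝ) (N : ℕ) (τ : ℝ) : ℝ := ∑ p ∈ pp N, ∑ r ∈ pp N, BB β p * BB β r * cc p r ^ (-(τ + 1))
def RR (p r : ℕ × ℕ) (M : ℕ) : ℕ := M / max (p.2 * r.1 / Nat.gcd (p.1 * r.2) (p.2 * r.1)) (p.1 * r.2 / Nat.gcd (p.1 * r.2) (p.2 * r.1))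

theorem mem_pp {N : ℕ} {p : ℕ × ℕ} : p ∈ pp N ↔ (1 ≤ p.1 ∧ p.1 ≤ N) ∧ 1 ≤ p.2 ∧ p.2 ≤ N := by
  simp [pp]

theorem cc_pos {N : ℕ} {p r : ℕ × ℕ} (hp : p ∈ pp N) (hr : r ∈ pp N) : 0 < cc p r := by
  rw [mem_pp] at hp hr
  have h1 : (0:ℝ) < p.1 := by exact_mod_cast hp.1.1
  have h2 : (0:ℝ) < r.1 := by exact_mod_cast hr.1.1
  have h3 : 0 < Nat.gcd (p.1 * r.2) (p.2 * r.1) := Nat.gcd_pos_of_pos_left _ (Nat.mul_pos hp.1.1 hr.2.1)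
  have h3' : (0:ℝ) < (Nat.gcd (p.1 * r.2) (p.2 * r.1) : ℕ) := by exact_mod_cast h3
  unfold cc; positivity

theorem RR_tendsto {N : ℕ} {p r : ℕ × ℕ} (hp : p ∈ pp N) (hr : r ∈ pp N) : Tendsto (RR p r) atTop atTop := by
  rw [mem_pp] at hp hr
  refine Nat.tendsto_div_const_atTop ?_
  have h3 : 0 < Nat.gcd (p.1 * r.2) (p.2 * r.1) := Nat.gcd_pos_of_pos_left _ (Nat.mul_pos hp.1.1 hr.2.1)
  have : 0 < p.1 * r.2 / Nat.gcd (p.1 * r.2) (p.2 * r.1) :=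
    Nat.div_pos (Nat.le_of_dvd (Nat.mul_pos hp.1.1 hr.2.1) (Nat.gcd_dvd_left _ _)) h3
  exact (lt_of_lt_of_le this (le_max_right _ _)).ne'

theorem diag_PP (β : ℕ → ℝ) (N M : ℕ) (f : ℝ → ℝ) :
    (∑ i ∈ pp N ×ˢ Finset.Icc 1 M, ∑ j ∈ pp N ×ˢ Finset.Icc 1 M, if yy i = yy j then BB β i.1 * BB β j.1 * f (yy i) else 0) =
    ∑ p ∈ pp N, ∑ r ∈ pp N, BB β p * BB β r * ∑ t ∈ Finset.Icc 1 (RR p r M), f (t * cc p r) := by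
  rw [Finset.sum_product]
  refine Finset.sum_congr rfl fun p hp => ?_
  simp_rw [Finset.sum_product]
  rw [Finset.sum_comm]
  refine Finset.sum_congr rfl fun r hr => ?_
  rw [mem_pp] at hp hr
  have := diagpair hp.1.1 hp.2.1 hr.1.1 hr.2.1 M f
  unfold RR cc
  rw [← this, Finset.mul_sum]
  refine Finset.sum_congr rfl fun m _ => ?_
  rw [Finset.mul_sum]
  refine Finset.sum_congr rfl fun n _ => ?_
  have e : yy (p, m) = m * ((p.1:ℝ) / p.2) := rfl
  have e' : yy (r, n) = n * ((r.1:ℝ) / r.2) := rfl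
  rw [mul_ite, mul_zero]
  by_cases h : yy (p, m) = yy (r, n)
  · rw [if_pos h, if_pos (by rwa [← e, ← e']), e]
  · rw [if_neg h, if_neg (by rwa [← e, ← e'])]

theorem QQ_pt {β : ℕ → ℝ} (N : ℕ) {a : ℝ} (ha : 0 < a) (hβ : ∀ p ∈ pp N, |BB β p| ≤ 1) :
    ∀ᶠ M in atTop, ∀ x : ℝ, 1 ≤ x → QQ (pp N ×ˢ Finset.Icc 1 M) (fun i => BB β i.1) yy a x ≤
      (SS β N 0 / (2 * √(2 * a))) / x + 2 * (N:ℝ) ^ 4 := by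
  have hpi := Real.pi_pos
  have h1 : ∀ p ∈ pp N, ∀ r ∈ pp N, ∀ᶠ M in atTop, ∀ s ≥ 2 * Real.pi * a * cc p r ^ 2,
      √(Real.pi / s) / 2 - 2 ≤ ∑ t ∈ Finset.Icc 1 (RR p r M), Real.exp (-s * (t:ℝ) ^ 2) := by
    intro p hp r hr
    have := cc_pos hp hr
    obtain ⟨R0, hR0⟩ := gsum_ge (show 0 < 2 * Real.pi * a * cc p r ^ 2 by positivity)
    filter_upwards [(RR_tendsto hp hr).eventually_ge_atTop R0] with M hM
    exact hR0 _ hM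
  have h2 := (Filter.eventually_all_finset (pp N)).2 fun p hp => (Filter.eventually_all_finset (pp N)).2 (h1 p hp)
  filter_upwards [h2] with M hM x hx
  have hx0 : 0 < x := by linarith
  rw [QQ, diag_PP β N M (fun v => Real.exp (-(2 * Real.pi * a * v ^ 2) * x ^ 2))]
  have hterm : ∀ p ∈ pp N, ∀ r ∈ pp N, BB β p * BB β r * ∑ t ∈ Finset.Icc 1 (RR p r M), Real.exp (-(2 * Real.pi * a * (t * cc p r) ^ 2) * x ^ 2)
      ≤ (BB β p * BB β r * cc p r ^ (-((0:ℝ)+1))) * ((2 * √(2 * a))⁻¹ / x) + 2 := by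
    intro p hp r hr
    have hc := cc_pos hp hr
    set s := 2 * Real.pi * a * cc p r ^ 2 * x ^ 2 with hs
    have hs0 : 0 < s := by positivity
    have e1 : ∑ t ∈ Finset.Icc 1 (RR p r M), Real.exp (-(2 * Real.pi * a * (t * cc p r) ^ 2) * x ^ 2) =
        ∑ t ∈ Finset.Icc 1 (RR p r M), Real.exp (-s * (t:ℝ) ^ 2) := by
      refine Finset.sum_congr rfl fun t _ => ?_
      congr 1; rw [hs]; ring
    have e2 : √(Real.pi / s) / 2 = cc p r ^ (-((0:ℝ)+1)) * ((2 * √(2 * a))⁻¹ / x) := by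
      have : Real.pi / s = ((√(2 * a)) * cc p r * x)⁻¹ ^ 2 := by
        rw [inv_pow, mul_pow, mul_pow, Real.sq_sqrt (by positivity), hs]; field_simp
      rw [this, Real.sqrt_sq (by positivity), zero_add, Real.rpow_neg_one]; field_simp
    have b1 := gsum_le hs0 (RR p r M)
    have b2 := hM p hp r hr s (by rw [hs]; exact le_mul_of_one_le_right (by positivity) (one_le_pow₀ hx))
    rw [e1, mul_assoc (BB β p * BB β r) (cc p r ^ _), ← e2]
    set D := ∑ t ∈ Finset.Icc 1 (RR p r M), Real.exp (-s * (t:ℝ) ^ 2)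
    have hb : |BB β p * BB β r| ≤ 1 := by
      rw [abs_mul]; exact mul_le_one₀ (hβ p hp) (abs_nonneg _) (hβ r hr)
    have : (BB β p * BB β r) * (D - √(Real.pi / s) / 2) ≤ 1 * 2 := by
      refine (le_abs_self _).trans ?_
      rw [abs_mul]
      exact mul_le_mul hb (abs_le.2 ⟨by linarith, by linarith⟩) (abs_nonneg _) zero_le_one
    linarith
  refine (Finset.sum_le_sum fun p hp => Finset.sum_le_sum (hterm p hp)).trans (le_of_eq ?_)
  simp_rw [Finset.sum_add_distrib]
  congr 1
  · rw [SS]; simp_rw [← Finset.sum_mul]; ring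
  · simp [pp]; ring

noncomputable def ZZ (τ : ℝ) : ℝ := ∑' n : ℕ, ((n:ℝ) + 1) ^ (-(τ + 1))

theorem QQ_tau {β : ℕ → ℝ} (N : ℕ) {τ : ℝ} (hτ : 0 < τ) :
    ∀ᶠ M in atTop, (∑ i ∈ pp N ×ˢ Finset.Icc 1 M, ∑ j ∈ pp N ×ˢ Finset.Icc 1 M, if yy i = yy j then BB β i.1 * BB β j.1 * yy i ^ (-(τ + 1)) else 0)
      ≤ ZZ τ * SS β N τ + 1 := by
  have hsum : Summable fun n : ℕ => ((n:ℝ) + 1) ^ (-(τ + 1)) := by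
    have h := (Real.summable_nat_rpow (p := -(τ+1))).2 (by linarith)
    exact_mod_cast (summable_nat_add_iff 1).2 h
  have ht : Tendsto (fun R : ℕ => ∑ t ∈ Finset.Icc 1 R, (t:ℝ) ^ (-(τ + 1))) atTop (𝓝 (ZZ τ)) := by
    refine hsum.hasSum.tendsto_sum_nat.congr fun R => ?_
    have h := Finset.sum_Ico_add' (fun t : ℕ => (t:ℝ) ^ (-(τ + 1))) 0 R 1
    rw [Finset.range_eq_Ico]
    push_cast at h
    rw [h]
    congr 1
  have h2 : Tendsto (fun M : ℕ => ∑ p ∈ pp N, ∑ r ∈ pp N, BB β p * BB β r * ∑ t ∈ Finset.Icc 1 (RR p r M), (t * cc p r) ^ (-(τ + 1)))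
      atTop (𝓝 (∑ p ∈ pp N, ∑ r ∈ pp N, BB β p * BB β r * (ZZ τ * cc p r ^ (-(τ + 1))))) := by
    refine tendsto_finsetSum _ fun p hp => tendsto_finsetSum _ fun r hr => Tendsto.const_mul _ ?_
    refine ((ht.comp (RR_tendsto hp hr)).mul_const _).congr fun M => ?_
    simp only [Function.comp]
    rw [Finset.sum_mul]
    exact Finset.sum_congr rfl fun t _ => (Real.mul_rpow (by positivity) (cc_pos hp hr).le).symm
  have e : ∑ p ∈ pp N, ∑ r ∈ pp N, BB β p * BB β r * (ZZ τ * cc p r ^ (-(τ + 1))) = ZZ τ * SS β N τ := by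
    rw [SS]; simp_rw [Finset.mul_sum]
    exact Finset.sum_congr rfl fun p _ => Finset.sum_congr rfl fun r _ => by ring
  rw [e] at h2
  filter_upwards [h2.eventually (gt_mem_nhds (lt_add_one _))] with M hM
  rw [diag_PP β N M (fun v => v ^ (-(τ + 1)))]
  exact hM.le

theorem ZZ_le {τ : ℝ} (hτ : 0 < τ) : ZZ τ ≤ 1 + 1 / τ := by
  have h := ZetaAsymptotics.zeta_limit_aux1 (s := τ + 1) (by linarith)
  have h2 : 0 ≤ ZetaAsymptotics.termTSum (τ + 1) :=
    tsum_nonneg fun n => ZetaAsymptotics.term_nonneg _ _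
  have e : ZZ τ = ∑' n : ℕ, 1 / ((n:ℝ) + 1) ^ (τ + 1) := by
    unfold ZZ; congr 1; ext n; rw [Real.rpow_neg (by positivity), one_div]
  rw [e]
  rw [show τ + 1 - 1 = τ by ring] at h
  nlinarith
end Sel

namespace Sel
open MeasureTheory Set Filter Topology Complex
open scoped ComplexConjugate

theorem off_le {β : ℕ → ℝ} (N M : ℕ) {k : ℂ} (hk : 0 < k.re) (him : 1/2 ≤ k.im) (hβ : ∀ p ∈ pp N, |BB β p| ≤ 1) :
    (∑ i ∈ pp N ×ˢ Finset.Icc 1 M, ∑ j ∈ pp N ×ˢ Finset.Icc 1 M, if yy i = yy j then 0 else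
      |BB β i.1| * |BB β j.1| * (Real.exp (-(Real.pi * (k * yy i ^ 2 + conj k * yy j ^ 2)).re) / ‖Real.pi * (k * yy i ^ 2 + conj k * yy j ^ 2)‖))
    ≤ 2 * C0 * (N:ℝ) ^ 10 * k.re ^ (-(1/4):ℝ) := by
  have hpi := Real.pi_gt_three
  have key : ∀ p ∈ pp N, ∀ r ∈ pp N, ∑ m ∈ Finset.Icc 1 M, ∑ n ∈ Finset.Icc 1 M, (if yy (p, m) = yy (r, n) then 0 else
      |BB β p| * |BB β r| * (Real.exp (-(Real.pi * (k * yy (p, m) ^ 2 + conj k * yy (r, n) ^ 2)).re) / ‖Real.pi * (k * yy (p, m) ^ 2 + conj k * yy (r, n) ^ 2)‖))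
      ≤ k.re ^ (-(1/4):ℝ) * (N:ℝ) ^ 6 * (2 * C0) := by
    intro p hp r hr
    have hp' := mem_pp.1 hp
    have hr' := mem_pp.1 hr
    have h2 := offsum (p.1 * r.2) (r.1 * p.2) (Nat.mul_pos hp'.1.1 hr'.2.1) (Nat.mul_pos hr'.1.1 hp'.2.1) (Finset.Icc 1 M ×ˢ Finset.Icc 1 M)
    rw [Finset.sum_product] at h2
    refine le_trans ?_ (mul_le_mul_of_nonneg_left h2 (by positivity))
    rw [Finset.mul_sum]
    refine Finset.sum_le_sum fun m hm => ?_
    rw [Finset.mul_sum]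
    refine Finset.sum_le_sum fun n hn => ?_
    have hm1 := (Finset.mem_Icc.1 hm).1
    have hn1 := (Finset.mem_Icc.1 hn).1
    dsimp only
    set A := m * (p.1 * r.2) with hA
    set B := n * (r.1 * p.2) with hB
    have hA1 : 1 ≤ A := Nat.mul_pos hm1 (Nat.mul_pos hp'.1.1 hr'.2.1)
    have hB1 : 1 ≤ B := Nat.mul_pos hn1 (Nat.mul_pos hr'.1.1 hp'.2.1)
    have hp2 : (1:ℝ) ≤ p.2 := by exact_mod_cast hp'.2.1
    have hr2 : (1:ℝ) ≤ r.2 := by exact_mod_cast hr'.2.1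
    have hp2' : (p.2:ℝ) ≤ N := by exact_mod_cast hp'.2.2
    have hr2' : (r.2:ℝ) ≤ N := by exact_mod_cast hr'.2.2
    set D : ℝ := p.2 * r.2 with hD
    have hD1 : 1 ≤ D := by rw [hD]; nlinarith
    have hDN : D ≤ (N:ℝ) ^ 2 := by rw [hD, sq]; gcongr
    have ey : yy (p, m) = A / D := by
      simp only [yy, hA, hD]; push_cast; field_simp
    have ey' : yy (r, n) = B / D := by
      simp only [yy, hB, hD]; push_cast; field_simp
    have hiff : yy (p, m) = yy (r, n) ↔ A = B := by
      rw [ey, ey', div_left_inj' (by positivity)]; norm_cast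
    by_cases hAB : A = B
    · rw [if_pos (hiff.2 hAB), if_pos hAB, mul_zero]
    rw [if_neg (mt hiff.1 hAB), if_neg hAB]
    set z := Real.pi * (k * yy (p, m) ^ 2 + conj k * yy (r, n) ^ 2) with hz
    have hzre : z.re = Real.pi * k.re * (A ^ 2 + B ^ 2) / D ^ 2 := by
      rw [hz, re_ofReal_mul, ← ofReal_pow, ← ofReal_pow, add_re, re_mul_ofReal, re_mul_ofReal, conj_re, ey, ey']; ring
    have hzim : z.im = Real.pi * k.im * (((A:ℝ) ^ 2 - B ^ 2) / D ^ 2) := by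
      rw [hz, im_ofReal_mul, ← ofReal_pow, ← ofReal_pow, add_im, im_mul_ofReal, im_mul_ofReal, conj_im, ey, ey']; ring
    have hzim2 : |((A:ℝ) ^ 2 - B ^ 2) / D ^ 2| ≤ |z.im| := by
      rw [hzim, abs_mul]
      apply le_mul_of_one_le_left (abs_nonneg _)
      rw [abs_of_pos (by nlinarith)]; nlinarith
    have hbb : |BB β p| * |BB β r| ≤ 1 := mul_le_one₀ (hβ p hp) (abs_nonneg _) (hβ r hr)
    have fin : Real.exp (-z.re) / ‖z‖ ≤ k.re ^ (-(1/4):ℝ) * D ^ 3 * EE (min A B) (max A B - min A B) := by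
      have hs : (1:ℝ) ≤ Real.pi := by linarith
      rcases lt_or_gt_of_ne hAB with h | h
      · rw [min_eq_left h.le, max_eq_right h.le]
        refine offterm hk hD1 hA1 h ?_ ?_
        · rw [hzre]; gcongr
          · exact le_mul_of_one_le_left hk.le hs
          · nlinarith [sq_nonneg (A:ℝ)]
        · refine le_trans ?_ hzim2
          rw [← abs_neg, ← neg_div, neg_sub]; exact le_abs_self _
      · rw [min_eq_right h.le, max_eq_left h.le]
        refine offterm hk hD1 hB1 h ?_ ?_
        · rw [hzre]; gcongr
          · exact le_mul_of_one_le_left hk.le hs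
          · nlinarith [sq_nonneg (B:ℝ)]
        · exact le_trans (le_abs_self _) hzim2
    calc |BB β p| * |BB β r| * (Real.exp (-z.re) / ‖z‖) ≤ 1 * (Real.exp (-z.re) / ‖z‖) := by gcongr
      _ ≤ k.re ^ (-(1/4):ℝ) * D ^ 3 * EE (min A B) (max A B - min A B) := by rw [one_mul]; exact fin
      _ ≤ k.re ^ (-(1/4):ℝ) * ((N:ℝ) ^ 2) ^ 3 * EE (min A B) (max A B - min A B) := by
          gcongr; exact EE_nonneg _ _
      _ = _ := by ring
  rw [Finset.sum_product]
  have : ∀ p ∈ pp N, ∑ m ∈ Finset.Icc 1 M, ∑ j ∈ pp N ×ˢ Finset.Icc 1 M, (if yy (p, m) = yy j then 0 else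
      |BB β p| * |BB β j.1| * (Real.exp (-(Real.pi * (k * yy (p, m) ^ 2 + conj k * yy j ^ 2)).re) / ‖Real.pi * (k * yy (p, m) ^ 2 + conj k * yy j ^ 2)‖))
      ≤ ∑ r ∈ pp N, k.re ^ (-(1/4):ℝ) * (N:ℝ) ^ 6 * (2 * C0) := by
    intro p hp
    simp_rw [Finset.sum_product]
    rw [Finset.sum_comm]
    exact Finset.sum_le_sum fun r hr => key p hp r hr
  refine (Finset.sum_le_sum this).trans (le_of_eq ?_)
  simp [pp]; ring

noncomputable def GM (k : ℂ) (β : ℕ → ℝ) (N M : ℕ) (x : ℝ) : ℂ :=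
  ∑ i ∈ pp N ×ˢ Finset.Icc 1 M, (BB β i.1 : ℂ) * cexp (-(Real.pi * k * yy i ^ 2) * (x:ℂ) ^ 2)

noncomputable def KH (k : ℂ) (β : ℕ → ℝ) (N : ℕ) : ℂ := ∑ p ∈ pp N, (BB β p : ℂ) * ((1/2) * (k⁻¹) ^ (1/2 : ℂ) * ((p.2:ℂ) / p.1))

theorem GM_tendsto {k : ℂ} (hk : 0 < k.re) (β : ℕ → ℝ) (N : ℕ) {x : ℝ} (hx : 0 < x) :
    Tendsto (fun M => GM k β N M x - KH k β N / x) atTop (𝓝 (HH k β N x)) := by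
  have e : HH k β N x = (∑ p ∈ pp N, (BB β p : ℂ) * ((th k ((((p.1:ℝ) / p.2) * x) ^ (2:ℝ)) - 1) / 2)) - KH k β N / x := by
    rw [HH, KH, pp, ← Finset.sum_product', Finset.sum_div, ← Finset.sum_sub_distrib]
    refine Finset.sum_congr rfl fun p hp => ?_
    have hp' := mem_pp.1 hp
    have h1 : (0:ℝ) < p.1 := by exact_mod_cast hp'.1.1
    have h2 : (0:ℝ) < p.2 := by exact_mod_cast hp'.2.1
    have h3 : ((((p.1:ℝ) / p.2) * x) ^ (2:ℝ)) ^ (-(1/2):ℝ) = (((p.1:ℝ) / p.2) * x)⁻¹ := by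
      rw [← Real.rpow_mul (by positivity)]; norm_num [Real.rpow_neg_one]
    rw [om, FF, h3, BB]
    push_cast
    have : (p.1:ℂ) ≠ 0 := by exact_mod_cast h1.ne'
    have : (p.2:ℂ) ≠ 0 := by exact_mod_cast h2.ne'
    have : (x:ℂ) ≠ 0 := by exact_mod_cast hx.ne'
    field_simp
  rw [e]
  refine Tendsto.sub_const ?_ _
  have e2 : ∀ M, GM k β N M x = ∑ p ∈ pp N, (BB β p : ℂ) * ∑ m ∈ Finset.range M, cexp (Real.pi * I * ((m:ℂ) + 1) ^ 2 * (I * k * ((((p.1:ℝ) / p.2) * x) ^ (2:ℝ) : ℝ))) := by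
    intro M
    rw [GM, Finset.sum_product]
    refine Finset.sum_congr rfl fun p hp => ?_
    dsimp only
    rw [← Finset.mul_sum]
    congr 1
    have h := Finset.sum_Ico_add' (fun m : ℕ => cexp (-(Real.pi * k * yy (p, m) ^ 2) * (x:ℂ) ^ 2)) 0 M 1
    have h' : Finset.Icc 1 M = Finset.Ico (0 + 1) (M + 1) := by ext; simp
    rw [h', ← h, Finset.range_eq_Ico]
    refine Finset.sum_congr rfl fun m _ => ?_
    congr 1
    rw [Real.rpow_two, yy]; push_cast
    linear_combination (-(Real.pi * k * (m + 1) ^ 2 * ((p.1:ℂ) / p.2 * x) ^ 2)) * I_sq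
  simp_rw [e2]
  refine tendsto_finsetSum _ fun p hp => Tendsto.const_mul _ ?_
  have hp' := mem_pp.1 hp
  have h1 : (0:ℝ) < p.1 := by exact_mod_cast hp'.1.1
  have h2 : (0:ℝ) < p.2 := by exact_mod_cast hp'.2.1
  exact (hasSum_nat_jacobiTheta (th_im hk (by positivity))).tendsto_sum_nat

theorem KH_le {k : ℂ} (hk : 0 < k.re) (hk1 : ‖k‖ = 1) {β : ℕ → ℝ} (N : ℕ) (hβ : ∀ n, |β n| ≤ 1) : ‖KH k β N‖ ≤ (N:ℝ) ^ 2 := by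
  have hn : ‖(k⁻¹) ^ (1/2 : ℂ)‖ = 1 := by
    rw [norm_cpow_of_ne_zero (by apply inv_ne_zero; rintro rfl; simp at hk)]
    simp [hk1]
  have : ∀ p ∈ pp N, ‖(BB β p : ℂ) * ((1/2) * (k⁻¹) ^ (1/2 : ℂ) * ((p.2:ℂ) / p.1))‖ ≤ 1 := by
    intro p hp
    have hp' := mem_pp.1 hp
    have h1 : (1:ℝ) ≤ p.1 := by exact_mod_cast hp'.1.1
    have h2 : (1:ℝ) ≤ p.2 := by exact_mod_cast hp'.2.1
    rw [norm_mul, norm_mul, norm_mul, hn, norm_real, BB, norm_div (β p.1 * β p.2), norm_div (p.2:ℂ), norm_mul, norm_natCast, norm_natCast, Real.norm_natCast]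
    have hb := mul_le_one₀ (hβ p.1) (abs_nonneg _) (hβ p.2)
    rw [← Real.norm_eq_abs, ← Real.norm_eq_abs] at hb
    have : ‖β p.1‖ * ‖β p.2‖ / p.2 * (‖(1/2:ℂ)‖ * 1 * (p.2 / p.1)) = (‖β p.1‖ * ‖β p.2‖) * (1 / 2) / p.1 := by
      norm_num; field_simp
    rw [this, div_le_one (by positivity)]
    linarith
  refine (norm_sum_le _ _).trans ((Finset.sum_le_sum this).trans (le_of_eq ?_))
  simp [pp]; ring

theorem HH_bd {k : ℂ} (hk : 0 < k.re) (hk1 : ‖k‖ = 1) (him : 1/2 ≤ k.im) {β : ℕ → ℝ} (N : ℕ) (hβ : ∀ n, |β n| ≤ 1)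
    {h x0 τ : ℝ} (hh : 0 ≤ h) (hx0 : 1 ≤ x0) (hτ : 0 < τ) :
    ∫ x in Ioi (1:ℝ), ‖HH k β N x‖ ^ 2 / (1 + h * Real.log x) ^ 2 ≤
      2 * (SS β N 0 / (2 * √(2 * k.re)) * (Real.log x0 / (1 + h * Real.log x0)) + 2 * (N:ℝ) ^ 4 * x0 + ww h x0 * x0 ^ (-τ) *
      ((2 * Real.pi * k.re) ^ (-(τ + 1) / 2) * (1/2) * Real.Gamma ((τ + 1) / 2)) * (ZZ τ * SS β N τ + 1) +
      2 * C0 * (N:ℝ) ^ 10 * k.re ^ (-(1/4):ℝ)) + 2 * (N:ℝ) ^ 4 := by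
  have hB : ∀ p ∈ pp N, |BB β p| ≤ 1 := by
    intro p hp
    have h2 : (1:ℝ) ≤ p.2 := by exact_mod_cast (mem_pp.1 hp).2.1
    rw [BB, abs_div, abs_mul, abs_of_pos (by linarith : (0:ℝ) < p.2), div_le_one (by linarith)]
    exact (mul_le_one₀ (hβ p.1) (abs_nonneg _) (hβ p.2)).trans h2
  set Bd := SS β N 0 / (2 * √(2 * k.re)) * (Real.log x0 / (1 + h * Real.log x0)) + 2 * (N:ℝ) ^ 4 * x0 + ww h x0 * x0 ^ (-τ) *
      ((2 * Real.pi * k.re) ^ (-(τ + 1) / 2) * (1/2) * Real.Gamma ((τ + 1) / 2)) * (ZZ τ * SS β N τ + 1) +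
      2 * C0 * (N:ℝ) ^ 10 * k.re ^ (-(1/4):ℝ) with hBd
  have hyy : ∀ M, ∀ i ∈ pp N ×ˢ Finset.Icc 1 M, 0 < yy i := by
    intro M i hi
    rw [Finset.mem_product, mem_pp, Finset.mem_Icc] at hi
    have h1 : (0:ℝ) < i.1.1 := by exact_mod_cast hi.1.1.1
    have h2 : (0:ℝ) < i.1.2 := by exact_mod_cast hi.1.2.1
    have h3 : (0:ℝ) < i.2 := by exact_mod_cast hi.2.1
    unfold yy; positivity
  have hM : ∀ᶠ M in atTop, ∫ x in Ioi (1:ℝ), ww h x * ‖GM k β N M x‖ ^ 2 ≤ Bd := by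
    filter_upwards [QQ_pt N hk hB, QQ_tau (β := β) N hτ] with M h1 h2
    refine (expand (pp N ×ˢ Finset.Icc 1 M) (fun i => BB β i.1) yy hk (hyy M) hh).2.trans ?_
    have h3 := diag_int (pp N ×ˢ Finset.Icc 1 M) (fun i => BB β i.1) yy (hyy M) hk hh hx0 hτ (c2 := 2 * (N:ℝ) ^ 4) (by positivity)
      fun x hx => h1 x hx.1.le
    have h4 := off_le N M hk him hB
    have h5 : ww h x0 * x0 ^ (-τ) * ((2 * Real.pi * k.re) ^ (-(τ + 1) / 2) * (1/2) * Real.Gamma ((τ + 1) / 2)) *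
      (∑ i ∈ pp N ×ˢ Finset.Icc 1 M, ∑ j ∈ pp N ×ˢ Finset.Icc 1 M, if yy i = yy j then BB β i.1 * BB β j.1 * yy i ^ (-(τ + 1)) else 0) ≤
      ww h x0 * x0 ^ (-τ) * ((2 * Real.pi * k.re) ^ (-(τ + 1) / 2) * (1/2) * Real.Gamma ((τ + 1) / 2)) * (ZZ τ * SS β N τ + 1) := by
      have := (ww_pos hh hx0).1
      have : 0 < Real.Gamma ((τ + 1) / 2) := Real.Gamma_pos_of_pos (by positivity)
      have := Real.pi_pos
      refine mul_le_mul_of_nonneg_left h2 (by positivity)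
    have h6 := add_le_add (h3.trans (add_le_add_right h5 _)) h4
    refine le_trans (le_of_eq ?_) h6
    rw [← Finset.sum_add_distrib]
    refine Finset.sum_congr rfl fun i _ => ?_
    rw [← Finset.sum_add_distrib]
    refine Finset.sum_congr rfl fun j _ => ?_
    split_ifs <;> simp
  have hGi : ∀ M, IntegrableOn (fun x : ℝ => ww h x * ‖GM k β N M x‖ ^ 2) (Ioi 1) := fun M =>
    (expand (pp N ×ˢ Finset.Icc 1 M) (fun i => BB β i.1) yy hk (hyy M) hh).1
  have hri : IntegrableOn (fun x : ℝ => 2 * (N:ℝ) ^ 4 * x ^ (-2:ℝ)) (Ioi 1) :=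
    (integrableOn_Ioi_rpow_of_lt (by norm_num) one_pos).const_mul _
  have hrI : ∫ x in Ioi (1:ℝ), 2 * (N:ℝ) ^ 4 * x ^ (-2:ℝ) = 2 * (N:ℝ) ^ 4 := by
    rw [integral_const_mul, integral_Ioi_rpow_of_lt (by norm_num) one_pos]; norm_num
  set Hm : ℕ → ℝ → ℝ := fun M x => ww h x * ‖GM k β N M x - KH k β N / x‖ ^ 2 with hHm
  have hHb : ∀ M, ∀ x ∈ Ioi (1:ℝ), Hm M x ≤ 2 * (ww h x * ‖GM k β N M x‖ ^ 2) + 2 * (N:ℝ) ^ 4 * x ^ (-2:ℝ) := by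
    intro M x hx
    have hx1 : (1:ℝ) < x := hx
    have hw := ww_pos hh hx1.le
    have h1 : ‖GM k β N M x - KH k β N / x‖ ^ 2 ≤ 2 * ‖GM k β N M x‖ ^ 2 + 2 * ((N:ℝ) ^ 4 * x ^ (-2:ℝ)) := by
      have := norm_sub_le (GM k β N M x) (KH k β N / x)
      have h2 : ‖KH k β N / x‖ ^ 2 ≤ (N:ℝ) ^ 4 * x ^ (-2:ℝ) := by
        rw [norm_div, norm_real, Real.norm_of_nonneg (by linarith), Real.rpow_neg (by linarith), Real.rpow_two, div_pow, ← div_eq_mul_inv]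
        gcongr
        calc ‖KH k β N‖ ^ 2 ≤ ((N:ℝ) ^ 2) ^ 2 := by gcongr; exact KH_le hk hk1 N hβ
          _ = _ := by ring
      nlinarith [sq_nonneg (‖GM k β N M x‖ - ‖KH k β N / x‖), norm_nonneg (GM k β N M x - KH k β N / x)]
    have hp : (0:ℝ) ≤ (N:ℝ) ^ 4 * x ^ (-2:ℝ) := by positivity
    have h3 := mul_le_mul_of_nonneg_left h1 hw.1.le
    have h4 := mul_le_mul_of_nonneg_right hw.2 hp
    simp only [hHm]
    linarith
  have hGc : ∀ M, Continuous (GM k β N M) := by intro M; unfold GM; fun_prop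
  have hHmeas : ∀ M, Measurable (Hm M) := by
    intro M
    refine (ww_meas h).mul ?_
    have := (hGc M).measurable
    fun_prop
  have hHnn : ∀ M, ∀ x ∈ Ioi (1:ℝ), 0 ≤ Hm M x := fun M x hx => mul_nonneg (ww_pos hh (le_of_lt hx)).1.le (sq_nonneg _)
  have hlin : ∀ᶠ M in atTop, ∫⁻ x in Ioi (1:ℝ), ENNReal.ofReal (Hm M x) ≤ ENNReal.ofReal (2 * Bd + 2 * (N:ℝ) ^ 4) := by
    filter_upwards [hM] with M hM
    have hi : Integrable (fun x : ℝ => 2 * (ww h x * ‖GM k β N M x‖ ^ 2) + 2 * (N:ℝ) ^ 4 * x ^ (-2:ℝ)) (volume.restrict (Ioi 1)) :=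
      ((hGi M).const_mul 2).add hri
    have hi2 : IntegrableOn (Hm M) (Ioi 1) := by
      refine hi.mono' (hHmeas M).aestronglyMeasurable ?_
      filter_upwards [ae_restrict_mem measurableSet_Ioi] with x hx
      rw [Real.norm_of_nonneg (hHnn M x hx)]
      exact hHb M x hx
    rw [← ofReal_integral_eq_lintegral_ofReal hi2 (by filter_upwards [ae_restrict_mem measurableSet_Ioi] with x hx using hHnn M x hx)]
    apply ENNReal.ofReal_le_ofReal
    refine (setIntegral_mono_on hi2 hi measurableSet_Ioi (hHb M)).trans ?_
    rw [integral_add ((hGi M).const_mul 2) hri, integral_const_mul, hrI]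
    linarith
  have hfat : ∫⁻ x in Ioi (1:ℝ), ENNReal.ofReal (‖HH k β N x‖ ^ 2 / (1 + h * Real.log x) ^ 2) ≤ ENNReal.ofReal (2 * Bd + 2 * (N:ℝ) ^ 4) := by
    have h1 : ∀ x ∈ Ioi (1:ℝ), ENNReal.ofReal (‖HH k β N x‖ ^ 2 / (1 + h * Real.log x) ^ 2) = liminf (fun M => ENNReal.ofReal (Hm M x)) atTop := by
      intro x hx
      have hx0 : (0:ℝ) < x := lt_trans zero_lt_one hx
      have ht : Tendsto (fun M => ENNReal.ofReal (Hm M x)) atTop (𝓝 (ENNReal.ofReal (‖HH k β N x‖ ^ 2 / (1 + h * Real.log x) ^ 2))) := by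
        refine (ENNReal.continuous_ofReal.tendsto _).comp ?_
        rw [div_eq_inv_mul]
        exact ((GM_tendsto hk β N hx0).norm.pow 2).const_mul _
      exact ht.liminf_eq.symm
    rw [setLIntegral_congr_fun measurableSet_Ioi h1]
    refine (lintegral_liminf_le fun M => (hHmeas M).ennreal_ofReal).trans ?_
    exact liminf_le_of_frequently_le' hlin.frequently
  have hpos : 0 ≤ 2 * Bd + 2 * (N:ℝ) ^ 4 := by
    obtain ⟨M, hM⟩ := hM.exists
    have : 0 ≤ ∫ x in Ioi (1:ℝ), ww h x * ‖GM k β N M x‖ ^ 2 := setIntegral_nonneg measurableSet_Ioi fun x hx =>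
      mul_nonneg (ww_pos hh (le_of_lt hx)).1.le (sq_nonneg _)
    have : (0:ℝ) ≤ 2 * (N:ℝ) ^ 4 := by positivity
    linarith
  rw [integral_eq_lintegral_of_nonneg_ae (Eventually.of_forall fun x => by simp only [Pi.zero_apply]; positivity)]
  · exact ENNReal.toReal_le_of_le_ofReal hpos hfat
  · refine ContinuousOn.aestronglyMeasurable ?_ measurableSet_Ioi
    refine ContinuousOn.div ?_ ?_ ?_
    · exact ((HH_cont hk β N).mono (Ioi_subset_Ioi zero_le_one)).norm.pow 2
    · refine ((continuousOn_const.add (continuousOn_const.mul (Real.continuousOn_log.mono fun x hx => ?_))).pow 2)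
      simp only [mem_compl_iff, mem_singleton_iff]
      exact (lt_trans zero_lt_one hx).ne'
    · intro x hx
      have := Real.log_pos hx
      positivity
end Sel

namespace Sel
open MeasureTheory Set Filter Topology Complex
open scoped ComplexConjugate

theorem nrm_ci (c y : ℝ) : ‖(c:ℂ) + y * I‖ ^ 2 = c ^ 2 + y ^ 2 := by
  rw [← normSq_eq_norm_sq, normSq_add_mul_I]

theorem ci_ne {c : ℝ} (hc : 0 < c) (y : ℝ) : (c:ℂ) + y * I ≠ 0 := by
  intro h; have := congrArg re h; simp at this; linarith

theorem ci_int {c : ℝ} (hc : 0 < c) : Integrable (fun y : ℝ => 1 / ((c:ℂ) + y * I) ^ 2) := by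
  refine ((integrable_inv_one_add_sq).const_mul (1 + 1 / c ^ 2)).mono' ?_ (Eventually.of_forall fun y => ?_)
  · refine Continuous.aestronglyMeasurable ?_
    exact continuous_const.div (by fun_prop) fun y => pow_ne_zero _ (ci_ne hc y)
  · rw [norm_div, norm_pow, nrm_ci, norm_one, ← div_eq_mul_inv, div_le_div_iff₀ (by positivity) (by positivity)]
    have : (1 + 1 / c ^ 2) * (c ^ 2 + y ^ 2) = 1 + y ^ 2 + c ^ 2 + y ^ 2 / c ^ 2 := by field_simp; ring
    rw [this, one_mul]; have : 0 ≤ y ^ 2 / c ^ 2 := by positivity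
    nlinarith [sq_nonneg c]

theorem perron {c x : ℝ} (hc : 0 < c) (hx : 0 < x) :
    (1 / (2 * Real.pi)) * ∫ y : ℝ, (x:ℂ) ^ (-((c:ℂ) + y * I)) * (1 / ((c:ℂ) + y * I) ^ 2) = ((max 0 (-Real.log x) : ℝ):ℂ) := by
  set f0 : ℝ → ℂ := indicator (Ioc 0 1) (fun _ => 1) with hf0
  have h1 : ∀ s : ℂ, 0 < s.re → MellinConvergent (fun t => Real.log t • f0 t) s ∧ HasDerivAt (mellin f0) (mellin (fun t => Real.log t • f0 t) s) s := by
    intro s hs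
    refine mellin_hasDerivAt_of_isBigO_rpow (a := s.re + 1) (b := 0) ?_ ?_ (by linarith) ?_ hs
    · exact ((integrable_indicator_iff measurableSet_Ioc).2 (by simp)).locallyIntegrable.locallyIntegrableOn _
    · refine Asymptotics.IsBigO.of_bound 0 ?_
      filter_upwards [eventually_gt_atTop 1] with t ht
      simp [hf0, ht]
    · refine Asymptotics.IsBigO.of_bound 1 (Eventually.of_forall fun t => ?_)
      simp only [hf0, neg_zero, Real.rpow_zero, norm_one, mul_one]
      refine (norm_indicator_le_norm_self _ _).trans (by simp)
  have h2 : ∀ s : ℂ, 0 < s.re → mellin (fun t => Real.log t • f0 t) s = -(1 / s ^ 2) := by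
    intro s hs
    have hs0 : s ≠ 0 := by rintro rfl; simp at hs
    refine (h1 s hs).2.unique ?_
    have := (hasDerivAt_inv hs0)
    rw [one_div]
    refine this.congr_of_eventuallyEq ?_
    filter_upwards [(isOpen_lt continuous_const continuous_re).mem_nhds hs] with z hz
    rw [(hasMellin_one_Ioc hz).2, one_div]
  have h2' := fun y : ℝ => h2 ((c:ℂ) + y * I) (by simpa using hc)
  have h3 := mellinInv_mellin_eq c (fun t => Real.log t • f0 t) hx (h1 c (by simpa using hc)).1 ?_ ?_
  · have e : (((max 0 (-Real.log x) : ℝ)):ℂ) = -(Real.log x • f0 x) := by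
      simp only [hf0, indicator, mem_Ioc, hx, true_and]
      split_ifs with h
      · rw [max_eq_right (by linarith [Real.log_nonpos hx.le h])]; simp
      · rw [max_eq_left (by linarith [Real.log_nonneg (not_le.1 h).le])]; simp
    rw [e, ← h3, mellinInv]
    simp_rw [smul_eq_mul, h2', mul_neg]
    rw [integral_neg, real_smul, mul_neg, neg_neg]; push_cast; rfl
  · unfold VerticalIntegrable
    simp_rw [h2']
    exact (ci_int hc).neg
  · have : (fun t : ℝ => Real.log t • f0 t) =ᶠ[𝓝 x] fun t => ((min 0 (Real.log t) : ℝ) : ℂ) := by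
      filter_upwards [eventually_gt_nhds hx] with t ht
      simp only [hf0, indicator, mem_Ioc, ht, true_and]
      split_ifs with h
      · rw [min_eq_right (Real.log_nonpos ht.le h)]; simp
      · rw [min_eq_left (Real.log_nonneg (not_le.1 h).le)]; simp
    refine ContinuousAt.congr ?_ this.symm
    exact continuous_ofReal.continuousAt.comp (continuousAt_const.min (Real.continuousAt_log hx.ne'))
end Sel

namespace Sel
open MeasureTheory Set Filter Topology Complex

noncomputable def al (n : ℕ) : ℝ := ArithmeticFunction.moebius n * (1/2) ^ n.primeFactors.card
noncomputable def sg (r : ℕ) : ℝ := ∑ d ∈ r.divisors, 1 / (d:ℝ)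
noncomputable def ff (r : ℕ) (w : ℂ) (n : ℕ) : ℂ := if n.Coprime r then al n * (n:ℂ) ^ (-w) else 0

theorem al_le (n : ℕ) : |al n| ≤ (1/2) ^ n.primeFactors.card := by
  rw [al, abs_mul, abs_of_nonneg (by positivity : (0:ℝ) ≤ (1/2) ^ n.primeFactors.card)]
  refine mul_le_of_le_one_left (by positivity) ?_
  exact_mod_cast ArithmeticFunction.abs_moebius_le_one

theorem al_le1 (n : ℕ) : |al n| ≤ 1 := (al_le n).trans (pow_le_one₀ (by norm_num) (by norm_num))

theorem al_mul {m n : ℕ} (h : m.Coprime n) : al (m * n) = al m * al n := by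
  rw [al, al, al, ArithmeticFunction.isMultiplicative_moebius.map_mul_of_coprime h, h.primeFactors_mul,
    Finset.card_union_of_disjoint h.disjoint_primeFactors, pow_add]
  push_cast; ring

theorem al_sq {n : ℕ} (h : ¬ Squarefree n) : al n = 0 := by
  rw [al, ArithmeticFunction.moebius_eq_zero_of_not_squarefree h]; simp

theorem sg_one_le {r : ℕ} (hr : r ≠ 0) : 1 ≤ sg r := by
  have := Finset.single_le_sum (f := fun d : ℕ => 1 / (d:ℝ)) (fun i _ => by positivity) (Nat.one_mem_divisors.2 hr)
  simpa [sg] using this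

theorem prod_sg {r : ℕ} (hr : r ≠ 0) : ∏ p ∈ r.primeFactors, (1 + 1 / (p:ℝ)) ≤ sg r := by
  rw [Finset.prod_one_add]
  have e : ∀ t ∈ r.primeFactors.powerset, (∏ i ∈ t, i).primeFactors = t := fun t ht =>
    Nat.primeFactors_prod fun p hp => Nat.prime_of_mem_primeFactors (Finset.mem_powerset.1 ht hp)
  have inj : Set.InjOn (fun t : Finset ℕ => ∏ i ∈ t, i) r.primeFactors.powerset := by
    intro a ha b hb h
    rw [← e a ha, ← e b hb]; exact congrArg _ h
  have : ∑ t ∈ r.primeFactors.powerset, ∏ i ∈ t, 1 / (i:ℝ) = ∑ d ∈ r.primeFactors.powerset.image (fun t : Finset ℕ => ∏ i ∈ t, i), 1 / (d:ℝ) := by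
    rw [Finset.sum_image inj]
    refine Finset.sum_congr rfl fun t _ => ?_
    push_cast; simp [Finset.prod_inv_distrib]
  rw [this]
  refine Finset.sum_le_sum_of_subset_of_nonneg ?_ fun _ _ _ => by positivity
  intro d hd
  obtain ⟨t, ht, rfl⟩ := Finset.mem_image.1 hd
  exact Nat.mem_divisors.2 ⟨(Finset.prod_dvd_prod_of_subset _ _ _ (Finset.mem_powerset.1 ht)).trans (Nat.prod_primeFactors_dvd r), hr⟩

theorem ff_norm (r : ℕ) {w : ℂ} (n : ℕ) : ‖ff r w n‖ ≤ (n:ℝ) ^ (-w.re) := by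
  rcases Nat.eq_zero_or_pos n with rfl | hn
  · have : ff r w 0 = 0 := by simp [ff, al]
    rw [this]; simp; positivity
  · have h : ‖(n:ℂ) ^ (-w)‖ = (n:ℝ) ^ (-w.re) := by
      rw [← ofReal_natCast, norm_cpow_eq_rpow_re_of_pos (by exact_mod_cast hn)]; simp
    unfold ff; split_ifs
    · rw [norm_mul, norm_real, h]
      exact mul_le_of_le_one_left (by positivity) (al_le1 n)
    · simp; positivity

theorem nsum {x : ℝ} (hx : 1 < x) : Summable fun n : ℕ => (n:ℝ) ^ (-x) := Real.summable_nat_rpow.2 (by linarith)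

theorem ff_sum (r : ℕ) {w : ℂ} (hw : 1 < w.re) : Summable fun n => ‖ff r w n‖ :=
  Summable.of_nonneg_of_le (fun _ => norm_nonneg _) (fun n => ff_norm r n) (nsum hw)

noncomputable def CA : ℝ := Real.exp (∑' n : ℕ, 2 * (n:ℝ) ^ (-2:ℝ))

theorem euler_bd {r : ℕ} (hr : r ≠ 0) {w : ℂ} (hw : 1 < w.re) :
    ‖∑' n, ff r w n‖ ^ 2 * ‖riemannZeta w‖ ≤ CA * sg r := by
  have h0 : ff r w 0 = 0 := by simp [ff, al]
  have h1 : ff r w 1 = 1 := by simp [ff, al]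
  have hm : ∀ {m n : ℕ}, m.Coprime n → ff r w (m * n) = ff r w m * ff r w n := by
    intro m n h
    simp only [ff, Nat.coprime_mul_iff_left]
    by_cases hmr : m.Coprime r <;> by_cases hnr : n.Coprime r
    rotate_left
    iterate 3 simp [hmr, hnr]
    rw [if_pos ⟨hmr, hnr⟩, if_pos hmr, if_pos hnr]
    rw [al_mul h, Nat.cast_mul, natCast_mul_natCast_cpow]; push_cast; ring
  have t1 := EulerProduct.eulerProduct h1 hm (ff_sum r hw) h0
  have t2 := ((t1.norm).pow 2).mul (riemannZeta_eulerProduct hw).norm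
  refine le_of_tendsto' t2 fun n => ?_
  have hpr : ∀ p ∈ Nat.primesBelow n, p.Prime := fun p hp => Nat.prime_of_mem_primesBelow hp
  have loc : ∀ p ∈ Nat.primesBelow n, ‖∑' e, ff r w (p ^ e)‖ ^ 2 * ‖(1 - (p:ℂ) ^ (-w))⁻¹‖ ≤
      Real.exp (2 * (p:ℝ) ^ (-2:ℝ)) * (if p ∣ r then 1 + 1 / (p:ℝ) else 1) := by
    intro p hp
    have pp := hpr p hp
    have hp2 : (2:ℝ) ≤ p := by exact_mod_cast pp.two_le
    set z := (p:ℂ) ^ (-w) with hz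
    have hzn : ‖z‖ ≤ 1 / p := by
      rw [hz, ← ofReal_natCast, norm_cpow_eq_rpow_re_of_pos (by linarith), one_div, ← Real.rpow_neg_one]
      refine Real.rpow_le_rpow_of_exponent_le (by linarith) (by simp; linarith)
    have hp12 : 1 / (p:ℝ) ≤ 1/2 := one_div_le_one_div_of_le two_pos hp2
    have hr1 : 1 - 1 / (p:ℝ) ≤ ‖1 - z‖ := by
      have := norm_sub_norm_le 1 z
      rw [norm_one] at this; linarith
    have e : ∑' e, ff r w (p ^ e) = if p ∣ r then 1 else 1 - z / 2 := by
      rw [tsum_eq_sum (s := Finset.range 2)]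
      · rw [Finset.sum_range_succ, Finset.sum_range_one, pow_zero, pow_one, h1, ff]; simp only [pp.coprime_iff_not_dvd]
        by_cases h : p ∣ r
        · simp [h]
        · simp only [h, not_false_eq_true, if_true, if_false, al, ArithmeticFunction.moebius_apply_prime pp, pp.primeFactors, Finset.card_singleton, ← hz]
          push_cast; ring
      · intro e he
        have : ¬ Squarefree (p ^ e) := by
          intro h
          have := (Nat.squarefree_pow_iff pp.ne_one (by simp at he; omega)).1 h
          simp at he; omega
        simp [ff, al_sq this]
    have hu : (p:ℝ) ^ (-2:ℝ) = (1 / (p:ℝ)) ^ 2 := by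
      rw [Real.rpow_neg (by linarith), Real.rpow_two, one_div, inv_pow]
    have hexp : 1 + 2 * (1 / (p:ℝ)) ^ 2 ≤ Real.exp (2 * (p:ℝ) ^ (-2:ℝ)) := by
      rw [hu]; linarith [Real.add_one_le_exp (2 * (1 / (p:ℝ)) ^ 2)]
    set u := 1 / (p:ℝ) with hu'
    have hu0 : 0 < u := by positivity
    have hpos : 0 < ‖1 - z‖ := by linarith
    rw [e, norm_inv, ← div_eq_mul_inv, div_le_iff₀ hpos]
    split_ifs with h
    · rw [norm_one, one_pow]
      calc (1:ℝ) ≤ (1 + 2 * u ^ 2) * (1 + u) * (1 - u) := by nlinarith [mul_nonneg (sq_nonneg u) (by nlinarith : 0 ≤ 1 - 2 * u ^ 2)]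
        _ ≤ _ := by gcongr; linarith
    · rw [mul_one]
      have h2 : ‖1 - z / 2‖ ^ 2 ≤ ‖1 - z‖ + u ^ 2 / 4 := by
        rw [← norm_pow, show (1 - z / 2) ^ 2 = (1 - z) + z ^ 2 / 4 by ring]
        refine (norm_add_le _ _).trans ?_
        rw [norm_div, norm_pow]; norm_num; gcongr
      nlinarith [mul_le_mul_of_nonneg_right hexp hpos.le, sq_nonneg u]
  rw [norm_prod, norm_prod, ← Finset.prod_pow, ← Finset.prod_mul_distrib]
  refine (Finset.prod_le_prod (fun _ _ => by positivity) loc).trans ?_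
  rw [Finset.prod_mul_distrib]
  refine mul_le_mul ?_ ?_ (Finset.prod_nonneg fun _ _ => by split_ifs <;> positivity) (Real.exp_pos _).le
  · rw [← Real.exp_sum]
    refine Real.exp_le_exp.2 (Summable.sum_le_tsum _ (fun _ _ => by positivity) ((nsum (by norm_num)).mul_left 2))
  · rw [← Finset.prod_filter]
    refine le_trans ?_ (prod_sg hr)
    refine Finset.prod_le_prod_of_subset_of_one_le ?_ (fun _ _ => by positivity) fun p _ _ => by
      have : 0 ≤ 1 / (p:ℝ) := by positivity
      linarith
    intro p hp
    rw [Finset.mem_filter] at hp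
    exact Nat.mem_primeFactors.2 ⟨hpr p hp.1, hp.2, hr⟩
end Sel

namespace Sel
open MeasureTheory Set Filter Topology Complex

theorem zinv1 {w : ℂ} (hw : 1 < w.re) : ‖riemannZeta w‖⁻¹ ≤ 1 + 1 / (w.re - 1) := by
  have h := ArithmeticFunction.LSeries_zeta_mul_Lseries_moebius hw
  rw [ArithmeticFunction.LSeries_zeta_eq_riemannZeta hw] at h
  have h2 : ‖riemannZeta w‖⁻¹ = ‖LSeries (fun n => (ArithmeticFunction.moebius n : ℂ)) w‖ := by
    rw [← norm_inv, inv_eq_of_mul_eq_one_right h]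
  have hs : Summable fun n : ℕ => (n:ℝ) ^ (-w.re) := nsum hw
  have h3 : ∀ n : ℕ, ‖LSeries.term (fun n => (ArithmeticFunction.moebius n : ℂ)) w n‖ ≤ (n:ℝ) ^ (-w.re) := by
    intro n
    rw [LSeries.norm_term_eq]
    split_ifs with h
    · positivity
    · rw [Real.rpow_neg (by positivity), div_eq_mul_inv]
      refine mul_le_of_le_one_left (by positivity) ?_
      rw [norm_intCast]; exact_mod_cast ArithmeticFunction.abs_moebius_le_one
  rw [h2, LSeries]
  refine (tsum_of_norm_bounded hs.hasSum h3).trans ?_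
  refine le_trans (le_of_eq ?_) (ZZ_le (sub_pos.2 hw))
  rw [hs.tsum_eq_zero_add, ZZ]
  simp only [Nat.cast_zero, sub_add_cancel]
  rw [Real.zero_rpow (by linarith), zero_add]; push_cast; rfl

theorem zinv2 : ∃ r0 > (0:ℝ), ∀ w : ℂ, 1 < w.re → ‖w - 1‖ < r0 → ‖riemannZeta w‖⁻¹ ≤ 2 * ‖w - 1‖ := by
  have h := (riemannZeta_residue_one.norm).eventually (lt_mem_nhds (by norm_num : (1/2:ℝ) < ‖(1:ℂ)‖))
  rw [eventually_nhdsWithin_iff, Metric.eventually_nhds_iff] at h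
  obtain ⟨r, hr, h⟩ := h
  refine ⟨r, hr, fun w hw hwr => ?_⟩
  have h1 := h (by rwa [dist_eq]) (by rintro rfl; simp at hw)
  rw [norm_mul] at h1
  have hz : 0 < ‖riemannZeta w‖ := norm_pos_iff.2 (riemannZeta_ne_zero_of_one_lt_re hw)
  rw [inv_le_iff_one_le_mul₀ hz]; linarith

theorem perron_bd : ∃ K > (0:ℝ), ∀ L Y τ : ℝ, ∀ r : ℕ, 1 ≤ L → 0 < Y → Y ≤ Real.exp L → 0 ≤ τ → τ ≤ 1 / L → r ≠ 0 →
    ‖∑' n : ℕ, (if n.Coprime r then (al n:ℂ) * (n:ℂ) ^ (-(1 + τ : ℂ)) else 0) * ((max 0 (-Real.log (n / Y)) : ℝ):ℂ)‖ ≤ K * √(sg r * L) := by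
  obtain ⟨r0, hr0, hz2⟩ := zinv2
  set g : ℝ → ℝ := fun u => (1 + ‖u‖ ^ 2) ^ (-(3/2:ℝ) / 2) with hg
  have hgi : Integrable g := integrable_rpow_neg_one_add_norm_sq (by simp; norm_num)
  have hJ : 0 ≤ ∫ u, g u := integral_nonneg fun u => by simp only [hg]; positivity
  set J := ∫ u, g u
  set B := 1 + 4 / r0 ^ 2 with hB
  have hB0 : 0 < B := by positivity
  have hCA : 0 < CA := Real.exp_pos _
  refine ⟨(1 / (2 * Real.pi)) * (Real.exp 1 * √CA * (2 * J + √2 * B * Real.pi)) + 1, by positivity, ?_⟩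
  intro L Y τ r hL hY hYL hτ hτL hr
  have hL0 : 0 < L := by linarith
  set c := 1 / L with hc
  have hc0 : 0 < c := by positivity
  set a : ℕ → ℂ := fun n => if n.Coprime r then (al n:ℂ) * (n:ℂ) ^ (-(1 + τ : ℂ)) else 0 with ha
  have ha0 : a 0 = 0 := by simp [ha, al]
  set P : ℝ → ℝ → ℂ := fun x y => (x:ℂ) ^ (-((c:ℂ) + y * I)) * (1 / ((c:ℂ) + y * I) ^ 2) with hP
  have hPn : ∀ x y, 0 < x → ‖P x y‖ = x ^ (-c) * ‖1 / ((c:ℂ) + y * I) ^ 2‖ := by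
    intro x y hx
    simp only [hP]; rw [norm_mul, norm_cpow_eq_rpow_re_of_pos hx]; simp
  have hPi : ∀ x, 0 < x → Integrable (P x) := by
    intro x hx
    refine ((ci_int hc0).norm.const_mul (x ^ (-c))).mono' ?_ (Eventually.of_forall fun y => (hPn x y hx).le)
    refine Continuous.aestronglyMeasurable (Continuous.mul ?_ (continuous_const.div (by fun_prop) fun y => pow_ne_zero _ (ci_ne hc0 y)))
    exact Continuous.const_cpow (by fun_prop) (Or.inl (by exact_mod_cast hx.ne'))
  set w : ℝ → ℂ := fun y => 1 + τ + (c + y * I) with hw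
  have hwre : ∀ y, (w y).re = 1 + τ + c := by intro y; simp [hw]
  have hw1 : ∀ y, 1 < (w y).re := by intro y; rw [hwre]; linarith
  have hGt : ∀ n y, a n * P (n / Y) y = ((Y:ℂ) ^ ((c:ℂ) + y * I) * (1 / ((c:ℂ) + y * I) ^ 2)) * ff r (w y) n := by
    intro n y
    rcases Nat.eq_zero_or_pos n with rfl | hn
    · simp [ha0, ff, al]
    have hn' : (0:ℝ) < n := by exact_mod_cast hn
    have hnc : (n:ℂ) ≠ 0 := by exact_mod_cast hn.ne'
    have e : (((n / Y : ℝ)):ℂ) ^ (-((c:ℂ) + y * I)) = (n:ℂ) ^ (-((c:ℂ) + y * I)) * (Y:ℂ) ^ ((c:ℂ) + y * I) := by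
      rw [div_eq_mul_inv, ofReal_mul, mul_cpow_ofReal_nonneg hn'.le (by positivity), ofReal_inv, inv_cpow _ _ (by
        rw [arg_ofReal_of_nonneg hY.le]; exact Real.pi_pos.ne), cpow_neg (Y:ℂ), inv_inv, ofReal_natCast]
    simp only [ha, hP, ff]
    rw [e]
    split_ifs
    · have : (n:ℂ) ^ (-w y) = (n:ℂ) ^ (-(1 + τ : ℂ)) * (n:ℂ) ^ (-((c:ℂ) + y * I)) := by
        rw [← cpow_add _ _ hnc]; congr 1; simp only [hw]; ring
      rw [this]; ring
    · simp
  have hF1 : ∀ n, Integrable (fun y => a n * P (n / Y) y) := by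
    intro n
    rcases Nat.eq_zero_or_pos n with rfl | hn
    · simp [ha0]
    · exact (hPi _ (by positivity)).const_mul _
  have hYc : ∀ y : ℝ, ‖(Y:ℂ) ^ ((c:ℂ) + y * I)‖ ≤ Real.exp 1 := by
    intro y
    rw [norm_cpow_eq_rpow_re_of_pos hY]
    simp only [add_re, ofReal_re, mul_re, I_re, I_im, mul_zero, ofReal_im, mul_one, sub_zero, add_zero]
    calc Y ^ c ≤ (Real.exp L) ^ c := by gcongr
      _ = _ := by rw [← Real.exp_mul, hc, mul_one_div_cancel hL0.ne']
  have hF2 : Summable fun n => ∫ y, ‖a n * P (n / Y) y‖ := by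
    refine Summable.of_nonneg_of_le (fun n => integral_nonneg fun y => norm_nonneg _) (fun n => ?_)
      (((nsum (x := 1 + τ + c) (by linarith)).mul_left (Real.exp 1 * ∫ y : ℝ, ‖1 / ((c:ℂ) + y * I) ^ 2‖)))
    rw [mul_right_comm, ← integral_const_mul]
    refine integral_mono (hF1 n).norm ((ci_int hc0).norm.const_mul _) fun y => ?_
    simp only
    rw [hGt, norm_mul, norm_mul]
    have := ff_norm r (w := w y) n
    rw [hwre] at this
    calc _ ≤ Real.exp 1 * ‖1 / ((c:ℂ) + y * I) ^ 2‖ * (n:ℝ) ^ (-(1 + τ + c)) := by gcongr; exact hYc y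
      _ = _ := by ring
  have hS := hasSum_integral_of_summable_integral_norm hF1 hF2
  have e1 : ∀ n : ℕ, a n * ((max 0 (-Real.log (n / Y)) : ℝ):ℂ) = (1 / (2 * Real.pi)) * ∫ y, a n * P (n / Y) y := by
    intro n
    rcases Nat.eq_zero_or_pos n with rfl | hn
    · simp [ha0]
    · rw [← perron hc0 (x := n / Y) (by positivity), integral_const_mul]; ring
  change ‖∑' n : ℕ, a n * ((max 0 (-Real.log (n / Y)) : ℝ):ℂ)‖ ≤ _
  simp_rw [e1]
  rw [tsum_mul_left, hS.tsum_eq, norm_mul]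
  have hbd : ∀ y, ‖∑' n, a n * P (n / Y) y‖ ≤ Real.exp 1 * √(CA * sg r) * (2 * (L ^ (3/2:ℝ) * g (L * y)) + √(2 * L) * B * (1 + y ^ 2)⁻¹) := by
    intro y
    simp_rw [hGt]
    rw [tsum_mul_left, norm_mul, norm_mul, mul_assoc, mul_assoc (Real.exp 1)]
    refine mul_le_mul (hYc y) ?_ (by positivity) (Real.exp_pos _).le
    rw [norm_div, norm_one, norm_pow, nrm_ci]
    set M := c ^ 2 + y ^ 2 with hM
    have hM0 : 0 < M := by positivity
    set q := ‖w y - 1‖ with hq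
    have hz := euler_bd hr (hw1 y)
    have hzp : 0 < ‖riemannZeta (w y)‖ := norm_pos_iff.2 (riemannZeta_ne_zero_of_one_lt_re (hw1 y))
    have hH : ‖∑' n, ff r (w y) n‖ ≤ √(CA * sg r) * √(‖riemannZeta (w y)‖⁻¹) := by
      rw [← Real.sqrt_mul (by have := sg_one_le hr; positivity)]
      apply Real.le_sqrt_of_sq_le
      rwa [← div_eq_mul_inv, le_div_iff₀ hzp]
    have hqM : q ^ 2 ≤ 4 * M := by
      have : w y - 1 = ((τ + c : ℝ):ℂ) + y * I := by simp only [hw]; push_cast; ring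
      rw [hq, this, nrm_ci]; nlinarith [sq_nonneg y]
    have hgM : L ^ (3/2:ℝ) * g (L * y) = M ^ (-(3/4):ℝ) := by
      have : M = (1 + ‖L * y‖ ^ 2) * (L ^ (2:ℝ))⁻¹ := by
        rw [hM, hc, Real.norm_eq_abs, sq_abs, Real.rpow_two]; field_simp
      rw [this, Real.mul_rpow (by positivity) (by positivity), Real.inv_rpow (by positivity), ← Real.rpow_mul hL0.le, ← Real.rpow_neg hL0.le]
      simp only [hg]; norm_num; ring
    have key : 1 / M * √(‖riemannZeta (w y)‖⁻¹) ≤ 2 * M ^ (-(3/4):ℝ) + √(2 * L) * B * (1 + y ^ 2)⁻¹ := by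
      by_cases hqr : q < r0
      · refine le_trans ?_ (le_add_of_nonneg_right (by positivity))
        have h1 : ‖riemannZeta (w y)‖⁻¹ ≤ 4 * √M := by
          refine (hz2 _ (hw1 y) hqr).trans ?_
          have : q ≤ 2 * √M := by
            rw [show (2:ℝ) * √M = √(4 * M) by rw [Real.sqrt_mul (by norm_num)]; norm_num [show (4:ℝ) = 2 ^ 2 by norm_num]]
            exact Real.le_sqrt_of_sq_le hqM
          linarith
        have h2 : √(4 * √M) = 2 * M ^ (1/4:ℝ) := by
          rw [Real.sqrt_mul (by norm_num), show (4:ℝ) = 2 ^ 2 by norm_num, Real.sqrt_sq (by norm_num), Real.sqrt_eq_rpow, Real.sqrt_eq_rpow, ← Real.rpow_mul hM0.le]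
          norm_num
        calc _ ≤ 1 / M * √(4 * √M) := by gcongr
          _ = 2 * (M ^ (-1:ℝ) * M ^ (1/4:ℝ)) := by rw [h2, Real.rpow_neg_one]; ring
          _ = _ := by rw [← Real.rpow_add hM0]; norm_num
      · refine le_trans ?_ (le_add_of_nonneg_left (by positivity))
        have h1 : ‖riemannZeta (w y)‖⁻¹ ≤ 2 * L := by
          refine (zinv1 (hw1 y)).trans ?_
          have : 1 / ((w y).re - 1) ≤ L := by
            rw [hwre, div_le_iff₀ (by linarith)]
            have : L * c = 1 := by rw [hc]; field_simp
            nlinarith [mul_nonneg hL0.le hτ]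
          linarith
        have h2 : 1 / M ≤ B * (1 + y ^ 2)⁻¹ := by
          rw [← div_eq_mul_inv, div_le_div_iff₀ hM0 (by positivity), one_mul]
          have h3 : r0 ^ 2 ≤ 4 * M := le_trans (by gcongr; linarith) hqM
          have h4 : 1 ≤ 4 / r0 ^ 2 * M := by rw [div_mul_eq_mul_div, le_div_iff₀ (by positivity)]; linarith
          rw [hB, add_mul]; nlinarith [sq_nonneg c]
        calc _ ≤ B * (1 + y ^ 2)⁻¹ * √(2 * L) := by gcongr
          _ = _ := by ring
    rw [hgM]
    calc _ ≤ 1 / M * (√(CA * sg r) * √(‖riemannZeta (w y)‖⁻¹)) := by gcongr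
      _ = √(CA * sg r) * (1 / M * √(‖riemannZeta (w y)‖⁻¹)) := by ring
      _ ≤ _ := by gcongr
  have hgL : Integrable fun y => g (L * y) := hgi.comp_mul_left' hL0.ne'
  have hint1 : Integrable fun y : ℝ => 2 * (L ^ (3/2:ℝ) * g (L * y)) := (hgL.const_mul _).const_mul _
  have hint2 : Integrable fun y : ℝ => √(2 * L) * B * (1 + y ^ 2)⁻¹ := integrable_inv_one_add_sq.const_mul _
  have hfin : ‖∫ y, ∑' n, a n * P (n / Y) y‖ ≤ Real.exp 1 * √(CA * sg r) * (2 * (√L * J) + √(2 * L) * B * Real.pi) := by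
    refine (norm_integral_le_of_norm_le ((hint1.add hint2).const_mul _) (Eventually.of_forall hbd)).trans (le_of_eq ?_)
    rw [integral_const_mul]
    simp only [Pi.add_apply]
    rw [integral_add hint1 hint2, integral_const_mul, integral_const_mul, integral_const_mul, integral_univ_inv_one_add_sq,
      Measure.integral_comp_mul_left, abs_of_pos (by positivity), smul_eq_mul, ← mul_assoc (L ^ (3/2:ℝ)), ← Real.rpow_neg_one, ← Real.rpow_add hL0, Real.sqrt_eq_rpow L]
    norm_num
    exact Or.inl (Or.inl rfl)
  have hpi : ‖(1 / (2 * Real.pi) : ℂ)‖ = 1 / (2 * Real.pi) := by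
    rw [show (1 / (2 * Real.pi) : ℂ) = ((1 / (2 * Real.pi) : ℝ):ℂ) by push_cast; rfl, norm_real, Real.norm_of_nonneg (by positivity)]
  rw [hpi]
  have hs : √(sg r * L) = √(sg r) * √L := Real.sqrt_mul' _ hL0.le
  calc _ ≤ 1 / (2 * Real.pi) * (Real.exp 1 * √(CA * sg r) * (2 * (√L * J) + √(2 * L) * B * Real.pi)) := by gcongr
    _ = 1 / (2 * Real.pi) * (Real.exp 1 * √CA * (2 * J + √2 * B * Real.pi)) * √(sg r * L) := by
      rw [hs, Real.sqrt_mul hCA.le, Real.sqrt_mul (by norm_num : (0:ℝ) ≤ 2)]; ring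
    _ ≤ _ := by gcongr; linarith
end Sel

namespace Sel
open MeasureTheory Set Filter Topology

noncomputable def be (N n : ℕ) : ℝ := al n * max 0 (-Real.log (n / N)) / Real.log N

theorem be_le {N : ℕ} (hN : 1 ≤ Real.log N) (n : ℕ) : |be N n| ≤ 1 := by
  have hN0 : (0:ℝ) < N := by
    rcases Nat.eq_zero_or_pos N with rfl | h
    · norm_num at hN
    · exact_mod_cast h
  rw [be, abs_div, abs_mul, abs_of_pos (by linarith : 0 < Real.log N), div_le_one (by linarith), abs_of_nonneg (le_max_left 0 (-Real.log (n / N)))]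
  rcases Nat.eq_zero_or_pos n with rfl | hn
  · simp; linarith
  refine (mul_le_of_le_one_left (le_max_left _ _) (al_le1 n)).trans (max_le (by linarith) ?_)
  rw [Real.log_div (by positivity) hN0.ne']
  have := Real.log_nonneg (by exact_mod_cast hn : (1:ℝ) ≤ n)
  linarith

noncomputable def Bd (N : ℕ) (τ : ℝ) (r d : ℕ) : ℝ := ∑ n ∈ Finset.Icc 1 N, if r.gcd n = d then be N n * (n:ℝ) ^ (-(1 + τ)) else 0

noncomputable def wt (d : ℕ) : ℝ := if Squarefree d then (1/2) ^ d.primeFactors.card / d else 0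

theorem Bd_bd : ∃ K > (0:ℝ), ∀ N r d : ℕ, ∀ τ : ℝ, 1 ≤ Real.log N → 0 ≤ τ → τ ≤ 1 / Real.log N → r ≠ 0 → d ∣ r →
    |Bd N τ r d| ≤ wt d * (K * √(sg r / Real.log N)) := by
  obtain ⟨K, hK, h⟩ := perron_bd
  refine ⟨K, hK, fun N r d τ hN hτ hτL hr hd => ?_⟩
  have hN0 : (0:ℝ) < N := by
    rcases Nat.eq_zero_or_pos N with rfl | h
    · norm_num at hN
    · exact_mod_cast h
  set L := Real.log N with hL
  have hL0 : 0 < L := by linarith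
  by_cases hsq : Squarefree d
  swap
  · have : Bd N τ r d = 0 := by
      refine Finset.sum_eq_zero fun n _ => ?_
      split_ifs with hg
      · have : ¬ Squarefree n := fun hn => hsq (hn.squarefree_of_dvd (hg ▸ Nat.gcd_dvd_right r n))
        simp [be, al_sq this]
      · rfl
    rw [this, wt, if_neg hsq]; simp
  have hd0 : d ≠ 0 := by rintro rfl; exact hr (Nat.eq_zero_of_zero_dvd hd)
  have hdr : (0:ℝ) < d := by positivity
  have h1 := h L (N / d) τ r hN (by positivity) (by
    rw [hL, Real.exp_log hN0]; exact div_le_self hN0.le (by exact_mod_cast Nat.one_le_iff_ne_zero.2 hd0)) hτ hτL hr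
  set F : ℕ → ℝ := fun n => if r.gcd n = d then be N n * (n:ℝ) ^ (-(1 + τ)) else 0 with hF
  have e1 : Bd N τ r d = ∑' n, F n := by
    rw [tsum_eq_sum (s := Finset.Icc 1 N)]; rfl
    intro n hn
    have : be N n = 0 := by
      rcases Nat.eq_zero_or_pos n with rfl | hn0
      · simp [be, al]
      · have hnN : N ≤ n := by
          rw [Finset.mem_Icc] at hn; omega
        rw [be, max_eq_left]; simp
        have := Real.log_nonneg ((one_le_div hN0).2 (by exact_mod_cast hnN : (N:ℝ) ≤ n))
        linarith
    simp [hF, this]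
  have e2 : ∑' n, F n = ∑' m, F (d * m) := by
    refine (Function.Injective.tsum_eq (mul_right_injective₀ hd0) ?_).symm
    intro n hn
    have hg : r.gcd n = d := by
      by_contra hg
      exact hn (by simp only [hF]; rw [if_neg hg])
    obtain ⟨m, hm⟩ := hg ▸ Nat.gcd_dvd_right r n
    exact ⟨m, hm.symm⟩
  have e3 : ∀ m : ℕ, ((F (d * m) : ℝ):ℂ) = ((al d * (d:ℝ) ^ (-(1 + τ)) / L : ℝ):ℂ) *
      ((if m.Coprime r then (al m:ℂ) * (m:ℂ) ^ (-(1 + τ : ℂ)) else 0) * ((max 0 (-Real.log (m / (N / d))) : ℝ):ℂ)) := by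
    intro m
    have ec : (m:ℂ) ^ (-(1 + τ : ℂ)) = (((m:ℝ) ^ (-(1 + τ)) : ℝ):ℂ) := by
      rw [Complex.ofReal_cpow (by positivity)]; push_cast; rfl
    simp only [hF]
    by_cases hc : m.Coprime r
    · have hg : r.gcd (d * m) = d := by
        rw [Nat.Coprime.gcd_mul_right_cancel_right d hc, Nat.gcd_eq_right hd]
      rw [if_pos hg, if_pos hc, ec, be, ← hL, al_mul (hc.coprime_dvd_right hd).symm, Nat.cast_mul, Real.mul_rpow hdr.le (by positivity),
        show (m:ℝ) / (N / d) = d * m / N by field_simp]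
      push_cast; ring
    · rw [if_neg hc, zero_mul, mul_zero]
      split_ifs with hg
      · have : ¬ Squarefree (d * m) := by
          intro hs
          have hdm := Nat.coprime_of_squarefree_mul hs
          obtain ⟨q, rfl⟩ := hd
          rw [Nat.gcd_mul_left] at hg
          have : q.gcd m = 1 := by simpa [hd0] using hg
          exact hc (Nat.Coprime.mul_right hdm.symm (Nat.Coprime.symm this))
        simp [be, al_sq this]
      · simp
  have e4 : ((Bd N τ r d : ℝ):ℂ) = ((al d * (d:ℝ) ^ (-(1 + τ)) / L : ℝ):ℂ) *
      ∑' m : ℕ, ((if m.Coprime r then (al m:ℂ) * (m:ℂ) ^ (-(1 + τ : ℂ)) else 0) * ((max 0 (-Real.log (m / (N / d))) : ℝ):ℂ)) := by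
    rw [e1, e2, Complex.ofReal_tsum, ← tsum_mul_left]
    exact tsum_congr e3
  have e5 : |Bd N τ r d| = ‖((Bd N τ r d : ℝ):ℂ)‖ := by rw [Complex.norm_real]; rfl
  rw [e5, e4, norm_mul, Complex.norm_real, Real.norm_eq_abs, abs_div, abs_mul, abs_of_pos hL0, abs_of_nonneg (by positivity : 0 ≤ (d:ℝ) ^ (-(1 + τ)))]
  have hd1 : (d:ℝ) ^ (-(1 + τ)) ≤ 1 / d := by
    rw [one_div, ← Real.rpow_neg_one]
    exact Real.rpow_le_rpow_of_exponent_le (by exact_mod_cast Nat.one_le_iff_ne_zero.2 hd0) (by linarith)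
  have hss : √(sg r * L) = √(sg r / L) * L := by
    rw [show sg r * L = sg r / L * L ^ 2 by field_simp, Real.sqrt_mul' _ (by positivity), Real.sqrt_sq hL0.le]
  calc _ ≤ (1/2) ^ d.primeFactors.card * (1 / d) / L * (K * √(sg r * L)) := by
        gcongr; exact al_le d
    _ = _ := by rw [wt, if_pos hsq, hss]; field_simp

theorem cnt {r : ℕ} (hr : r ≠ 0) : ∑ d ∈ r.divisors, ∑ e ∈ r.divisors, (if r ∣ d * e then wt d * wt e else 0) ≤ sg r / r := by
  have hr0 : (0:ℝ) < r := by positivity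
  have hsg : 0 < sg r := by linarith [sg_one_le hr]
  have key : ∀ d ∈ r.divisors, ∑ e ∈ r.divisors, (if r ∣ d * e then wt d * wt e else 0) ≤
      if Squarefree d then (1/2) ^ r.primeFactors.card * (sg r / r) else 0 := by
    intro d hd
    split_ifs with hsq
    swap
    · refine le_of_eq (Finset.sum_eq_zero fun e _ => ?_)
      simp [wt, hsq]
    have hdd := Nat.mem_divisors.1 hd
    have hd0 : 0 < d := Nat.pos_of_mem_divisors hd
    have h1 : ∀ e ∈ r.divisors, (if r ∣ d * e then wt d * wt e else 0) ≤
        if r ∣ d * e then (1/2) ^ r.primeFactors.card * ((1 / (r:ℝ)) * (1 / ((d * e / r : ℕ):ℝ))) else 0 := by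
      intro e he
      have he0 : 0 < e := Nat.pos_of_mem_divisors he
      split_ifs with hde
      swap
      · rfl
      rw [Nat.cast_div hde hr0.ne', Nat.cast_mul]
      have hd' : (0:ℝ) < d := by positivity
      have he' : (0:ℝ) < e := by positivity
      have hle : r.primeFactors.card ≤ d.primeFactors.card + e.primeFactors.card := by
        refine le_trans (Finset.card_le_card (Nat.primeFactors_mono hde (by positivity))) ?_
        rw [Nat.primeFactors_mul hd0.ne' he0.ne']; exact Finset.card_union_le _ _
      have hw : wt e ≤ (1/2) ^ e.primeFactors.card / e := by
        unfold wt; split_ifs <;> first | rfl | positivity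
      have hwd : wt d = (1/2) ^ d.primeFactors.card / d := by rw [wt, if_pos hsq]
      calc wt d * wt e ≤ (1/2) ^ d.primeFactors.card / d * ((1/2) ^ e.primeFactors.card / e) := by rw [hwd]; gcongr
        _ = (1/2) ^ (d.primeFactors.card + e.primeFactors.card) * (1 / (d * e)) := by rw [pow_add]; field_simp
        _ ≤ (1/2) ^ r.primeFactors.card * (1 / (d * e)) := by
          gcongr ?_ * _
          exact pow_le_pow_of_le_one (by norm_num) (by norm_num) hle
        _ = _ := by field_simp
    refine (Finset.sum_le_sum h1).trans ?_
    rw [← Finset.sum_filter, ← Finset.mul_sum, ← Finset.mul_sum]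
    refine mul_le_mul_of_nonneg_left ?_ (by positivity)
    rw [show sg r / r = 1 / (r:ℝ) * sg r by ring]
    refine mul_le_mul_of_nonneg_left ?_ (by positivity)
    have inj : Set.InjOn (fun e => d * e / r) (r.divisors.filter fun e => r ∣ d * e) := by
      intro a ha b hb hab
      simp only [Finset.coe_filter, Set.mem_ofPred_eq] at ha hb
      have := congrArg (· * r) hab
      simp only [Nat.div_mul_cancel ha.2, Nat.div_mul_cancel hb.2] at this
      exact Nat.eq_of_mul_eq_mul_left hd0 this
    rw [← Finset.sum_image (f := fun f : ℕ => 1 / (f:ℝ)) inj]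
    refine Finset.sum_le_sum_of_subset_of_nonneg ?_ fun _ _ _ => by positivity
    intro f hf
    obtain ⟨e, he, rfl⟩ := Finset.mem_image.1 hf
    rw [Finset.mem_filter, Nat.mem_divisors] at he
    refine Nat.mem_divisors.2 ⟨?_, hr⟩
    rw [Nat.div_dvd_iff_dvd_mul he.2 (by positivity)]
    exact Nat.mul_dvd_mul hdd.1 he.1.1
  refine (Finset.sum_le_sum key).trans ?_
  rw [← Finset.sum_filter, Finset.sum_const, nsmul_eq_mul, ← mul_assoc]
  refine mul_le_of_le_one_left (by positivity) ?_
  have hcard : (r.divisors.filter Squarefree).card ≤ 2 ^ r.primeFactors.card := by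
    rw [← Finset.card_powerset]
    refine Finset.card_le_card_of_injOn Nat.primeFactors (fun d hd => ?_) ?_
    · simp only [Finset.coe_filter, Set.mem_ofPred_eq, Nat.mem_divisors] at hd
      exact Finset.mem_coe.2 (Finset.mem_powerset.2 (Nat.primeFactors_mono hd.1.1 hr))
    · intro a ha b hb hab
      simp only [Finset.coe_filter, Set.mem_ofPred_eq] at ha hb
      rw [← Nat.prod_primeFactors_of_squarefree ha.2, ← Nat.prod_primeFactors_of_squarefree hb.2, hab]
  calc ((r.divisors.filter Squarefree).card : ℝ) * (1/2) ^ r.primeFactors.card ≤ (2 ^ r.primeFactors.card : ℕ) * (1/2) ^ r.primeFactors.card := by gcongr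
    _ = 1 := by push_cast; rw [← mul_pow]; norm_num

noncomputable def yr (N : ℕ) (τ : ℝ) (r : ℕ) : ℝ := ∑ k ∈ Finset.Icc 1 N, ∑ n ∈ Finset.Icc 1 N,
  if r ∣ k * n then (be N k * (k:ℝ) ^ (-(1 + τ))) * (be N n * (n:ℝ) ^ (-(1 + 0:ℝ))) else 0

theorem yr_eq (N : ℕ) (τ : ℝ) {r : ℕ} (hr : r ≠ 0) : yr N τ r = ∑ d ∈ r.divisors, ∑ e ∈ r.divisors, if r ∣ d * e then Bd N τ r d * Bd N 0 r e else 0 := by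
  have key : ∀ k n : ℕ, ∀ x y : ℝ, (if r ∣ k * n then x * y else 0) = ∑ d ∈ r.divisors, ∑ e ∈ r.divisors,
      if r ∣ d * e then (if r.gcd k = d then x else 0) * (if r.gcd n = e then y else 0) else 0 := by
    intro k n x y
    rw [Finset.sum_eq_single (r.gcd k), Finset.sum_eq_single (r.gcd n)]
    · simp [Nat.dvd_gcd_mul_gcd_iff_dvd_mul]
    · intro b _ hb; simp [hb.symm]
    · intro h; exact absurd (Nat.mem_divisors.2 ⟨Nat.gcd_dvd_left r n, hr⟩) h
    · intro b _ hb; simp [hb.symm]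
    · intro h; exact absurd (Nat.mem_divisors.2 ⟨Nat.gcd_dvd_left r k, hr⟩) h
  unfold yr
  have : ∀ k ∈ Finset.Icc 1 N, (∑ n ∈ Finset.Icc 1 N, if r ∣ k * n then (be N k * (k:ℝ) ^ (-(1 + τ))) * (be N n * (n:ℝ) ^ (-(1 + 0:ℝ))) else 0) =
      ∑ d ∈ r.divisors, ∑ e ∈ r.divisors, ∑ n ∈ Finset.Icc 1 N,
      if r ∣ d * e then (if r.gcd k = d then be N k * (k:ℝ) ^ (-(1 + τ)) else 0) * (if r.gcd n = e then be N n * (n:ℝ) ^ (-(1 + 0:ℝ)) else 0) else 0 := by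
    intro k _
    rw [Finset.sum_congr rfl fun n _ => key k n _ _, Finset.sum_comm]
    exact Finset.sum_congr rfl fun d _ => Finset.sum_comm
  rw [Finset.sum_congr rfl this, Finset.sum_comm]
  refine Finset.sum_congr rfl fun d _ => ?_
  rw [Finset.sum_comm]
  refine Finset.sum_congr rfl fun e _ => ?_
  by_cases hde : r ∣ d * e
  · simp only [if_pos hde, Bd]
    rw [Finset.sum_mul_sum]
  · simp [hde]

theorem yr_bd : ∃ K > (0:ℝ), ∀ N r : ℕ, ∀ τ : ℝ, 1 ≤ Real.log N → 0 ≤ τ → τ ≤ 1 / Real.log N → r ≠ 0 →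
    |yr N τ r| ≤ K * (sg r) ^ 2 / (r * Real.log N) := by
  obtain ⟨K, hK, h⟩ := Bd_bd
  refine ⟨K ^ 2, by positivity, fun N r τ hN hτ hτL hr => ?_⟩
  have hsg : 0 < sg r := by linarith [sg_one_le hr]
  have hL0 : 0 < Real.log N := by linarith
  have hr0 : (0:ℝ) < r := by positivity
  have hw : ∀ d, 0 ≤ wt d := fun d => by unfold wt; split_ifs <;> positivity
  rw [yr_eq N τ hr]
  have : ∀ d ∈ r.divisors, ∀ e ∈ r.divisors, |if r ∣ d * e then Bd N τ r d * Bd N 0 r e else 0| ≤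
      (if r ∣ d * e then wt d * wt e else 0) * (K ^ 2 * (sg r / Real.log N)) := by
    intro d hd e he
    split_ifs
    · rw [abs_mul]
      calc _ ≤ (wt d * (K * √(sg r / Real.log N))) * (wt e * (K * √(sg r / Real.log N))) := by
            have := hw d; gcongr
            · exact h N r d τ hN hτ hτL hr (Nat.dvd_of_mem_divisors hd)
            · exact h N r e 0 hN le_rfl (by positivity) hr (Nat.dvd_of_mem_divisors he)
        _ = wt d * wt e * (K ^ 2 * (√(sg r / Real.log N) * √(sg r / Real.log N))) := by ring
        _ = _ := by rw [Real.mul_self_sqrt (by positivity)]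
    · simp
  calc _ ≤ ∑ d ∈ r.divisors, ∑ e ∈ r.divisors, (if r ∣ d * e then wt d * wt e else 0) * (K ^ 2 * (sg r / Real.log N)) :=
        (Finset.abs_sum_le_sum_abs _ _).trans (Finset.sum_le_sum fun d hd => (Finset.abs_sum_le_sum_abs _ _).trans (Finset.sum_le_sum fun e he => this d hd e he))
    _ = (∑ d ∈ r.divisors, ∑ e ∈ r.divisors, (if r ∣ d * e then wt d * wt e else 0)) * (K ^ 2 * (sg r / Real.log N)) := by
        simp_rw [Finset.sum_mul]
    _ ≤ sg r / r * (K ^ 2 * (sg r / Real.log N)) := by gcongr; exact cnt hr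
    _ = _ := by field_simp
end Sel

namespace Sel
open MeasureTheory Set Filter Topology

theorem sg5 : ∃ K > (0:ℝ), ∀ r : ℕ, sg r ^ 5 ≤ K * ∑ d ∈ r.divisors, (d:ℝ) ^ (-(3/5:ℝ)) := by
  set A : ℝ := ∑' n : ℕ, (n:ℝ) ^ (-(11/10:ℝ)) with hA
  have hs : Summable fun n : ℕ => (n:ℝ) ^ (-(11/10:ℝ)) := nsum (by norm_num)
  have hA1 : 0 < A := by
    refine lt_of_lt_of_le one_pos ?_
    simpa using hs.sum_le_tsum {1} fun i _ => by positivity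
  refine ⟨A ^ 4, by positivity, fun r => ?_⟩
  have h := Real.inner_le_weight_mul_Lp_of_nonneg r.divisors (p := 5) (by norm_num) (fun d : ℕ => (d:ℝ) ^ (-(11/10:ℝ))) (fun d : ℕ => (d:ℝ) ^ (1/10:ℝ))
    (fun i => by positivity) (fun i => by positivity)
  have e1 : ∑ d ∈ r.divisors, (d:ℝ) ^ (-(11/10:ℝ)) * (d:ℝ) ^ (1/10:ℝ) = sg r := by
    refine Finset.sum_congr rfl fun d hd => ?_
    have : (0:ℝ) < d := by exact_mod_cast Nat.pos_of_mem_divisors hd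
    rw [← Real.rpow_add this, one_div (d:ℝ), ← Real.rpow_neg_one]; norm_num
  have e2 : ∑ d ∈ r.divisors, (d:ℝ) ^ (-(11/10:ℝ)) * ((d:ℝ) ^ (1/10:ℝ)) ^ (5:ℝ) = ∑ d ∈ r.divisors, (d:ℝ) ^ (-(3/5:ℝ)) := by
    refine Finset.sum_congr rfl fun d hd => ?_
    have : (0:ℝ) < d := by exact_mod_cast Nat.pos_of_mem_divisors hd
    rw [← Real.rpow_mul this.le, ← Real.rpow_add this]; norm_num
  rw [e1, e2] at h
  set B := ∑ d ∈ r.divisors, (d:ℝ) ^ (-(3/5:ℝ)) with hB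
  have hB0 : 0 ≤ B := by positivity
  have hA2 : ∑ d ∈ r.divisors, (d:ℝ) ^ (-(11/10:ℝ)) ≤ A := hs.sum_le_tsum _ fun i _ => by positivity
  have h2 : sg r ≤ A ^ (4/5:ℝ) * B ^ (1/5:ℝ) := by
    refine h.trans ?_
    norm_num
    gcongr
  have h0 : 0 ≤ sg r := by unfold sg; positivity
  calc sg r ^ 5 ≤ (A ^ (4/5:ℝ) * B ^ (1/5:ℝ)) ^ 5 := by gcongr
    _ = (A ^ (4/5:ℝ)) ^ (5:ℝ) * (B ^ (1/5:ℝ)) ^ (5:ℝ) := by rw [mul_pow]; norm_cast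
    _ = A ^ 4 * B := by rw [← Real.rpow_mul hA1.le, ← Real.rpow_mul hB0]; norm_num

theorem sgsum : ∃ K > (0:ℝ), ∀ M : ℕ, ∑ r ∈ Finset.Icc 1 M, sg r ^ 5 / r ≤ K * (1 + Real.log M) := by
  obtain ⟨K, hK, h⟩ := sg5
  have hs : Summable fun n : ℕ => (n:ℝ) ^ (-(8/5:ℝ)) := nsum (by norm_num)
  set A : ℝ := ∑' n : ℕ, (n:ℝ) ^ (-(8/5:ℝ)) with hA
  have hA1 : 0 < A := by
    refine lt_of_lt_of_le one_pos ?_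
    simpa using hs.sum_le_tsum {1} fun i _ => by positivity
  refine ⟨K * A, by positivity, fun M => ?_⟩
  have hH : ∑ m ∈ Finset.Icc 1 M, (1 / (m:ℝ)) ≤ 1 + Real.log M := by
    have := harmonic_le_one_add_log M
    rw [harmonic_eq_sum_Icc] at this
    push_cast at this
    simpa using this
  have h1 : ∀ r ∈ Finset.Icc 1 M, sg r ^ 5 / r ≤ ∑ d ∈ Finset.Icc 1 M, if d ∣ r then K * (d:ℝ) ^ (-(3/5:ℝ)) * (1 / r) else 0 := by
    intro r hr
    rw [Finset.mem_Icc] at hr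
    have hr0 : (0:ℝ) < r := by exact_mod_cast hr.1
    rw [← Finset.sum_filter, ← Finset.sum_mul, ← Finset.mul_sum, div_eq_mul_one_div]
    gcongr
    refine (h r).trans ?_
    gcongr
    intro d hd
    rw [Finset.mem_filter, Finset.mem_Icc]
    exact ⟨⟨Nat.pos_of_mem_divisors hd, (Nat.divisor_le hd).trans hr.2⟩, Nat.dvd_of_mem_divisors hd⟩
  refine (Finset.sum_le_sum h1).trans ?_
  rw [Finset.sum_comm]
  have h2 : ∀ d ∈ Finset.Icc 1 M, (∑ r ∈ Finset.Icc 1 M, if d ∣ r then K * (d:ℝ) ^ (-(3/5:ℝ)) * (1 / r) else 0) ≤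
      K * (1 + Real.log M) * (d:ℝ) ^ (-(8/5:ℝ)) := by
    intro d hd
    rw [Finset.mem_Icc] at hd
    have hd0 : (0:ℝ) < d := by exact_mod_cast hd.1
    rw [← Finset.sum_filter, ← Finset.mul_sum]
    have h3 : ∑ r ∈ Finset.Icc 1 M with d ∣ r, (1 / (r:ℝ)) ≤ ∑ m ∈ Finset.Icc 1 M, 1 / ((d * m : ℕ):ℝ) := by
      rw [← Finset.sum_image (f := fun r : ℕ => 1 / (r:ℝ)) (g := fun m => d * m) (fun a _ b _ hab => Nat.eq_of_mul_eq_mul_left hd.1 hab)]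
      refine Finset.sum_le_sum_of_subset_of_nonneg ?_ fun _ _ _ => by positivity
      intro r hr
      rw [Finset.mem_filter, Finset.mem_Icc] at hr
      obtain ⟨⟨h1, h2⟩, m, rfl⟩ := hr
      refine Finset.mem_image.2 ⟨m, Finset.mem_Icc.2 ⟨Nat.pos_of_ne_zero ?_, ?_⟩, rfl⟩
      · rintro rfl; simp at h1
      · exact (Nat.le_mul_of_pos_left m hd.1).trans h2
    have e : (d:ℝ) ^ (-(8/5:ℝ)) = (d:ℝ) ^ (-(3/5:ℝ)) * (1 / d) := by
      rw [one_div, ← Real.rpow_neg_one, ← Real.rpow_add hd0]; norm_num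
    calc _ ≤ K * (d:ℝ) ^ (-(3/5:ℝ)) * ∑ m ∈ Finset.Icc 1 M, 1 / ((d * m : ℕ):ℝ) := by gcongr
      _ = K * (d:ℝ) ^ (-(3/5:ℝ)) * (1 / d * ∑ m ∈ Finset.Icc 1 M, 1 / (m:ℝ)) := by
        rw [Finset.mul_sum (a := (1 / (d:ℝ)))]; congr 1
        refine Finset.sum_congr rfl fun m _ => ?_
        push_cast; rw [one_div_mul_one_div]
      _ ≤ K * (d:ℝ) ^ (-(3/5:ℝ)) * (1 / d * (1 + Real.log M)) := by gcongr
      _ = _ := by rw [e]; ring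
  refine (Finset.sum_le_sum h2).trans ?_
  rw [← Finset.mul_sum]
  have : 0 ≤ Real.log M := Real.log_natCast_nonneg M
  calc _ ≤ K * (1 + Real.log M) * A := by gcongr; exact hs.sum_le_tsum _ fun i _ => by positivity
    _ = _ := by ring

noncomputable def JJ (τ : ℝ) (n : ℕ) : ℝ := ∑ x ∈ n.divisorsAntidiagonal, (ArithmeticFunction.moebius x.1 : ℝ) * (x.2:ℝ) ^ (τ + 1)

theorem JJ_sum (τ : ℝ) {n : ℕ} (hn : 0 < n) : ∑ i ∈ n.divisors, JJ τ i = (n:ℝ) ^ (τ + 1) :=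
  (ArithmeticFunction.sum_eq_iff_sum_mul_moebius_eq (f := JJ τ) (g := fun n : ℕ => (n:ℝ) ^ (τ + 1))).2 (fun n _ => rfl) n hn

theorem JJ_le {τ : ℝ} (hτ : 0 ≤ τ) (n : ℕ) : |JJ τ n| ≤ (n:ℝ) ^ (τ + 1) * sg n := by
  rw [JJ, Nat.sum_divisorsAntidiagonal (f := fun a b => (ArithmeticFunction.moebius a : ℝ) * (b:ℝ) ^ (τ + 1)), sg, Finset.mul_sum]
  refine (Finset.abs_sum_le_sum_abs _ _).trans (Finset.sum_le_sum fun d hd => ?_)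
  have hd0 : (0:ℝ) < d := by exact_mod_cast Nat.pos_of_mem_divisors hd
  have hd1 : (1:ℝ) ≤ d := by exact_mod_cast Nat.pos_of_mem_divisors hd
  rw [abs_mul, Nat.cast_div (Nat.dvd_of_mem_divisors hd) hd0.ne', Real.div_rpow (by positivity) hd0.le, abs_of_nonneg (by positivity : 0 ≤ (n:ℝ) ^ (τ + 1) / (d:ℝ) ^ (τ + 1))]
  refine (mul_le_of_le_one_left (by positivity) (by exact_mod_cast ArithmeticFunction.abs_moebius_le_one)).trans ?_
  rw [div_eq_mul_one_div]
  gcongr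
  exact Real.self_le_rpow_of_one_le hd1 (by linarith)

theorem SS_eq (N : ℕ) (τ : ℝ) : SS (be N) N τ = ∑ r ∈ Finset.Icc 1 (N * N), JJ τ r * yr N τ r ^ 2 := by
  have h1 : ∀ p ∈ pp N, ∀ q ∈ pp N, BB (be N) p * BB (be N) q * cc p q ^ (-(τ + 1)) = ∑ r ∈ Finset.Icc 1 (N * N),
      JJ τ r * ((if r ∣ p.1 * q.2 then (be N p.1 * (p.1:ℝ) ^ (-(1 + τ))) * (be N q.2 * (q.2:ℝ) ^ (-(1 + 0:ℝ))) else 0) *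
      (if r ∣ q.1 * p.2 then (be N q.1 * (q.1:ℝ) ^ (-(1 + τ))) * (be N p.2 * (p.2:ℝ) ^ (-(1 + 0:ℝ))) else 0)) := by
    intro p hp q hq
    rw [mem_pp] at hp hq
    have a1 : (0:ℝ) < p.1 := by exact_mod_cast hp.1.1
    have a2 : (0:ℝ) < p.2 := by exact_mod_cast hp.2.1
    have a3 : (0:ℝ) < q.1 := by exact_mod_cast hq.1.1
    have a4 : (0:ℝ) < q.2 := by exact_mod_cast hq.2.1
    set g := Nat.gcd (p.1 * q.2) (p.2 * q.1) with hg
    have hg0 : 0 < g := Nat.gcd_pos_of_pos_left _ (Nat.mul_pos hp.1.1 hq.2.1)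
    have hg1 : (0:ℝ) < g := by exact_mod_cast hg0
    have hgN : g ≤ N * N := (Nat.le_of_dvd (Nat.mul_pos hp.1.1 hq.2.1) (Nat.gcd_dvd_left _ _)).trans (Nat.mul_le_mul hp.1.2 hq.2.2)
    have e : g.divisors = (Finset.Icc 1 (N * N)).filter fun r => r ∣ p.1 * q.2 ∧ r ∣ q.1 * p.2 := by
      ext r
      rw [Nat.mem_divisors, Finset.mem_filter, Finset.mem_Icc, hg, Nat.dvd_gcd_iff, mul_comm p.2 q.1]
      constructor
      · rintro ⟨h, h0⟩
        have hr := Nat.le_of_dvd hg0 (by rw [hg, Nat.dvd_gcd_iff, mul_comm p.2 q.1]; exact h)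
        refine ⟨⟨Nat.pos_of_ne_zero ?_, hr.trans hgN⟩, h⟩
        rintro rfl
        exact (Nat.mul_pos hp.1.1 hq.2.1).ne' (Nat.eq_zero_of_zero_dvd h.1)
      · intro h
        refine ⟨h.2, ?_⟩
        rw [mul_comm q.1]; exact hg0.ne'
    have hc : cc p q ^ (-(τ + 1)) = (p.1:ℝ) ^ (-(1 + τ)) * (q.1:ℝ) ^ (-(1 + τ)) * ∑ r ∈ g.divisors, JJ τ r := by
      rw [JJ_sum τ hg0, cc, ← hg, Real.div_rpow (by positivity) hg1.le, Real.mul_rpow a1.le a3.le, Real.rpow_neg hg1.le, add_comm τ 1]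
      field_simp
    rw [hc, e, Finset.sum_filter, Finset.mul_sum, Finset.mul_sum]
    refine Finset.sum_congr rfl fun r _ => ?_
    rw [add_zero, Real.rpow_neg_one, Real.rpow_neg_one, BB, BB]
    by_cases b1 : r ∣ p.1 * q.2
    · by_cases b2 : r ∣ q.1 * p.2
      · rw [if_pos ⟨b1, b2⟩, if_pos b1, if_pos b2]; ring
      · rw [if_neg (fun h => b2 h.2), if_neg b2]; ring
    · rw [if_neg (fun h => b1 h.1), if_neg b1]; ring
  rw [SS, Finset.sum_congr rfl fun p hp => Finset.sum_congr rfl (h1 p hp), Finset.sum_congr rfl fun p _ => Finset.sum_comm, Finset.sum_comm]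
  refine Finset.sum_congr rfl fun r _ => ?_
  simp_rw [← Finset.mul_sum]
  congr 1
  rw [sq, yr, Finset.sum_mul_sum, pp, Finset.sum_product]
  refine Finset.sum_congr rfl fun k _ => ?_
  rw [Finset.sum_congr rfl fun _ _ => Finset.sum_product _ _ _]
  rw [Finset.sum_comm]
  refine Finset.sum_congr rfl fun l _ => ?_
  rw [Finset.sum_mul_sum, Finset.sum_comm]

theorem SS_bd : ∃ K > (0:ℝ), ∀ N : ℕ, ∀ τ : ℝ, 1 ≤ Real.log N → 0 ≤ τ → τ ≤ 1 / Real.log N → SS (be N) N τ ≤ K / Real.log N := by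
  obtain ⟨K, hK, h⟩ := yr_bd
  obtain ⟨A, hA, h'⟩ := sgsum
  refine ⟨Real.exp 2 * K ^ 2 * (A * 3), by positivity, fun N τ hN hτ hτL => ?_⟩
  have hN0 : (0:ℝ) < N := by
    rcases Nat.eq_zero_or_pos N with rfl | h
    · norm_num at hN
    · exact_mod_cast h
  have hL0 : 0 < Real.log N := by linarith
  rw [SS_eq]
  have h1 : ∀ r ∈ Finset.Icc 1 (N * N), JJ τ r * yr N τ r ^ 2 ≤ Real.exp 2 * K ^ 2 / Real.log N ^ 2 * (sg r ^ 5 / r) := by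
    intro r hr
    rw [Finset.mem_Icc] at hr
    have hr0 : (0:ℝ) < r := by exact_mod_cast hr.1
    have hsg : 0 ≤ sg r := by unfold sg; positivity
    have hrt : (r:ℝ) ^ (τ + 1) ≤ Real.exp 2 * r := by
      rw [Real.rpow_add hr0, Real.rpow_one]
      gcongr
      calc (r:ℝ) ^ τ ≤ (N * N : ℝ) ^ τ := by gcongr; exact_mod_cast hr.2
        _ = Real.exp (2 * (Real.log N * τ)) := by
          rw [Real.rpow_def_of_pos (by positivity), Real.log_mul hN0.ne' hN0.ne']; ring_nf
        _ ≤ _ := by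
          gcongr
          have := mul_le_mul_of_nonneg_left hτL hL0.le
          rw [mul_one_div_cancel hL0.ne'] at this
          linarith
    calc _ ≤ |JJ τ r| * |yr N τ r| ^ 2 := by rw [sq_abs]; gcongr; exact le_abs_self _
      _ ≤ (Real.exp 2 * r * sg r) * (K * (sg r) ^ 2 / (r * Real.log N)) ^ 2 := by
        gcongr
        · exact (JJ_le hτ r).trans (by gcongr)
        · exact h N r τ hN hτ hτL (by omega)
      _ = _ := by field_simp
  refine (Finset.sum_le_sum h1).trans ?_
  rw [← Finset.mul_sum]
  calc _ ≤ Real.exp 2 * K ^ 2 / Real.log N ^ 2 * (A * (1 + Real.log (N * N : ℕ))) := by gcongr; exact h' _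
    _ ≤ Real.exp 2 * K ^ 2 / Real.log N ^ 2 * (A * (3 * Real.log N)) := by
      gcongr
      rw [Nat.cast_mul, Real.log_mul hN0.ne' hN0.ne']; linarith
    _ = _ := by field_simp
end Sel

namespace Sel
open MeasureTheory Set Filter Topology

noncomputable def kk (N : ℕ) : ℂ := ⟨Real.sin ((N:ℝ) ^ 100)⁻¹, Real.cos ((N:ℝ) ^ 100)⁻¹⟩

theorem N_pos {N : ℕ} (hN : 1 ≤ Real.log N) : 1 ≤ N := by
  rcases Nat.eq_zero_or_pos N with rfl | h
  · norm_num at hN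
  · exact h

theorem kk_nrm (N : ℕ) : ‖kk N‖ = 1 := by
  rw [Complex.norm_def, Complex.normSq_apply, kk]
  simp only
  rw [← sq, ← sq, Real.sin_sq_add_cos_sq, Real.sqrt_one]

theorem kk_d {N : ℕ} (hN : 1 ≤ Real.log N) : 0 < ((N:ℝ) ^ 100)⁻¹ ∧ ((N:ℝ) ^ 100)⁻¹ ≤ 1 := by
  have h1 : (1:ℝ) ≤ N := by exact_mod_cast N_pos hN
  exact ⟨by positivity, inv_le_one_of_one_le₀ (one_le_pow₀ h1)⟩

theorem kk_re {N : ℕ} (hN : 1 ≤ Real.log N) : ((N:ℝ) ^ 100)⁻¹ / 2 ≤ (kk N).re := by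
  obtain ⟨h0, h1⟩ := kk_d hN
  have hp := Real.pi_gt_three
  have hp' := Real.pi_lt_four
  refine le_trans ?_ (Real.mul_le_sin h0.le (by linarith))
  rw [div_eq_mul_one_div, mul_comm]
  gcongr ?_ * _
  rw [div_le_div_iff₀ (by norm_num) Real.pi_pos]; linarith

theorem kk_im {N : ℕ} (hN : 1 ≤ Real.log N) : 1 / 2 ≤ (kk N).im := by
  obtain ⟨h0, h1⟩ := kk_d hN
  have := Real.one_sub_sq_div_two_le_cos (x := ((N:ℝ) ^ 100)⁻¹)
  have h2 : ((N:ℝ) ^ 100)⁻¹ ^ 2 ≤ 1 := pow_le_one₀ h0.le h1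
  change _ ≤ Real.cos _
  linarith

theorem Gam2 {x : ℝ} (h1 : 1 / 2 ≤ x) (h2 : x ≤ 1) : Real.Gamma x ≤ 2 := by
  have h := Real.convexOn_Gamma.le_max_of_mem_Icc (x := 1/2) (y := 1) (z := x) (by norm_num) (by norm_num) ⟨h1, h2⟩
  refine h.trans (max_le ?_ ?_)
  · rw [Real.Gamma_one_half_eq, Real.sqrt_le_left (by norm_num)]
    linarith [Real.pi_lt_four]
  · rw [Real.Gamma_one]; norm_num

theorem HH_fin : ∃ K > (0:ℝ), ∀ N : ℕ, ∀ h : ℝ, 1 ≤ Real.log N → 0 ≤ h → h ≤ 1 →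
    ∫ x in Ioi 1, ‖HH (kk N) (be N) N x‖ ^ 2 / (1 + h * Real.log x) ^ 2 ≤ K * (N:ℝ) ^ 50 / (1 + h * Real.log N) := by
  obtain ⟨K, hK, hS⟩ := SS_bd
  have hC0 := C0_nonneg
  refine ⟨30 * K + 8 + 4 * Real.exp 50 * (2 * K + 1) + 16 * C0 + 4, by positivity, fun N h hN hh hh1 => ?_⟩
  have hN1 : (1:ℝ) ≤ N := by exact_mod_cast N_pos hN
  have hN0 : (0:ℝ) < N := by linarith
  set L := Real.log N with hL
  have hL0 : 0 < L := by linarith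
  have hLN : L ≤ N := by
    have := Real.log_le_sub_one_of_pos hN0
    linarith
  have hre := kk_re hN
  have him := kk_im hN
  set a := (kk N).re with ha
  have ha0 : 0 < a := lt_of_lt_of_le (by positivity) hre
  have ha1 : a⁻¹ ≤ 2 * (N:ℝ) ^ 100 := by
    rw [inv_le_comm₀ ha0 (by positivity)]
    refine le_trans (le_of_eq ?_) hre
    rw [mul_inv]; ring
  have hx : (1:ℝ) ≤ (N:ℝ) ^ 30 := one_le_pow₀ hN1
  have hτ : 0 < 1 / L := by positivity
  have hτ1 : 1 / L ≤ 1 := by rw [div_le_one hL0]; exact hN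
  have hb := HH_bd ha0 (kk_nrm N) him N (be_le hN) hh hx hτ
  have hP : 0 < 1 + h * L := by positivity
  have hPN : 1 + h * L ≤ 2 * N := by nlinarith
  have hlx : Real.log ((N:ℝ) ^ 30) = 30 * L := by rw [Real.log_pow, ← hL]; norm_num
  have hsm : ∀ j : ℕ, j ≤ 49 → (N:ℝ) ^ j ≤ 2 * ((N:ℝ) ^ 50 / (1 + h * L)) := by
    intro j hj
    rw [← mul_div_assoc, le_div_iff₀ hP]
    calc (N:ℝ) ^ j * (1 + h * L) ≤ (N:ℝ) ^ 49 * (2 * N) := by gcongr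
      _ = _ := by ring
  set X := (N:ℝ) ^ 50 / (1 + h * L) with hX
  have hX0 : 0 < X := by positivity
  have sq2 : √(2:ℝ) ≤ 2 := by rw [Real.sqrt_le_left (by norm_num)]; norm_num
  have t1 : SS (be N) N 0 / (2 * √(2 * a)) * (Real.log ((N:ℝ) ^ 30) / (1 + h * Real.log ((N:ℝ) ^ 30))) ≤ 15 * K * X := by
    rw [hlx]
    have hs : (2 * √(2 * a))⁻¹ ≤ 1/2 * (N:ℝ) ^ 50 := by
      have : (√(2 * a))⁻¹ ≤ (N:ℝ) ^ 50 := by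
        rw [← Real.sqrt_inv, Real.sqrt_le_left (by positivity), ← pow_mul, mul_inv]
        linarith
      rw [mul_inv]; linarith
    calc _ ≤ K / L * (1/2 * (N:ℝ) ^ 50) * (30 * L / (1 + h * L)) := by
          rw [div_eq_mul_inv (SS _ _ _)]
          gcongr
          · exact hS N 0 hN le_rfl (by positivity)
          · nlinarith
      _ = _ := by rw [hX]; field_simp; norm_num
  have t3 : ww h ((N:ℝ) ^ 30) * ((N:ℝ) ^ 30) ^ (-(1 / L)) * ((2 * Real.pi * a) ^ (-(1 / L + 1) / 2) * (1 / 2) * Real.Gamma ((1 / L + 1) / 2)) * (ZZ (1 / L) * SS (be N) N (1 / L) + 1) ≤ 2 * Real.exp 50 * (2 * K + 1) * X := by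
    have u1 : ww h ((N:ℝ) ^ 30) ≤ 1 / (1 + h * L) := by
      rw [ww, hlx, ← one_div]
      refine one_div_le_one_div_of_le hP ?_
      nlinarith [mul_nonneg hh hL0.le, sq_nonneg (h * L)]
    have u2 : ((N:ℝ) ^ 30) ^ (-(1 / L)) ≤ 1 := Real.rpow_le_one_of_one_le_of_nonpos hx (by linarith)
    have u3 : (2 * Real.pi * a) ^ (-(1 / L + 1) / 2) ≤ 2 * (N:ℝ) ^ 50 * Real.exp 50 := by
      have : (2 * Real.pi * a)⁻¹ ≤ 2 * (N:ℝ) ^ 100 := by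
        refine le_trans ?_ ha1
        refine inv_anti₀ ha0 ?_
        nlinarith [Real.pi_gt_three]
      rw [neg_div, Real.rpow_neg (by positivity), ← Real.inv_rpow (by positivity)]
      calc _ ≤ (2 * (N:ℝ) ^ 100) ^ ((1 / L + 1) / 2) := by gcongr
        _ = 2 ^ ((1 / L + 1) / 2) * ((N:ℝ) ^ 100) ^ ((1 / L + 1) / 2) := Real.mul_rpow (by norm_num) (by positivity)
        _ = 2 ^ ((1 / L + 1) / 2) * ((N:ℝ) ^ 50 * Real.exp 50) := by
          congr 1
          rw [Real.rpow_def_of_pos (by positivity), Real.log_pow, ← hL, show ((100:ℕ):ℝ) * L * ((1 / L + 1) / 2) = 50 * L + 50 by field_simp; push_cast; ring,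
            Real.exp_add, mul_comm 50 L, Real.exp_mul, hL, Real.exp_log hN0]
          norm_cast
        _ ≤ 2 ^ (1:ℝ) * ((N:ℝ) ^ 50 * Real.exp 50) := by gcongr; norm_num; linarith
        _ = _ := by rw [Real.rpow_one]; ring
    have u4 : Real.Gamma ((1 / L + 1) / 2) ≤ 2 := Gam2 (by linarith) (by linarith)
    have u4' : 0 < Real.Gamma ((1 / L + 1) / 2) := Real.Gamma_pos_of_pos (by positivity)
    have u5 : ZZ (1 / L) * SS (be N) N (1 / L) ≤ 2 * K := by
      have z0 : 0 ≤ ZZ (1 / L) := tsum_nonneg fun n => by positivity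
      have z1 := ZZ_le hτ
      rw [one_div_one_div] at z1
      calc _ ≤ ZZ (1 / L) * (K / L) := by gcongr; exact hS N _ hN hτ.le le_rfl
        _ ≤ (2 * L) * (K / L) := by gcongr; linarith
        _ = _ := by field_simp
    have w0 : 0 < ww h ((N:ℝ) ^ 30) := by rw [ww, hlx]; positivity
    calc _ ≤ ww h ((N:ℝ) ^ 30) * ((N:ℝ) ^ 30) ^ (-(1 / L)) * ((2 * Real.pi * a) ^ (-(1 / L + 1) / 2) * (1 / 2) * Real.Gamma ((1 / L + 1) / 2)) * (2 * K + 1) := by gcongr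
      _ ≤ 1 / (1 + h * L) * 1 * ((2 * (N:ℝ) ^ 50 * Real.exp 50) * (1 / 2) * 2) * (2 * K + 1) := by gcongr
      _ = _ := by rw [hX]; field_simp
  have t4 : 2 * C0 * (N:ℝ) ^ 10 * a ^ (-(1/4:ℝ)) ≤ 8 * C0 * X := by
    have : a ^ (-(1/4:ℝ)) ≤ 2 * (N:ℝ) ^ 25 := by
      rw [Real.rpow_neg ha0.le, ← Real.inv_rpow ha0.le]
      calc _ ≤ (2 * (N:ℝ) ^ 100) ^ (1/4:ℝ) := by gcongr
        _ = 2 ^ (1/4:ℝ) * ((N:ℝ) ^ 100) ^ (1/4:ℝ) := Real.mul_rpow (by norm_num) (by positivity)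
        _ = 2 ^ (1/4:ℝ) * (N:ℝ) ^ 25 := by
          congr 1
          rw [← Real.rpow_natCast, ← Real.rpow_mul hN0.le, ← Real.rpow_natCast]; norm_num
        _ ≤ 2 ^ (1:ℝ) * (N:ℝ) ^ 25 := by gcongr <;> norm_num
        _ = _ := by rw [Real.rpow_one]
    calc _ ≤ 2 * C0 * (N:ℝ) ^ 10 * (2 * (N:ℝ) ^ 25) := by gcongr
      _ = 4 * C0 * (N:ℝ) ^ 35 := by ring
      _ ≤ 4 * C0 * (2 * X) := by gcongr; exact hsm 35 (by norm_num)
      _ = _ := by ring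
  have t2 : 2 * (N:ℝ) ^ 4 * (N:ℝ) ^ 30 ≤ 4 * X := by
    have := hsm 34 (by norm_num)
    calc _ = 2 * (N:ℝ) ^ 34 := by ring
      _ ≤ _ := by linarith
  have t5 := hsm 4 (by norm_num)
  have e5 := Real.exp_pos 50
  rw [← ha] at hb
  refine hb.trans ?_
  rw [mul_div_assoc, ← hX]
  linarith
end Sel

namespace Sel
open MeasureTheory Set Filter Topology Complex

noncomputable def gz (n : ℕ) (s : ℂ) : ℂ := ((n:ℂ) ^ (-s) + ((n:ℂ) + 1) ^ (-s)) / 2 - ((n:ℂ) ^ (1 - s) - ((n:ℂ) + 1) ^ (1 - s)) / (s - 1)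

theorem gz_le {n : ℕ} (hn : 1 ≤ n) {s : ℂ} (hs : 0 < s.re) (hs1 : s ≠ 1) : ‖gz n s‖ ≤ ‖s‖ * ‖s + 1‖ * (n:ℝ) ^ (-s.re - 2) := by
  have hn0 : (0:ℝ) < n := by exact_mod_cast hn
  have hs1' : 1 - s ≠ 0 := sub_ne_zero.2 hs1.symm
  have hs2 : s - 1 ≠ 0 := sub_ne_zero.2 hs1
  set G : ℝ → ℂ := fun u => u * (1 - u) * (-s * ((n + u : ℝ):ℂ) ^ (-s - 1)) - (1 - 2 * u) * ((n + u : ℝ):ℂ) ^ (-s) - 2 * (((n + u : ℝ):ℂ) ^ (1 - s) / (1 - s)) with hG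
  have hd : ∀ u ∈ Icc (0:ℝ) 1, HasDerivWithinAt G (u * (1 - u) * (s * (s + 1) * ((n + u : ℝ):ℂ) ^ (-s - 2))) (Icc 0 1) u := by
    intro u hu
    have hx : 0 < (n:ℝ) + u := by linarith [hu.1]
    have hd1 : HasDerivAt (fun u : ℝ => ((n + u : ℝ):ℂ)) 1 u := by
      have := ((hasDerivAt_id u).const_add (n:ℝ)).ofReal_comp
      simpa using this
    have hu1 : HasDerivAt (fun u : ℝ => (u:ℂ)) 1 u := by simpa using (hasDerivAt_id u).ofReal_comp
    have hsl : ((n + u : ℝ):ℂ) ∈ slitPlane := by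
      left; rw [ofReal_re]; exact hx
    have dc : ∀ c : ℂ, HasDerivAt (fun u : ℝ => ((n + u : ℝ):ℂ) ^ c) (c * ((n + u : ℝ):ℂ) ^ (c - 1)) u := fun c => by
      have := HasDerivAt.scomp u ((hasDerivAt_id ((n + u : ℝ):ℂ)).cpow_const (c := c) hsl) hd1
      simpa [Function.comp_def] using this
    have d1 := dc (-s - 1)
    have d2 := dc (-s)
    have d3 := dc (1 - s)
    have := ((((hu1.mul (hu1.const_sub 1)).mul (d1.const_mul (-s))).sub (((hu1.const_mul 2).const_sub 1).mul d2)).sub ((d3.div_const (1 - s)).const_mul 2))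
    refine HasDerivAt.hasDerivWithinAt ?_
    refine (this.congr_deriv ?_)
    rw [show -s - 1 - 1 = -s - 2 by ring, show 1 - s - 1 = -s by ring]
    simp only [Pi.mul_apply]
    field_simp
    ring
  have hb : ∀ u ∈ Ico (0:ℝ) 1, ‖(u:ℂ) * (1 - u) * (s * (s + 1) * ((n + u : ℝ):ℂ) ^ (-s - 2))‖ ≤ ‖s‖ * ‖s + 1‖ * (n:ℝ) ^ (-s.re - 2) := by
    intro u hu
    have hx : 0 < (n:ℝ) + u := by linarith [hu.1]
    have e1 : ‖(u:ℂ) * (1 - u)‖ ≤ 1 := by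
      rw [← ofReal_one, ← ofReal_sub, ← ofReal_mul, norm_real, Real.norm_eq_abs, abs_le]
      constructor <;> nlinarith [hu.1, hu.2]
    rw [norm_mul ((u:ℂ) * _), norm_mul (s * _), norm_mul s, norm_cpow_eq_rpow_re_of_pos hx]
    refine (mul_le_of_le_one_left (by positivity : 0 ≤ ‖s‖ * ‖s + 1‖ * ((n:ℝ) + u) ^ (-s - 2).re) e1).trans ?_
    gcongr
    simp only [sub_re, neg_re, re_ofNat]
    exact Real.rpow_le_rpow_of_nonpos hn0 (by linarith [hu.1]) (by linarith)
  have := norm_image_sub_le_of_norm_deriv_le_segment_01' hd hb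
  have e : G 1 - G 0 = 2 * gz n s := by
    simp only [hG, gz]
    push_cast
    rw [show (1 - s) = -(s - 1) by ring, add_zero]
    field_simp
    ring
  rw [e, norm_mul, Complex.norm_ofNat] at this
  have h0 : 0 ≤ ‖gz n s‖ := norm_nonneg _
  linarith

theorem gz_tele (s : ℂ) (M K : ℕ) : ∑ j ∈ Finset.range K, gz (M + j) s = ∑ j ∈ Finset.range K, ((M + j : ℕ):ℂ) ^ (-s) - (M:ℂ) ^ (-s) / 2 + ((M + K : ℕ):ℂ) ^ (-s) / 2
    - ((M:ℂ) ^ (1 - s) - ((M + K : ℕ):ℂ) ^ (1 - s)) / (s - 1) := by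
  induction K with
  | zero => simp
  | succ K ih =>
    rw [Finset.sum_range_succ, ih, Finset.sum_range_succ, gz]
    push_cast
    rw [← add_assoc]
    ring

theorem zz_gt {s : ℂ} (hs : 1 < s.re) {M : ℕ} (hM : 1 ≤ M) :
    HasSum (fun j => gz (M + j) s) (riemannZeta s - ∑ n ∈ Finset.range M, (n:ℂ) ^ (-s) - (M:ℂ) ^ (-s) / 2 - (M:ℂ) ^ (1 - s) / (s - 1)) ↔
    Summable (fun j => gz (M + j) s) := by
  refine ⟨fun h => h.summable, fun h => ?_⟩
  rw [h.hasSum_iff_tendsto_nat]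
  simp_rw [gz_tele]
  have hsum : Summable fun n : ℕ => (n:ℂ) ^ (-s) := by
    simp_rw [cpow_neg, ← one_div]
    exact Complex.summable_one_div_nat_cpow.2 hs
  have hz : riemannZeta s = ∑' n : ℕ, (n:ℂ) ^ (-s) := by
    rw [zeta_eq_tsum_one_div_nat_cpow hs]; simp_rw [cpow_neg, one_div]
  have h1 : Tendsto (fun K => ∑ j ∈ Finset.range K, ((M + j : ℕ):ℂ) ^ (-s)) atTop (𝓝 (riemannZeta s - ∑ n ∈ Finset.range M, (n:ℂ) ^ (-s))) := by
    have : HasSum (fun j : ℕ => ((M + j : ℕ):ℂ) ^ (-s)) (riemannZeta s - ∑ n ∈ Finset.range M, (n:ℂ) ^ (-s)) := by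
      simp_rw [add_comm M]
      rw [hasSum_nat_add_iff' (f := fun n : ℕ => (n:ℂ) ^ (-s)) M, hz]
      exact hsum.hasSum
    exact this.tendsto_sum_nat
  have ht : Tendsto (fun K : ℕ => ((M + K : ℕ):ℝ)) atTop atTop := by
    exact tendsto_natCast_atTop_atTop.comp (tendsto_add_atTop_iff_nat M |>.2 tendsto_id |>.congr fun n => by simp [add_comm])
  have hp : ∀ w : ℂ, w.re < 0 → Tendsto (fun K : ℕ => ((M + K : ℕ):ℂ) ^ w) atTop (𝓝 0) := by
    intro w hw
    rw [tendsto_zero_iff_norm_tendsto_zero]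
    have := (tendsto_rpow_neg_atTop (y := -w.re) (by linarith)).comp ht
    refine this.congr fun K => ?_
    simp only [Function.comp]
    rw [neg_neg, ← ofReal_natCast, norm_cpow_eq_rpow_re_of_pos (by positivity)]
  have h2 := hp (-s) (by simp; linarith)
  have h3 := hp (1 - s) (by simp; linarith)
  have := ((h1.sub_const ((M:ℂ) ^ (-s) / 2)).add (h2.div_const 2)).sub ((h3.const_sub ((M:ℂ) ^ (1 - s))).div_const (s - 1))
  convert this using 2
  ring

theorem gz_bd {M : ℕ} (hM : 1 ≤ M) {s : ℂ} (hs : 0 < s.re) (hs1 : s ≠ 1) (j : ℕ) : ‖gz (M + j) s‖ ≤ ‖s‖ * ‖s + 1‖ * ((M:ℝ) ^ (-s.re - 3/4) * ((j + 1 : ℕ):ℝ) ^ (-(5/4:ℝ))) := by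
  refine (gz_le (by omega) hs hs1).trans ?_
  have hM0 : (0:ℝ) < M := by exact_mod_cast hM
  have hj : (0:ℝ) < (j + 1 : ℕ) := by positivity
  have hMj : (0:ℝ) < (M + j : ℕ) := by positivity
  gcongr
  rw [show -s.re - 2 = (-s.re - 3/4) + (-(5/4)) by ring, Real.rpow_add hMj]
  gcongr ?_ * ?_
  · exact Real.rpow_le_rpow_of_nonpos hM0 (by push_cast; linarith [Nat.cast_nonneg (α := ℝ) j]) (by linarith)
  · refine Real.rpow_le_rpow_of_nonpos hj ?_ (by norm_num)
    exact_mod_cast (by omega : j + 1 ≤ M + j)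

theorem jsum : Summable fun j : ℕ => ((j + 1 : ℕ):ℝ) ^ (-(5/4:ℝ)) :=
  (summable_nat_add_iff (f := fun j : ℕ => (j:ℝ) ^ (-(5/4:ℝ))) 1).2 (nsum (by norm_num))

theorem zz_app {M : ℕ} (hM : 1 ≤ M) {t : ℝ} (ht : 0 < t) :
    riemannZeta (1/2 + t * I) - ∑ n ∈ Finset.range M, (n:ℂ) ^ (-(1/2 + t * I)) - (M:ℂ) ^ (-(1/2 + t * I)) / 2 - (M:ℂ) ^ (1 - (1/2 + t * I)) / ((1/2 + t * I) - 1) =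
    ∑' j, gz (M + j) (1/2 + t * I) := by
  set U : Set ℂ := (Ioo 0 3) ×ℂ (Ioo 0 (t + 1)) with hU
  have hUo : IsOpen U := isOpen_Ioo.reProdIm isOpen_Ioo
  have hUc : IsPreconnected U := by
    refine Convex.isPreconnected (((convex_Ioo (0:ℝ) 3).linear_preimage reLm).inter ((convex_Ioo (0:ℝ) (t+1)).linear_preimage imLm))
  have hU1 : ∀ s ∈ U, 0 < s.re ∧ s ≠ 1 ∧ ‖s‖ ≤ t + 4 ∧ ‖s + 1‖ ≤ t + 5 := by
    intro s hs
    have a := hs.1; have b := hs.2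
    simp only [mem_preimage, mem_Ioo] at a b
    refine ⟨a.1, ?_, ?_⟩
    · rintro rfl; simp at b
    · have h1 : ‖s‖ ≤ t + 4 := by
        refine (norm_le_abs_re_add_abs_im s).trans ?_
        rw [abs_of_pos a.1, abs_of_pos b.1]; linarith
      exact ⟨h1, (norm_add_le _ _).trans (by rw [norm_one]; linarith)⟩
  have hM0 : (M:ℂ) ≠ 0 := by exact_mod_cast (by omega : M ≠ 0)
  have hbd : ∀ j, ∀ s ∈ U, ‖gz (M + j) s‖ ≤ (t + 4) * (t + 5) * (1 * ((j + 1 : ℕ):ℝ) ^ (-(5/4:ℝ))) := by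
    intro j s hs
    obtain ⟨a, b, c, d⟩ := hU1 s hs
    refine (gz_bd hM a b j).trans ?_
    gcongr
    exact Real.rpow_le_one_of_one_le_of_nonpos (by exact_mod_cast hM) (by linarith)
  have hsm : Summable fun j : ℕ => (t + 4) * (t + 5) * (1 * ((j + 1 : ℕ):ℝ) ^ (-(5/4:ℝ))) := (jsum.mul_left _).mul_left _
  have hcp : ∀ (z : ℂ) (f : ℂ → ℂ), z ≠ 0 → Differentiable ℂ f → Differentiable ℂ fun s => z ^ (f s) := fun z f hz hf => hf.const_cpow (Or.inl hz)
  have hdg : ∀ j, DifferentiableOn ℂ (gz (M + j)) U := by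
    intro j
    have c1 : ((M + j : ℕ):ℂ) ≠ 0 := by exact_mod_cast (by omega : M + j ≠ 0)
    have c2 : ((M + j : ℕ):ℂ) + 1 ≠ 0 := by exact_mod_cast (by omega : M + j + 1 ≠ 0)
    have d1 := hcp _ (fun s => -s) c1 (by fun_prop)
    have d2 := hcp _ (fun s => -s) c2 (by fun_prop)
    have d3 := hcp _ (fun s => 1 - s) c1 (by fun_prop)
    have d4 := hcp _ (fun s => 1 - s) c2 (by fun_prop)
    unfold gz
    refine (((d1.add d2).div_const 2).differentiableOn).sub ((d3.sub d4).differentiableOn.div (by fun_prop) fun s hs => sub_ne_zero.2 (hU1 s hs).2.1)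
  have hR : DifferentiableOn ℂ (fun s => ∑' j, gz (M + j) s) U := differentiableOn_tsum_of_summable_norm hsm hdg hUo hbd
  have hL : DifferentiableOn ℂ (fun s => riemannZeta s - ∑ n ∈ Finset.range M, (n:ℂ) ^ (-s) - (M:ℂ) ^ (-s) / 2 - (M:ℂ) ^ (1 - s) / (s - 1)) U := by
    refine ((DifferentiableOn.sub ?_ ?_).sub ((hcp _ (fun s => -s) hM0 (by fun_prop)).div_const 2).differentiableOn).sub
      ((hcp _ (fun s => 1 - s) hM0 (by fun_prop)).differentiableOn.div (by fun_prop) fun s hs => sub_ne_zero.2 (hU1 s hs).2.1)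
    · exact fun s hs => (differentiableAt_riemannZeta (hU1 s hs).2.1).differentiableWithinAt
    · refine DifferentiableOn.fun_sum fun n _ s hs => ?_
      rcases Nat.eq_zero_or_pos n with rfl | hn
      · refine DifferentiableAt.differentiableWithinAt ?_
        refine (differentiableAt_const (0:ℂ)).congr_of_eventuallyEq ?_
        filter_upwards [hUo.mem_nhds hs] with w hw
        rw [Nat.cast_zero, zero_cpow]
        intro h
        have := (hU1 w hw).1
        rw [neg_eq_zero] at h; rw [h] at this; simp at this
      · exact (hcp _ (fun s => -s) (by exact_mod_cast hn.ne') (by fun_prop)).differentiableAt.differentiableWithinAt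
  have hz0 : (2 + (t/2:ℝ) * I : ℂ) ∈ U := by
    constructor
    · simp; norm_num
    · simp; constructor <;> linarith
  have hEq := (hL.analyticOnNhd hUo).eqOn_of_preconnected_of_eventuallyEq (hR.analyticOnNhd hUo) hUc hz0 (by
    have : IsOpen {s : ℂ | 1 < s.re} := isOpen_lt continuous_const continuous_re
    filter_upwards [hUo.mem_nhds hz0, this.mem_nhds (by simp : (2 + (t/2:ℝ) * I : ℂ) ∈ {s : ℂ | 1 < s.re})] with s hs hs1
    have hs1 : 1 < s.re := hs1
    exact (((zz_gt hs1 hM).2 (Summable.of_norm_bounded hsm fun j => hbd j s hs)).tsum_eq).symm)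
  exact hEq (by
    constructor
    · simp; norm_num
    · simp; exact ht)

theorem zz_bd : ∃ K > (0:ℝ), ∀ M : ℕ, ∀ t : ℝ, 1 ≤ M → 1 ≤ t →
    ‖riemannZeta (1/2 + t * I) - ∑ n ∈ Finset.Icc 1 M, (n:ℂ) ^ (-(1/2 + t * I))‖ ≤ √M / t + 1 / √M + K * t ^ 2 * (M:ℝ) ^ (-(5/4:ℝ)) := by
  set A := ∑' j : ℕ, ((j + 1 : ℕ):ℝ) ^ (-(5/4:ℝ)) with hA
  have hA0 : 0 < A := by
    refine lt_of_lt_of_le one_pos ?_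
    simpa [hA] using jsum.sum_le_tsum {0} fun i _ => by positivity
  refine ⟨6 * A, by positivity, fun M t hM ht => ?_⟩
  have ht0 : 0 < t := by linarith
  have hM0 : (0:ℝ) < M := by exact_mod_cast hM
  have h := zz_app hM ht0
  set s : ℂ := 1/2 + t * I with hs
  have hre : s.re = 1/2 := by simp [hs]
  have hs0 : -s ≠ 0 := by
    intro h; have := congrArg re h; rw [neg_re, hre] at this; norm_num at this
  have him : s.im = t := by simp [hs]
  have e1 : ∑ n ∈ Finset.Icc 1 M, (n:ℂ) ^ (-s) = ∑ n ∈ Finset.range M, (n:ℂ) ^ (-s) + (M:ℂ) ^ (-s) := by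
    have : ∑ n ∈ Finset.range (M + 1), (n:ℂ) ^ (-s) = ∑ n ∈ Finset.Icc 1 M, (n:ℂ) ^ (-s) := by
      rw [Finset.range_eq_Ico, Finset.sum_eq_sum_Ico_succ_bot (by omega)]
      rw [Nat.cast_zero, zero_cpow hs0, zero_add]; rfl
    rw [← this, Finset.sum_range_succ]
  have e2 : riemannZeta s - ∑ n ∈ Finset.Icc 1 M, (n:ℂ) ^ (-s) = (M:ℂ) ^ (1 - s) / (s - 1) - (M:ℂ) ^ (-s) / 2 + ∑' j, gz (M + j) s := by
    rw [e1, ← h]; ring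
  have hs1 : ‖s‖ ≤ 2 * t := by
    refine (norm_le_abs_re_add_abs_im s).trans ?_
    rw [hre, him, abs_of_pos ht0, abs_of_pos (by norm_num)]; linarith
  have hs2 : ‖s + 1‖ ≤ 3 * t := (norm_add_le _ _).trans (by rw [norm_one]; linarith)
  have hs3 : t ≤ ‖s - 1‖ := by
    have := abs_im_le_norm (s - 1)
    rw [sub_im, him, one_im, sub_zero, abs_of_pos ht0] at this
    exact this
  rw [e2]
  have n1 : ‖(M:ℂ) ^ (1 - s)‖ = √M := by
    rw [← ofReal_natCast, norm_cpow_eq_rpow_re_of_pos hM0, sub_re, hre, one_re, Real.sqrt_eq_rpow]; norm_num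
  have n2 : ‖(M:ℂ) ^ (-s)‖ = 1 / √M := by
    rw [← ofReal_natCast, norm_cpow_eq_rpow_re_of_pos hM0, neg_re, hre, Real.sqrt_eq_rpow, Real.rpow_neg hM0.le, one_div ((M:ℝ) ^ _)]
  have hb := gz_bd hM (s := s) (by rw [hre]; norm_num) (by intro h; have := congrArg re h; rw [hre] at this; norm_num at this)
  rw [hre] at hb
  have n3 : ‖∑' j, gz (M + j) s‖ ≤ ‖s‖ * ‖s + 1‖ * ((M:ℝ) ^ (-(1/2) - 3/4 : ℝ) * A) :=
    tsum_of_norm_bounded ((jsum.hasSum.mul_left _).mul_left _) hb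
  refine (norm_add_le _ _).trans (add_le_add ((norm_sub_le _ _).trans (add_le_add ?_ ?_)) (n3.trans ?_))
  · rw [norm_div, n1]; gcongr
  · rw [norm_div, n2, Complex.norm_ofNat]
    exact div_le_self (by positivity) (by norm_num)
  · rw [show (-(1/2) - 3/4 : ℝ) = -(5/4) by norm_num]
    calc _ ≤ (2 * t) * (3 * t) * ((M:ℝ) ^ (-(5/4:ℝ)) * A) := by gcongr
      _ = _ := by ring
end Sel

namespace Sel
open MeasureTheory Set Filter Topology Complex

theorem osc1 {m : ℕ} (hm : 2 ≤ m) (X Y : ℝ) : ‖∫ t in X..Y, (m:ℂ) ^ (-(1/2 + t * I))‖ ≤ 3 * (m:ℝ) ^ (-(1/2:ℝ)) := by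
  have hm0 : (0:ℝ) < m := by positivity
  have hm1 : (m:ℂ) ≠ 0 := by exact_mod_cast (by omega : m ≠ 0)
  have hl : (2/3:ℝ) ≤ Real.log m := by
    have h2 : Real.log 2 ≤ Real.log m := Real.log_le_log (by norm_num) (by exact_mod_cast hm)
    linarith [Real.log_two_gt_d9]
  have hl0 : 0 < Real.log m := by linarith
  set c : ℂ := -(I * Real.log m) with hc
  have hc0 : c ≠ 0 := by
    rw [hc, neg_ne_zero]; exact mul_ne_zero I_ne_zero (by exact_mod_cast hl0.ne')
  have hcn : ‖c‖ = Real.log m := by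
    rw [hc, norm_neg, norm_mul, norm_I, one_mul, norm_real, Real.norm_of_nonneg hl0.le]
  have e : ∀ t : ℝ, (m:ℂ) ^ (-(1/2 + t * I)) = (((m:ℝ) ^ (-(1/2:ℝ)) : ℝ):ℂ) * cexp (c * t) := by
    intro t
    rw [ofReal_cpow hm0.le, ofReal_natCast, cpow_def_of_ne_zero hm1, cpow_def_of_ne_zero hm1, ← Complex.exp_add, hc, natCast_log]
    congr 1; push_cast; ring
  have en : ∀ t : ℝ, ‖cexp (c * t)‖ = 1 := by
    intro t; rw [Complex.norm_exp, show c * t = ((-(Real.log m * t) : ℝ):ℂ) * I by rw [hc]; push_cast; ring, re_ofReal_mul, I_re, mul_zero, Real.exp_zero]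
  simp_rw [e]
  rw [intervalIntegral.integral_const_mul, integral_exp_mul_complex hc0, norm_mul, norm_real, Real.norm_of_nonneg (by positivity), mul_comm]
  gcongr
  rw [norm_div, hcn, div_le_iff₀ hl0]
  refine (norm_sub_le _ _).trans ?_
  rw [en, en]; linarith

theorem sqsum (M : ℕ) : ∑ n ∈ Finset.Icc 1 M, (n:ℝ) ^ (-(1/2:ℝ)) ≤ 2 * √M := by
  induction M with
  | zero => simp
  | succ M ih =>
    rw [Finset.sum_Icc_succ_top (by omega)]
    have h1 : (0:ℝ) < (M + 1 : ℕ) := by positivity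
    rw [Real.rpow_neg h1.le, ← Real.sqrt_eq_rpow]
    have h2 : 0 < √((M + 1 : ℕ):ℝ) := Real.sqrt_pos.2 h1
    have h3 := Real.sq_sqrt h1.le
    have h4 := Real.sq_sqrt (Nat.cast_nonneg (α := ℝ) M)
    have h5 := Real.sqrt_nonneg (M:ℝ)
    have : (√((M + 1 : ℕ):ℝ))⁻¹ ≤ 2 * √((M + 1 : ℕ):ℝ) - 2 * √(M:ℝ) := by
      rw [inv_le_iff_one_le_mul₀ h2]
      push_cast at *
      nlinarith [sq_nonneg (√((M:ℝ) + 1) - √(M:ℝ))]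
    linarith

theorem ccont (n : ℕ) : Continuous fun t : ℝ => (n:ℂ) ^ (-(1/2 + t * I)) := by
  rcases Nat.eq_zero_or_pos n with rfl | hn
  · have : (fun t : ℝ => ((0:ℕ):ℂ) ^ (-(1/2 + t * I))) = fun _ => 0 := by
      funext t
      rw [Nat.cast_zero, zero_cpow]
      intro h; have := congrArg re h; simp at this
    rw [this]; exact continuous_const
  · exact Continuous.const_cpow (by fun_prop) (Or.inl (by exact_mod_cast hn.ne'))

theorem phi_cont (β : ℕ → ℝ) (N : ℕ) : Continuous fun t : ℝ => phi β N (1/2 + t * I) := by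
  unfold phi
  exact continuous_finsetSum _ fun n _ => continuous_const.mul (ccont n)

theorem hs1 (t : ℝ) : (1/2 + t * I : ℂ) ≠ 1 := by
  intro h; have := congrArg re h; simp at this

theorem zeta_cont : Continuous fun t : ℝ => riemannZeta (1/2 + t * I) := by
  rw [continuous_iff_continuousAt]
  intro t
  exact ContinuousAt.comp (f := fun t : ℝ => (1/2 + t * I : ℂ)) (g := riemannZeta) (differentiableAt_riemannZeta (hs1 t)).continuousAt (by fun_prop)

theorem cn_le {n : ℕ} (hn : 1 ≤ n) (t : ℝ) : ‖(n:ℂ) ^ (-(1/2 + t * I))‖ ≤ 1 := by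
  rw [← ofReal_natCast, norm_cpow_eq_rpow_re_of_pos (by exact_mod_cast hn)]
  refine Real.rpow_le_one_of_one_le_of_nonpos (by exact_mod_cast hn) (by simp)

theorem phi_le {N : ℕ} (hN : 1 ≤ Real.log N) (t : ℝ) : ‖phi (be N) N (1/2 + t * I)‖ ≤ N := by
  unfold phi
  calc _ ≤ ∑ n ∈ Finset.Icc 1 N, (1:ℝ) := by
        refine norm_sum_le_of_le _ fun n hn => ?_
        rw [norm_mul, norm_real]
        exact mul_le_one₀ (be_le hN n) (norm_nonneg _) (cn_le (Finset.mem_Icc.1 hn).1 t)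
    _ = N := by simp

theorem main_int {N M : ℕ} (hN : 1 ≤ Real.log N) (hM : 1 ≤ M) {X Y : ℝ} (hXY : X ≤ Y) :
    (Y - X) - 6 * N ^ 2 * √M ≤ ‖∫ t in X..Y, (∑ n ∈ Finset.Icc 1 M, (n:ℂ) ^ (-(1/2 + t * I))) * phi (be N) N (1/2 + t * I) ^ 2‖ := by
  set S : Finset (ℕ × ℕ × ℕ) := Finset.Icc 1 M ×ˢ Finset.Icc 1 N ×ˢ Finset.Icc 1 N with hS
  set F : ℕ × ℕ × ℕ → ℝ → ℂ := fun p t => ((be N p.2.1 * be N p.2.2 : ℝ):ℂ) * ((p.1 * p.2.1 * p.2.2 : ℕ):ℂ) ^ (-(1/2 + t * I)) with hF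
  have e1 : ∀ t : ℝ, (∑ n ∈ Finset.Icc 1 M, (n:ℂ) ^ (-(1/2 + t * I))) * phi (be N) N (1/2 + t * I) ^ 2 = ∑ p ∈ S, F p t := by
    intro t
    rw [hS, Finset.sum_product, Finset.sum_mul]
    refine Finset.sum_congr rfl fun n _ => ?_
    rw [sq, phi, Finset.sum_mul_sum, Finset.mul_sum, Finset.sum_product]
    refine Finset.sum_congr rfl fun a _ => ?_
    rw [Finset.mul_sum]
    refine Finset.sum_congr rfl fun b _ => ?_
    simp only [hF]
    rw [Nat.cast_mul (n * a) b, natCast_mul_natCast_cpow, Nat.cast_mul n a, natCast_mul_natCast_cpow]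
    push_cast; ring
  have hc : ∀ p, Continuous (F p) := fun p => continuous_const.mul (ccont _)
  simp_rw [e1]
  rw [intervalIntegral.integral_finsetSum fun p _ => (hc p).intervalIntegrable _ _]
  have hN1 := N_pos hN
  have h1 : ((1, 1, 1) : ℕ × ℕ × ℕ) ∈ S := by simp [hS]; omega
  rw [← Finset.add_sum_erase _ _ h1]
  have hb1 : be N 1 = 1 := by
    rw [be, max_eq_right]
    · rw [Nat.cast_one, one_div, Real.log_inv]; have : Real.log N ≠ 0 := by linarith
      simp only [al, neg_neg, Nat.primeFactors_one, Finset.card_empty, pow_zero, ArithmeticFunction.moebius_apply_one, Int.cast_one, mul_one, one_mul]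
      exact div_self this
    · rw [Nat.cast_one, one_div, Real.log_inv]; linarith
  have e2 : ∫ t in X..Y, F (1, 1, 1) t = ((Y - X : ℝ):ℂ) := by simp [hF, hb1]
  have e3 : ‖∑ p ∈ S.erase (1, 1, 1), ∫ t in X..Y, F p t‖ ≤ 6 * N ^ 2 * √M := by
    have h2 : ∀ p ∈ S.erase (1, 1, 1), ‖∫ t in X..Y, F p t‖ ≤ 3 * (p.1:ℝ) ^ (-(1/2:ℝ)) := by
      rintro ⟨n, a, b⟩ hp
      rw [Finset.mem_erase, hS, Finset.mem_product, Finset.mem_product, Finset.mem_Icc, Finset.mem_Icc, Finset.mem_Icc] at hp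
      obtain ⟨hne, ⟨hn, _⟩, ⟨ha, _⟩, hb, _⟩ := hp
      dsimp only at hn ha hb
      have hnab : n ≤ n * a * b := (Nat.le_mul_of_pos_right n ha).trans (Nat.le_mul_of_pos_right _ hb)
      have h2 : 2 ≤ n * a * b := by
        by_contra hlt
        have h1 : n * a * b = 1 := by
          have : 0 < n * a * b := by positivity
          omega
        have hb1 := Nat.eq_one_of_mul_eq_one_left h1
        rw [hb1, mul_one] at h1
        have ha1 := Nat.eq_one_of_mul_eq_one_left h1
        rw [ha1, mul_one] at h1
        exact hne (by rw [h1, ha1, hb1])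
      simp only [hF]
      rw [intervalIntegral.integral_const_mul, norm_mul, norm_real, norm_mul]
      have hbb : ‖be N a‖ * ‖be N b‖ ≤ 1 := mul_le_one₀ (be_le hN a) (norm_nonneg _) (be_le hN b)
      refine (mul_le_of_le_one_left (norm_nonneg _) hbb).trans ((osc1 h2 X Y).trans ?_)
      gcongr ?_ * ?_
      exact Real.rpow_le_rpow_of_nonpos (by exact_mod_cast hn) (by exact_mod_cast hnab) (by norm_num)
    calc _ ≤ ∑ p ∈ S.erase (1, 1, 1), 3 * (p.1:ℝ) ^ (-(1/2:ℝ)) := norm_sum_le_of_le _ h2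
      _ ≤ ∑ p ∈ S, 3 * (p.1:ℝ) ^ (-(1/2:ℝ)) := Finset.sum_le_sum_of_subset_of_nonneg (Finset.erase_subset _ _) fun _ _ _ => by positivity
      _ = 3 * N ^ 2 * ∑ n ∈ Finset.Icc 1 M, (n:ℝ) ^ (-(1/2:ℝ)) := by
        rw [hS, Finset.sum_product, Finset.mul_sum]
        refine Finset.sum_congr rfl fun n _ => ?_
        simp; ring
      _ ≤ 3 * N ^ 2 * (2 * √M) := by gcongr; exact sqsum M
      _ = _ := by ring
  rw [e2]
  have := norm_sub_le_norm_add ((Y - X : ℝ):ℂ) (∑ p ∈ S.erase (1, 1, 1), ∫ t in X..Y, F p t)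
  rw [norm_real, Real.norm_of_nonneg (by linarith)] at this
  linarith

theorem low_int : ∃ N1 : ℕ, ∀ N : ℕ, N1 ≤ N → (N:ℝ) ^ 100 / 2 ≤ ∫ t in ((N:ℝ) ^ 100 + 1)..(2 * (N:ℝ) ^ 100),
    ‖riemannZeta (1/2 + t * I)‖ * ‖phi (be N) N (1/2 + t * I)‖ ^ 2 := by
  obtain ⟨K, hK, hb⟩ := zz_bd
  refine ⟨max 3 ⌈2 * (9 + 4 * K)⌉₊, fun N hN => ?_⟩
  have hN3 : (3:ℝ) ≤ N := by exact_mod_cast (le_max_left _ _).trans hN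
  have hNK : 2 * (9 + 4 * K) ≤ N := (Nat.le_ceil _).trans (by exact_mod_cast (le_max_right _ _).trans hN)
  have hN0 : (0:ℝ) < N := by linarith
  have hN1 : (1:ℝ) ≤ N := by linarith
  have hl : 1 ≤ Real.log N := by
    rw [Real.le_log_iff_exp_le hN0]
    linarith [Real.exp_one_lt_d9]
  set T := (N:ℝ) ^ 100 with hT
  have hT1 : 1 ≤ T := one_le_pow₀ hN1
  set M := N ^ 170 with hM
  have hM1 : 1 ≤ M := Nat.one_le_pow _ _ (N_pos hl)
  have hMs : √(M:ℝ) = (N:ℝ) ^ 85 := by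
    rw [hM, Nat.cast_pow, show (N:ℝ) ^ 170 = ((N:ℝ) ^ 85) ^ 2 by ring, Real.sqrt_sq (by positivity)]
  have hM5 : (M:ℝ) ^ (-(5/4:ℝ)) ≤ ((N:ℝ) ^ 212)⁻¹ := by
    rw [hM, Nat.cast_pow, ← Real.rpow_natCast, ← Real.rpow_mul hN0.le, ← Real.rpow_natCast, ← Real.rpow_neg hN0.le]
    exact Real.rpow_le_rpow_of_exponent_le hN1 (by norm_num)
  have hXY : T + 1 ≤ 2 * T := by linarith
  have hmain := main_int (N := N) (M := M) hl hM1 hXY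
  set Z : ℝ → ℂ := fun t => ∑ n ∈ Finset.Icc 1 M, (n:ℂ) ^ (-(1/2 + t * I)) with hZ
  have hZc : Continuous Z := continuous_finsetSum _ fun n _ => ccont n
  have hpc := phi_cont (be N) N
  have hzc := zeta_cont
  have hpt : ∀ t ∈ Icc (T + 1) (2 * T), ‖Z t * phi (be N) N (1/2 + t * I) ^ 2‖ ≤
      ‖riemannZeta (1/2 + t * I)‖ * ‖phi (be N) N (1/2 + t * I)‖ ^ 2 + (2 + 4 * K) * ((N:ℝ) ^ 10)⁻¹ := by
    intro t ht
    have ht0 : 1 ≤ t := by linarith [ht.1]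
    have hd : ‖riemannZeta (1/2 + t * I) - Z t‖ ≤ (2 + 4 * K) * ((N:ℝ) ^ 12)⁻¹ := by
      refine (hb M t hM1 ht0).trans ?_
      rw [hMs]
      have a1 : (N:ℝ) ^ 85 / t ≤ ((N:ℝ) ^ 12)⁻¹ := by
        rw [div_le_iff₀ (by linarith)]
        calc (N:ℝ) ^ 85 ≤ (N:ℝ) ^ 88 := pow_le_pow_right₀ hN1 (by norm_num)
          _ = ((N:ℝ) ^ 12)⁻¹ * T := by rw [hT]; field_simp
          _ ≤ _ := by gcongr; linarith [ht.1]
      have a2 : 1 / (N:ℝ) ^ 85 ≤ ((N:ℝ) ^ 12)⁻¹ := by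
        rw [one_div]; exact inv_anti₀ (by positivity) (pow_le_pow_right₀ hN1 (by norm_num))
      have a3 : K * t ^ 2 * (M:ℝ) ^ (-(5/4:ℝ)) ≤ 4 * K * ((N:ℝ) ^ 12)⁻¹ := by
        calc _ ≤ K * (2 * T) ^ 2 * ((N:ℝ) ^ 212)⁻¹ := by gcongr; exact ht.2
          _ = _ := by rw [hT]; field_simp; ring
      linarith
    have hZn : ‖Z t‖ ≤ ‖riemannZeta (1/2 + t * I)‖ + (2 + 4 * K) * ((N:ℝ) ^ 12)⁻¹ := by
      have := norm_sub_norm_le (Z t) (riemannZeta (1/2 + t * I))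
      rw [norm_sub_rev] at this
      linarith
    rw [norm_mul, norm_pow]
    have hp := phi_le hl t
    calc _ ≤ (‖riemannZeta (1/2 + t * I)‖ + (2 + 4 * K) * ((N:ℝ) ^ 12)⁻¹) * ‖phi (be N) N (1/2 + t * I)‖ ^ 2 := by gcongr
      _ = ‖riemannZeta (1/2 + t * I)‖ * ‖phi (be N) N (1/2 + t * I)‖ ^ 2 + (2 + 4 * K) * ((N:ℝ) ^ 12)⁻¹ * ‖phi (be N) N (1/2 + t * I)‖ ^ 2 := by ring
      _ ≤ ‖riemannZeta (1/2 + t * I)‖ * ‖phi (be N) N (1/2 + t * I)‖ ^ 2 + (2 + 4 * K) * ((N:ℝ) ^ 12)⁻¹ * N ^ 2 := by gcongr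
      _ = _ := by field_simp
  have hi := (intervalIntegral.norm_integral_le_integral_norm hXY (μ := volume) (f := fun t => Z t * phi (be N) N (1/2 + t * I) ^ 2)).trans
    (intervalIntegral.integral_mono_on hXY (by apply Continuous.intervalIntegrable; fun_prop) (by apply Continuous.intervalIntegrable; fun_prop) hpt)
  rw [intervalIntegral.integral_add (by apply Continuous.intervalIntegrable; fun_prop) (by simp), intervalIntegral.integral_const, smul_eq_mul] at hi
  have b1 : (2 * T - (T + 1)) * ((2 + 4 * K) * ((N:ℝ) ^ 10)⁻¹) ≤ (2 + 4 * K) * (N:ℝ) ^ 99 := by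
    calc _ ≤ T * ((2 + 4 * K) * ((N:ℝ) ^ 10)⁻¹) := by gcongr; linarith
      _ = (2 + 4 * K) * (N:ℝ) ^ 90 := by rw [hT]; field_simp
      _ ≤ _ := by gcongr <;> norm_num
  have b2 : 6 * (N:ℝ) ^ 2 * √M ≤ 6 * (N:ℝ) ^ 99 := by
    rw [hMs]
    calc _ = 6 * (N:ℝ) ^ 87 := by ring
      _ ≤ _ := by gcongr <;> norm_num
  have b3 : (1:ℝ) ≤ (N:ℝ) ^ 99 := one_le_pow₀ hN1
  have b4 : (9 + 4 * K) * (N:ℝ) ^ 99 ≤ T / 2 := by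
    calc _ ≤ ((N:ℝ) / 2) * (N:ℝ) ^ 99 := by gcongr; linarith
      _ = _ := by rw [hT]; ring
  linarith
end Sel

namespace Sel
open MeasureTheory Set Filter Topology Complex

theorem gseq : ∃ C > (0:ℝ), ∀ u : ℝ, ‖Complex.Gamma (3/4 + u * I)‖ ^ 2 ≤ C * (‖Complex.Gamma (1/4 + u * I)‖ * ‖Complex.Gamma (5/4 + u * I)‖) := by
  have hsum : Summable fun j : ℕ => ((j + 1 : ℕ):ℝ) ^ (-(2:ℝ)) :=
    (summable_nat_add_iff (f := fun j : ℕ => (j:ℝ) ^ (-(2:ℝ))) 1).2 (nsum (by norm_num))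
  refine ⟨Real.exp (∑' j : ℕ, ((j + 1 : ℕ):ℝ) ^ (-(2:ℝ))), by positivity, fun u => ?_⟩
  have hne : ∀ a : ℝ, 0 < a → ∀ j : ℕ, ‖(a + u * I : ℂ) + j‖ ≠ 0 := by
    intro a ha j h
    have := congrArg re (norm_eq_zero.1 h)
    simp at this
    have hj : (0:ℝ) ≤ j := Nat.cast_nonneg j
    linarith
  refine le_of_tendsto_of_tendsto' ((GammaSeq_tendsto_Gamma (3/4 + u * I)).norm.pow 2)
    (((GammaSeq_tendsto_Gamma (1/4 + u * I)).norm.mul (GammaSeq_tendsto_Gamma (5/4 + u * I)).norm).const_mul _) fun n => ?_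
  rcases Nat.eq_zero_or_pos n with rfl | hn
  · have : ∀ a : ℝ, 0 < a → GammaSeq (a + u * I) 0 = 0 := by
      intro a ha
      rw [GammaSeq, Nat.cast_zero, zero_cpow]; simp
      intro h; have := congrArg re h; simp at this; linarith
    have := this (3/4) (by norm_num)
    push_cast at this
    rw [this]; simp; positivity
  have hn0 : (0:ℝ) < n := by exact_mod_cast hn
  have key : ∏ j ∈ Finset.range (n + 1), (‖(1/4 + u * I : ℂ) + j‖ * ‖(5/4 + u * I : ℂ) + j‖) ≤
      Real.exp (∑' j : ℕ, ((j + 1 : ℕ):ℝ) ^ (-(2:ℝ))) * ∏ j ∈ Finset.range (n + 1), ‖(3/4 + u * I : ℂ) + j‖ ^ 2 := by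
    have hf : ∀ j ∈ Finset.range (n + 1), ‖(1/4 + u * I : ℂ) + j‖ * ‖(5/4 + u * I : ℂ) + j‖ ≤ Real.exp (((j + 1 : ℕ):ℝ) ^ (-(2:ℝ))) * ‖(3/4 + u * I : ℂ) + j‖ ^ 2 := by
      intro j _
      have hj : (0:ℝ) ≤ j := Nat.cast_nonneg j
      set w : ℂ := (3/4 + u * I : ℂ) + j with hw
      have hwn : (j + 1:ℝ) / 2 ≤ ‖w‖ := by
        have := (le_abs_self _).trans (abs_re_le_norm w)
        simp [hw] at this
        linarith
      have hw2 : 1/4 ≤ (((j + 1 : ℕ):ℝ) ^ (-(2:ℝ))) * ‖w‖ ^ 2 := by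
        rw [Real.rpow_neg (by positivity), Real.rpow_two, inv_mul_eq_div, le_div_iff₀ (by positivity)]
        push_cast
        calc 1/4 * ((j:ℝ) + 1) ^ 2 = (((j:ℝ) + 1) / 2) ^ 2 := by ring
          _ ≤ _ := by gcongr
      rw [← norm_mul, show ((1/4 + u * I : ℂ) + j) * ((5/4 + u * I : ℂ) + j) = w ^ 2 - 1/4 by rw [hw]; ring]
      calc ‖w ^ 2 - 1/4‖ ≤ ‖w‖ ^ 2 + 1/4 := by
            refine (norm_sub_le _ _).trans ?_
            rw [norm_pow]; norm_num
        _ ≤ (((j + 1 : ℕ):ℝ) ^ (-(2:ℝ)) + 1) * ‖w‖ ^ 2 := by linarith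
        _ ≤ _ := by gcongr; exact Real.add_one_le_exp _
    refine (Finset.prod_le_prod (fun j _ => by positivity) hf).trans ?_
    rw [Finset.prod_mul_distrib, ← Real.exp_sum]
    gcongr
    exact hsum.sum_le_tsum _ fun j _ => by positivity
  have hG : ∀ s : ℂ, ‖GammaSeq s n‖ = (n:ℝ) ^ s.re * (Nat.factorial n : ℝ) / ∏ j ∈ Finset.range (n + 1), ‖s + j‖ := by
    intro s
    rw [GammaSeq, norm_div, norm_mul, norm_prod, norm_natCast, ← ofReal_natCast n, norm_cpow_eq_rpow_re_of_pos hn0]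
  have h1 := hne (1/4) (by norm_num)
  have h2 := hne (3/4) (by norm_num)
  have h3 := hne (5/4) (by norm_num)
  push_cast at h1 h2 h3
  have p1 : 0 < ∏ j ∈ Finset.range (n + 1), ‖(1/4 + u * I : ℂ) + j‖ := Finset.prod_pos fun j _ => lt_of_le_of_ne (norm_nonneg _) (h1 j).symm
  have p2 : 0 < ∏ j ∈ Finset.range (n + 1), ‖(3/4 + u * I : ℂ) + j‖ := Finset.prod_pos fun j _ => lt_of_le_of_ne (norm_nonneg _) (h2 j).symm
  have p3 : 0 < ∏ j ∈ Finset.range (n + 1), ‖(5/4 + u * I : ℂ) + j‖ := Finset.prod_pos fun j _ => lt_of_le_of_ne (norm_nonneg _) (h3 j).symm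
  rw [Finset.prod_mul_distrib, Finset.prod_pow] at key
  have r1 : (1/4 + u * I : ℂ).re = 1/4 := by simp
  have r2 : (3/4 + u * I : ℂ).re = 3/4 := by simp
  have r3 : (5/4 + u * I : ℂ).re = 5/4 := by simp
  rw [hG, hG, hG, r1, r2, r3]
  set P1 := ∏ j ∈ Finset.range (n + 1), ‖(1/4 + u * I : ℂ) + j‖
  set P2 := ∏ j ∈ Finset.range (n + 1), ‖(3/4 + u * I : ℂ) + j‖
  set P3 := ∏ j ∈ Finset.range (n + 1), ‖(5/4 + u * I : ℂ) + j‖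
  set E := Real.exp (∑' j : ℕ, ((j + 1 : ℕ):ℝ) ^ (-(2:ℝ)))
  have e1 : ((n:ℝ) ^ (3/4:ℝ)) ^ 2 = (n:ℝ) ^ (3/2:ℝ) := by rw [← Real.rpow_natCast, ← Real.rpow_mul hn0.le]; norm_num
  have e2 : (n:ℝ) ^ (1/4:ℝ) * (n:ℝ) ^ (5/4:ℝ) = (n:ℝ) ^ (3/2:ℝ) := by rw [← Real.rpow_add hn0]; norm_num
  rw [div_pow, mul_pow, e1, div_mul_div_comm, show (n:ℝ) ^ (1/4:ℝ) * (Nat.factorial n : ℝ) * ((n:ℝ) ^ (5/4:ℝ) * (Nat.factorial n : ℝ)) = (n:ℝ) ^ (3/2:ℝ) * (Nat.factorial n : ℝ) ^ 2 by rw [← e2]; ring,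
    ← mul_div_assoc, div_le_div_iff₀ (by positivity) (by positivity)]
  have : 0 ≤ (n:ℝ) ^ (3/2:ℝ) * (Nat.factorial n : ℝ) ^ 2 := by positivity
  calc _ ≤ (n:ℝ) ^ (3/2:ℝ) * (Nat.factorial n : ℝ) ^ 2 * (E * P2 ^ 2) := by gcongr
    _ = _ := by ring

theorem Gam_low : ∃ c > (0:ℝ), ∀ t : ℝ, 1 ≤ t → c * t ^ (-(1/4:ℝ)) * Real.exp (-(Real.pi * t / 4)) ≤ ‖Gammaℝ (1/2 + t * I)‖ := by
  obtain ⟨C, hC, h⟩ := gseq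
  have hpi := Real.pi_pos
  refine ⟨Real.pi ^ (-(1/4:ℝ)) * C ^ (-(1/4:ℝ)), by positivity, fun t ht => ?_⟩
  have ht0 : 0 < t := by linarith
  set u := t / 2 with hu
  have hu0 : 0 < u := by positivity
  set A := ‖Complex.Gamma (1/4 + u * I)‖ with hA
  set B := ‖Complex.Gamma (3/4 + u * I)‖ with hB
  have hAp : 0 < A := by
    rw [hA, norm_pos_iff]; exact Gamma_ne_zero_of_re_pos (by simp)
  have hBp : 0 < B := by
    rw [hB, norm_pos_iff]; exact Gamma_ne_zero_of_re_pos (by simp)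
  have h5 : ‖Complex.Gamma (5/4 + u * I)‖ ≤ t * A := by
    rw [show (5/4 + u * I : ℂ) = (1/4 + u * I) + 1 by ring, Gamma_add_one _ (by
      intro h; have := congrArg re h; simp at this), norm_mul]
    gcongr
    refine (norm_le_abs_re_add_abs_im _).trans ?_
    simp [abs_of_pos hu0]
    linarith
  have hBA : B ^ 2 ≤ C * t * A ^ 2 := by
    refine (h u).trans ?_
    calc _ ≤ C * (A * (t * A)) := by gcongr
      _ = _ := by ring
  have hre : Real.pi * Real.exp (-(Real.pi * u)) ≤ A * B := by
    have e1 : ‖Complex.Gamma (1 - (1/4 + u * I))‖ = B := by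
      rw [hB, ← norm_conj, ← Gamma_conj]
      congr 2
      apply Complex.ext <;> simp <;> norm_num
    have e2 := Complex.Gamma_mul_Gamma_one_sub (1/4 + u * I)
    have e3 : ‖Complex.sin (Real.pi * (1/4 + u * I))‖ ≤ Real.exp (Real.pi * u) := by
      rw [Complex.sin]
      have n1 : ‖cexp (-(Real.pi * (1/4 + u * I)) * I)‖ = Real.exp (Real.pi * u) := by
        rw [Complex.norm_exp]; congr 1; simp
      have n2 : ‖cexp ((Real.pi * (1/4 + u * I)) * I)‖ ≤ Real.exp (Real.pi * u) := by
        rw [Complex.norm_exp]; gcongr; simp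
        nlinarith
      rw [norm_div, norm_mul, norm_I, mul_one, Complex.norm_ofNat]
      have := norm_sub_le (cexp (-(Real.pi * (1/4 + u * I)) * I)) (cexp ((Real.pi * (1/4 + u * I)) * I))
      linarith
    have e4 : A * B = Real.pi / ‖Complex.sin (Real.pi * (1/4 + u * I))‖ := by
      rw [hA, ← e1, ← norm_mul, e2, norm_div, norm_real, Real.norm_of_nonneg hpi.le]
    have hs0 : 0 < ‖Complex.sin (Real.pi * (1/4 + u * I))‖ := by
      by_contra h0
      have : ‖Complex.sin (Real.pi * (1/4 + u * I))‖ = 0 := le_antisymm (not_lt.1 h0) (norm_nonneg _)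
      rw [this, div_zero] at e4
      exact absurd e4 (by positivity)
    rw [e4, Real.exp_neg, ← div_eq_mul_inv]
    gcongr
  have hA4 : C ^ (-(1:ℝ)) * t ^ (-(1:ℝ)) * Real.exp (-(Real.pi * t)) ≤ A ^ 4 := by
    rw [Real.rpow_neg_one, Real.rpow_neg_one]
    have h1 : (Real.pi * Real.exp (-(Real.pi * u))) ^ 2 ≤ (A * B) ^ 2 := by gcongr
    have h2 : (A * B) ^ 2 ≤ C * t * A ^ 4 := by
      calc _ = A ^ 2 * B ^ 2 := by ring
        _ ≤ A ^ 2 * (C * t * A ^ 2) := by gcongr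
        _ = _ := by ring
    have h3 : (Real.pi * Real.exp (-(Real.pi * u))) ^ 2 = Real.pi ^ 2 * Real.exp (-(Real.pi * t)) := by
      rw [mul_pow, ← Real.exp_nat_mul]; congr 2; rw [hu]; push_cast; ring
    have h4 : Real.exp (-(Real.pi * t)) ≤ C * t * A ^ 4 := by
      refine le_trans ?_ (h1.trans h2)
      rw [h3]
      exact le_mul_of_one_le_left (by positivity) (one_le_pow₀ (by linarith [Real.pi_gt_three]))
    rw [← mul_inv, inv_mul_le_iff₀ (by positivity)]
    exact h4
  have hAl : C ^ (-(1/4:ℝ)) * t ^ (-(1/4:ℝ)) * Real.exp (-(Real.pi * t / 4)) ≤ A := by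
    have := Real.rpow_le_rpow (by positivity) hA4 (by norm_num : (0:ℝ) ≤ 1/4)
    rw [Real.mul_rpow (by positivity) (by positivity), Real.mul_rpow (by positivity) (by positivity), ← Real.rpow_mul hC.le, ← Real.rpow_mul ht0.le,
      ← Real.exp_mul, ← Real.rpow_natCast A, ← Real.rpow_mul hAp.le] at this
    norm_num at this
    rw [show Real.pi * t / 4 = Real.pi * t * (1/4) by ring]; exact this
  rw [Gammaℝ_def, norm_mul, ← ofReal_one, norm_cpow_eq_rpow_re_of_pos hpi]
  have e1 : (-(((1:ℝ):ℂ)/2 + t * I) / 2).re = -(1/4) := by simp; norm_num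
  have e2 : (((1:ℝ):ℂ)/2 + t * I) / 2 = 1/4 + u * I := by rw [hu]; push_cast; ring
  rw [e1, e2, mul_assoc, mul_assoc]
  gcongr
  rw [← mul_assoc]; exact hAl
end Sel

namespace Sel
open MeasureTheory Set Filter Topology Complex FourierTransform

noncomputable def Xi (t : ℝ) : ℝ := (completedRiemannZeta (1/2 + t * I)).re
noncomputable def tt (N : ℕ) : ℝ := Real.pi / 2 - ((N:ℝ) ^ 100)⁻¹
noncomputable def WW (N : ℕ) (t : ℝ) : ℝ := 1/2 * Real.exp (tt N * t / 2) * Xi t * ‖phi (be N) N (1/2 + t * I)‖ ^ 2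

theorem hs0 (t : ℝ) : (1/2 + t * I : ℂ) ≠ 0 := by
  intro h; have := congrArg re h; simp at this

theorem LamGam (t : ℝ) : completedRiemannZeta (1/2 + t * I) = Gammaℝ (1/2 + t * I) * riemannZeta (1/2 + t * I) := by
  rw [riemannZeta_def_of_ne_zero (hs0 t), mul_div_cancel₀]
  exact Gammaℝ_ne_zero_of_re_pos (by simp)

theorem Xi_eq (t : ℝ) : (Xi t : ℂ) = completedRiemannZeta (1/2 + t * I) := by
  have hg : Gammaℝ ((starRingEnd ℂ) (1/2 + t * I)) = (starRingEnd ℂ) (Gammaℝ (1/2 + t * I)) := by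
    rw [Gammaℝ_def, Gammaℝ_def, map_mul, ← Gamma_conj]
    have := cpow_conj (Real.pi : ℂ) (-(1/2 + t * I) / 2) (by
      rw [arg_ofReal_of_nonneg Real.pi_pos.le]; exact Real.pi_pos.ne)
    rw [conj_ofReal] at this
    rw [← this]
    have e2 : (starRingEnd ℂ) 2 = 2 := Complex.conj_ofNat 2
    rw [map_div₀, map_div₀, map_neg, e2]
  have hc : (starRingEnd ℂ) (1/2 + t * I) = 1 - (1/2 + t * I) := by
    apply Complex.ext <;> simp <;> norm_num
  rw [Xi, ← Complex.conj_eq_iff_re]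
  have e : (1/2 + ((-t:ℝ):ℂ) * I : ℂ) = (starRingEnd ℂ) (1/2 + t * I) := by
    apply Complex.ext <;> simp
  rw [LamGam, map_mul, ← hg, ← riemannZeta_conj, ← e, ← LamGam, e, hc, completedRiemannZeta_one_sub, LamGam]

theorem Xi_zero {t : ℝ} (h : Xi t = 0) : riemannZeta (1/2 + t * I) = 0 := by
  have := Xi_eq t
  rw [h, LamGam] at this
  rcases mul_eq_zero.1 this.symm with h | h
  · exact absurd h (Gammaℝ_ne_zero_of_re_pos (by simp))
  · exact h

theorem Xi_cont : Continuous Xi := by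
  unfold Xi
  apply continuous_re.comp
  rw [continuous_iff_continuousAt]
  intro t
  exact (differentiableAt_completedZeta (hs0 t) (hs1 t)).continuousAt.comp (f := fun t : ℝ => (1/2 + t * I : ℂ)) (by fun_prop)

theorem WW_cont (N : ℕ) : Continuous (WW N) := by
  unfold WW
  have := Xi_cont
  have := phi_cont (be N) N
  fun_prop

theorem kk_exp (N : ℕ) : kk N = cexp (tt N * I) := by
  rw [exp_mul_I, ← ofReal_cos, ← ofReal_sin, tt, Real.cos_pi_div_two_sub, Real.sin_pi_div_two_sub]
  rw [kk, Complex.mk_eq_add_mul_I]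

theorem RW {N : ℕ} (hN : 1 ≤ Real.log N) (t : ℝ) :
    𝓕 (f1 (kk N) (be N) N) (t / (2 * Real.pi)) = cexp (-(tt N / 4 : ℝ) * I) * (WW N t : ℝ) := by
  obtain ⟨h0, h1⟩ := kk_d hN
  rw [f1_four (by have := kk_re hN; linarith), WW, ofReal_mul, ofReal_mul, ofReal_mul, Xi_eq]
  have : kk N ^ (-(1/2 + t * I)/2) = cexp (-(tt N / 4 : ℝ) * I) * (Real.exp (tt N * t / 2) : ℝ) := by
    rw [kk_exp, cpow_def_of_ne_zero (exp_ne_zero _), log_exp, ofReal_exp, ← exp_add]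
    · congr 1; push_cast; ring_nf; rw [I_sq]; ring
    · rw [im_ofReal_mul, I_im, tt]; linarith [Real.pi_gt_three]
    · rw [im_ofReal_mul, I_im, tt]; linarith [Real.pi_gt_three]
  rw [this]; push_cast; ring

theorem W_up : ∃ K > 0, ∀ (N : ℕ), 1 ≤ Real.log N →
    (Integrable (fun t => WW N t ^ 2) ∧ ∫ t, WW N t ^ 2 ≤ K * (N:ℝ) ^ 50) ∧ ∀ h : ℝ, 0 < h → h ≤ 1 →
    (Integrable (fun t => (∫ y in t..t+h, WW N y) ^ 2) ∧ ∫ t, (∫ y in t..t+h, WW N y) ^ 2 ≤ K * h ^ 2 * (N:ℝ) ^ 50 / (1 + h * Real.log N)) := by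
  obtain ⟨K, hK, H⟩ := HH_fin
  have hpi := Real.pi_pos
  refine ⟨36 * Real.pi * K, by positivity, fun N hN => ?_⟩
  have hk : 0 < (kk N).re := by have := kk_re hN; have := (kk_d hN).1; linarith
  have hk1 := kk_nrm N
  have f1i := f1_int hk (be N) N
  have f1m := f1_memLp hk hk1 (be N) N
  have hn1 : ‖cexp (-(tt N / 4 : ℝ) * I)‖ = 1 := by
    rw [← ofReal_neg, norm_exp_ofReal_mul_I]
  constructor
  · obtain ⟨a, b⟩ := four1 f1i f1m
    have e : ∀ t : ℝ, ‖𝓕 (f1 (kk N) (be N) N) (t / (2 * Real.pi))‖ ^ 2 = WW N t ^ 2 := by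
      intro t; rw [RW hN, norm_mul, hn1, one_mul, norm_real, Real.norm_eq_abs, sq_abs]
    simp only [e] at a b
    refine ⟨a, ?_⟩
    have := H N 0 hN le_rfl zero_le_one
    have h2 := (f1_W hk hk1 (be N) N le_rfl).2
    simp only [zero_mul, add_zero, one_pow, div_one] at this h2
    rw [b, h2]
    calc _ ≤ 2 * Real.pi * (2 * (K * (N:ℝ) ^ 50)) := by gcongr
      _ ≤ _ := by have : 0 ≤ Real.pi * K * (N:ℝ) ^ 50 := by positivity
                  linarith
  · intro h hh hh1
    obtain ⟨a, b⟩ := four2 f1i f1m hh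
    have e : ∀ t : ℝ, ‖∫ y in t..t+h, 𝓕 (f1 (kk N) (be N) N) (y / (2 * Real.pi))‖ ^ 2 = (∫ y in t..t+h, WW N y) ^ 2 := by
      intro t
      simp only [RW hN]
      rw [intervalIntegral.integral_const_mul, norm_mul, hn1, one_mul, intervalIntegral.integral_ofReal, norm_real, Real.norm_eq_abs, sq_abs]
    simp only [e] at a b
    refine ⟨a, b.trans ?_⟩
    rw [(f1_W hk hk1 (be N) N hh.le).2]
    calc _ ≤ 18 * Real.pi * h ^ 2 * (2 * (K * (N:ℝ) ^ 50 / (1 + h * Real.log N))) := by gcongr; exact H N h hN hh.le hh1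
      _ = _ := by ring
end Sel

namespace Sel
open MeasureTheory Set Filter Topology Complex

theorem W_low : ∃ c > 0, ∃ N1 : ℕ, ∀ N ≥ N1, 1 ≤ Real.log N →
    c * (N:ℝ) ^ 75 ≤ ∫ t in ((N:ℝ) ^ 100 + 1)..(2 * (N:ℝ) ^ 100), |WW N t| := by
  obtain ⟨N1, h1⟩ := low_int
  obtain ⟨c, hc, hG⟩ := Gam_low
  refine ⟨c * Real.exp (-1) / 4 / 2, by positivity, N1, fun N hN hL => ?_⟩
  have hn1 : (1:ℝ) ≤ N := by exact_mod_cast N_pos hL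
  have hn0 : (0:ℝ) < N := by linarith
  have hT1 : (1:ℝ) ≤ (N:ℝ) ^ 100 := one_le_pow₀ hn1
  have hc1 : Continuous fun t : ℝ => ‖riemannZeta (1/2 + t * I)‖ * ‖phi (be N) N (1/2 + t * I)‖ ^ 2 :=
    zeta_cont.norm.mul ((phi_cont _ _).norm.pow 2)
  calc _ = c * Real.exp (-1) / 4 * ((N:ℝ) ^ 25)⁻¹ * ((N:ℝ) ^ 100 / 2) := by
        rw [show (N:ℝ) ^ 100 = (N:ℝ) ^ 25 * (N:ℝ) ^ 75 by ring]; field_simp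
    _ ≤ c * Real.exp (-1) / 4 * ((N:ℝ) ^ 25)⁻¹ * ∫ t in ((N:ℝ) ^ 100 + 1)..(2 * (N:ℝ) ^ 100), ‖riemannZeta (1/2 + t * I)‖ * ‖phi (be N) N (1/2 + t * I)‖ ^ 2 := by
        gcongr; exact h1 N hN
    _ = ∫ t in ((N:ℝ) ^ 100 + 1)..(2 * (N:ℝ) ^ 100), c * Real.exp (-1) / 4 * ((N:ℝ) ^ 25)⁻¹ * (‖riemannZeta (1/2 + t * I)‖ * ‖phi (be N) N (1/2 + t * I)‖ ^ 2) := by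
        rw [intervalIntegral.integral_const_mul]
    _ ≤ _ := by
        have hle : (N:ℝ) ^ 100 + 1 ≤ 2 * (N:ℝ) ^ 100 := by linarith
        refine intervalIntegral.integral_mono_on hle ((hc1.const_mul _).intervalIntegrable _ _) ((WW_cont N).abs.intervalIntegrable _ _) fun t ht => ?_
        have ht1 : 1 ≤ t := by linarith [ht.1]
        have ht0 : 0 < t := by linarith
        have hX : |Xi t| = ‖Gammaℝ (1/2 + t * I)‖ * ‖riemannZeta (1/2 + t * I)‖ := by
          rw [← norm_mul, ← LamGam, ← Xi_eq, norm_real, Real.norm_eq_abs]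
        have hr : (1/2) * ((N:ℝ) ^ 25)⁻¹ ≤ t ^ (-(1/4:ℝ)) := by
          have : (2 * (N:ℝ) ^ 25) = (((2 * (N:ℝ) ^ 25) ^ 4)) ^ (1/4:ℝ) := by
            rw [← Real.rpow_natCast _ 4, ← Real.rpow_mul (by positivity)]; norm_num
          rw [Real.rpow_neg ht0.le, show (1/2) * ((N:ℝ) ^ 25)⁻¹ = (2 * (N:ℝ) ^ 25)⁻¹ by rw [mul_inv]; norm_num, this]
          gcongr
          calc t ≤ 2 * (N:ℝ) ^ 100 := ht.2
            _ ≤ _ := by rw [mul_pow, ← pow_mul]; norm_num; linarith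
        have he : Real.exp (-1) ≤ Real.exp (tt N * t / 2) * Real.exp (-(Real.pi * t / 4)) := by
          rw [← Real.exp_add]; gcongr
          have : tt N * t / 2 + -(Real.pi * t / 4) = - (((N:ℝ) ^ 100)⁻¹ * t) / 2 := by rw [tt]; ring
          rw [this]
          have : ((N:ℝ) ^ 100)⁻¹ * t ≤ 2 := by
            rw [inv_mul_le_iff₀ (by positivity)]; linarith [ht.2]
          linarith
        rw [WW, abs_mul, abs_mul, abs_mul, hX, abs_of_nonneg (by norm_num : (0:ℝ) ≤ 1/2), Real.abs_exp, abs_of_nonneg (by positivity : 0 ≤ ‖phi (be N) N (1/2 + t * I)‖ ^ 2)]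
        have hg := hG t ht1
        set z := ‖riemannZeta (1/2 + t * I)‖
        set p := ‖phi (be N) N (1/2 + t * I)‖ ^ 2
        have hz : 0 ≤ z := norm_nonneg _
        have hp : 0 ≤ p := by positivity
        calc _ = 1/2 * c * (1/2 * ((N:ℝ) ^ 25)⁻¹) * Real.exp (-1) * (z * p) := by ring
          _ ≤ 1/2 * c * t ^ (-(1/4:ℝ)) * (Real.exp (tt N * t / 2) * Real.exp (-(Real.pi * t / 4))) * (z * p) := by gcongr
          _ = 1/2 * Real.exp (tt N * t / 2) * ((c * t ^ (-(1/4:ℝ)) * Real.exp (-(Real.pi * t / 4))) * z) * p := by ring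
          _ ≤ _ := by gcongr

theorem swp {f : ℝ → ℝ} (hf : Continuous f) (X Y h : ℝ) :
    ∫ t in X..Y, ∫ y in t..t+h, f y = ∫ v in (0:ℝ)..h, ∫ y in (X+v)..(Y+v), f y := by
  have e : ∀ t, ∫ y in t..t+h, f y = ∫ v in (0:ℝ)..h, f (t + v) := by
    intro t; rw [intervalIntegral.integral_comp_add_left]; simp
  have e2 : ∀ v, ∫ y in (X+v)..(Y+v), f y = ∫ t in X..Y, f (t + v) := by
    intro v; rw [intervalIntegral.integral_comp_add_right]
  simp only [e, e2]
  apply intervalIntegral_intervalIntegral_swap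
  have c : Continuous (Function.uncurry fun t v => f (t + v)) := by unfold Function.uncurry; fun_prop
  exact (c.continuousOn.integrableOn_compact (isCompact_uIcc.prod isCompact_uIcc)).mono_set (prod_mono uIoc_subset_uIcc uIoc_subset_uIcc)

theorem cntI {f : ℝ → ℝ} (hf : Continuous f) (h : ℝ) : Continuous fun t => ∫ y in t..t+h, f y := by
  have e : ∀ t, ∫ y in t..t+h, f y = (∫ y in (0:ℝ)..t+h, f y) - ∫ y in (0:ℝ)..t, f y := by
    intro t; rw [intervalIntegral.integral_interval_sub_left] <;> exact hf.intervalIntegrable _ _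
  simp only [e]
  have := intervalIntegral.continuous_primitive (fun a b => hf.intervalIntegrable (μ := volume) a b) 0
  exact (this.comp (by fun_prop)).sub this

def Es (W : ℝ → ℝ) (T h : ℝ) : Set ℝ := {t | t ∈ Ioc T (2*T) ∧ |∫ y in t..t+h, W y| < ∫ y in t..t+h, |W y|}

theorem Emeas {W : ℝ → ℝ} (hW : Continuous W) {T h A0 B D a b : ℝ} (hT : 1 ≤ T) (hh : 0 < h) (hh1 : h ≤ 1) (ha : 0 < a) (hb : 0 < b)
    (h1 : A0 ≤ ∫ t in (T+1)..(2*T), |W t|) (h2 : Integrable fun t => W t ^ 2) (h3 : ∫ t, W t ^ 2 ≤ B)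
    (h4 : Integrable fun t => (∫ y in t..t+h, W y) ^ 2) (h5 : ∫ t, (∫ y in t..t+h, W y) ^ 2 ≤ D) :
    h * A0 ≤ a * T / 2 + D / (2 * a) + h * (b * (volume (Es W T h)).toReal / 2 + B / (2 * b)) := by
  have hT2 : T ≤ 2 * T := by linarith
  have cJ := cntI hW h
  have cM := cntI hW.abs h
  have hW2 : Continuous fun y => W y ^ 2 := hW.pow 2
  have cS := cntI hW2 h
  set J := fun t => ∫ y in t..t+h, W y with hJ
  set M := fun t => ∫ y in t..t+h, |W y| with hM
  set S := fun t => ∫ y in t..t+h, W y ^ 2 with hS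
  have mE : MeasurableSet (Es W T h) := by
    apply measurableSet_Ioc.inter
    exact (isOpen_lt cJ.abs cM).measurableSet
  have lo : h * A0 ≤ ∫ t in T..(2*T), M t := by
    rw [hM, swp hW.abs]
    have : h * A0 = ∫ v in (0:ℝ)..h, A0 := by simp
    rw [this]
    have cc : Continuous fun v => ∫ y in (T+v)..(2*T+v), |W y| := by
      have := (cntI hW.abs T).comp (continuous_const_add T)
      convert this using 2 with v
      simp only [Function.comp]; congr 1; ring
    refine intervalIntegral.integral_mono_on hh.le (by simp) (cc.intervalIntegrable _ _) fun v hv => h1.trans ?_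
    by_cases hc : T + 1 ≤ 2 * T
    · exact intervalIntegral.integral_mono_interval (by linarith [hv.2]) hc (by linarith [hv.1]) (Eventually.of_forall fun _ => abs_nonneg _) (hW.abs.intervalIntegrable _ _)
    · refine le_trans ?_ (intervalIntegral.integral_nonneg (by linarith) fun _ _ => abs_nonneg _)
      rw [intervalIntegral.integral_symm]
      have := intervalIntegral.integral_nonneg (μ := volume) (f := fun x => |W x|) (by linarith : 2 * T ≤ T + 1) fun _ _ => abs_nonneg _
      linarith
  have hMS : ∀ t, M t ≤ h * b / 2 + S t / (2 * b) := by
    intro t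
    have : h * b / 2 + S t / (2 * b) = ∫ y in t..t+h, (b / 2 + W y ^ 2 / (2 * b)) := by
      rw [intervalIntegral.integral_add (by simp) ((hW2.div_const _).intervalIntegrable _ _), intervalIntegral.integral_div (2 * b)]
      simp [hS]
    rw [this]
    refine intervalIntegral.integral_mono_on (by linarith) (hW.abs.intervalIntegrable _ _) ((Continuous.intervalIntegrable (by fun_prop)) _ _) fun y _ => ?_
    rw [← sq_abs (W y)]
    have : b / 2 + |W y| ^ 2 / (2 * b) - |W y| = (b - |W y|) ^ 2 / (2 * b) := by field_simp; ring
    have h0 : 0 ≤ (b - |W y|) ^ 2 / (2 * b) := by positivity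
    linarith
  have hS0 : ∀ t, 0 ≤ S t := fun t => intervalIntegral.integral_nonneg (by linarith) fun _ _ => sq_nonneg _
  have pt : ∀ t ∈ Ioc T (2*T), M t ≤ (a / 2 + J t ^ 2 / (2 * a)) + ((Es W T h).indicator (fun _ => h * b / 2) t + S t / (2 * b)) := by
    intro t ht
    have hj : |J t| ≤ a / 2 + J t ^ 2 / (2 * a) := by
      rw [← sq_abs (J t)]
      have : a / 2 + |J t| ^ 2 / (2 * a) - |J t| = (a - |J t|) ^ 2 / (2 * a) := by field_simp; ring
      have h0 : 0 ≤ (a - |J t|) ^ 2 / (2 * a) := by positivity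
      linarith
    have hs := div_nonneg (hS0 t) (by positivity : 0 ≤ 2 * b)
    by_cases hE : t ∈ Es W T h
    · rw [indicator_of_mem hE]
      have := hMS t
      have : 0 ≤ |J t| := abs_nonneg _
      linarith
    · rw [indicator_of_notMem hE]
      have : M t ≤ |J t| := by
        by_contra hc; exact hE ⟨ht, not_le.1 hc⟩
      linarith
  have fE : volume (Es W T h) ≠ ⊤ := by
    refine ne_top_of_le_ne_top ?_ (measure_mono (fun t ht => ht.1 : Es W T h ⊆ Ioc T (2*T)))
    simp
  have iE : Integrable ((Es W T h).indicator (fun _ => h * b / 2)) :=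
    (integrable_indicator_iff mE).2 (integrableOn_const fE)
  have i1 : IntervalIntegrable (fun t => a / 2 + J t ^ 2 / (2 * a)) volume T (2*T) := Continuous.intervalIntegrable (by fun_prop) _ _
  have i2 : IntervalIntegrable (fun t => S t / (2 * b)) volume T (2*T) := Continuous.intervalIntegrable (by fun_prop) _ _
  have up : ∫ t in T..(2*T), M t ≤ ∫ t in T..(2*T), ((a / 2 + J t ^ 2 / (2 * a)) + ((Es W T h).indicator (fun _ => h * b / 2) t + S t / (2 * b))) := by
    rw [intervalIntegral.integral_of_le hT2, intervalIntegral.integral_of_le hT2]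
    refine setIntegral_mono_on ?_ ?_ measurableSet_Ioc pt
    · exact (cM.intervalIntegrable T (2*T)).1
    · exact (i1.add (iE.intervalIntegrable.add i2)).1
  rw [intervalIntegral.integral_add i1 (iE.intervalIntegrable.add i2), intervalIntegral.integral_add iE.intervalIntegrable i2, intervalIntegral.integral_add (by simp) (Continuous.intervalIntegrable (by fun_prop) _ _),
    intervalIntegral.integral_div (2 * a), intervalIntegral.integral_div (2 * b)] at up
  have b1 : ∫ t in T..(2*T), J t ^ 2 ≤ D := by
    rw [intervalIntegral.integral_of_le hT2]
    exact (setIntegral_le_integral h4 (Eventually.of_forall fun _ => sq_nonneg _)).trans h5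
  have b2 : ∫ t in T..(2*T), (Es W T h).indicator (fun _ => h * b / 2) t ≤ (volume (Es W T h)).toReal * (h * b / 2) := by
    rw [intervalIntegral.integral_of_le hT2]
    refine (setIntegral_le_integral iE (Eventually.of_forall fun _ => indicator_nonneg (fun _ _ => by positivity) _)).trans ?_
    rw [integral_indicator mE, setIntegral_const, smul_eq_mul, Measure.real]
  have b3 : ∫ t in T..(2*T), S t ≤ h * B := by
    rw [hS, swp hW2]
    have : h * B = ∫ v in (0:ℝ)..h, B := by simp
    rw [this]
    have cc : Continuous fun v => ∫ y in (T+v)..(2*T+v), W y ^ 2 := by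
      have := (cntI hW2 T).comp (continuous_const_add T)
      convert this using 2 with v
      simp only [Function.comp]; congr 1; ring
    refine intervalIntegral.integral_mono_on hh.le (cc.intervalIntegrable _ _) (by simp) fun v hv => ?_
    rw [intervalIntegral.integral_of_le (by linarith)]
    exact (setIntegral_le_integral h2 (Eventually.of_forall fun _ => sq_nonneg _)).trans h3
  have e1 : ∫ t in T..(2*T), a / 2 = a * T / 2 := by simp; ring
  rw [e1] at up
  have b1' : (∫ t in T..(2*T), J t ^ 2) / (2 * a) ≤ D / (2 * a) := by gcongr
  have b3' : (∫ t in T..(2*T), S t) / (2 * b) ≤ h * B / (2 * b) := by gcongr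
  calc _ ≤ _ := lo.trans up
    _ ≤ a * T / 2 + D / (2 * a) + ((volume (Es W T h)).toReal * (h * b / 2) + h * B / (2 * b)) := by gcongr
    _ = _ := by ring
end Sel

namespace Sel
open MeasureTheory Set Filter Topology Complex

theorem Es_zero {N : ℕ} {T h t : ℝ} (hh : 0 < h) (ht : t ∈ Es (WW N) T h) : ∃ u ∈ Icc t (t+h), Xi u = 0 := by
  by_contra! hc
  obtain ⟨_, ht⟩ := ht
  have key : (∀ u ∈ Icc t (t+h), 0 < Xi u) ∨ (∀ u ∈ Icc t (t+h), Xi u < 0) := by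
    by_contra! hd
    obtain ⟨⟨x, hx, hx0⟩, ⟨y, hy, hy0⟩⟩ := hd
    obtain ⟨u, hu, hu0⟩ := isPreconnected_Icc.intermediate_value hx hy Xi_cont.continuousOn ⟨hx0, hy0⟩
    exact hc u hu hu0
  have hle : t ≤ t + h := by linarith
  refine absurd ht (not_lt.2 ?_)
  rcases key with k | k
  · rw [intervalIntegral.integral_congr (g := WW N)]
    · exact le_abs_self _
    · intro u hu
      rw [uIcc_of_le hle] at hu
      have := k u hu
      exact abs_of_nonneg (by rw [WW]; positivity)
  · rw [intervalIntegral.integral_congr (g := fun u => - WW N u)]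
    · rw [intervalIntegral.integral_neg]; exact neg_le_abs _
    · intro u hu
      rw [uIcc_of_le hle] at hu
      have := k u hu
      refine abs_of_nonpos ?_
      have h2 : WW N u = -(1/2 * Real.exp (tt N * u / 2) * (- Xi u) * ‖phi (be N) N (1/2 + u * I)‖ ^ 2) := by rw [WW]; ring
      have h3 : 0 ≤ - Xi u := by linarith
      rw [h2, neg_nonpos]; positivity

theorem fin0 (T : ℝ) : {ρ : ℂ | riemannZeta ρ = 0 ∧ ρ.re = 1/2 ∧ 0 < ρ.im ∧ ρ.im < T}.Finite := by
  have hc : IsCompact (Icc (1/2:ℝ) (1/2) ×ℂ Icc 0 T) := isCompact_Icc.reProdIm isCompact_Icc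
  refine hc.inter_riemannZetaZeros_finite.subset fun ρ hρ => ⟨?_, hρ.1⟩
  rw [mem_reProdIm]
  exact ⟨⟨hρ.2.1.ge, hρ.2.1.le⟩, ⟨hρ.2.2.1.le, hρ.2.2.2.le⟩⟩

theorem cover {N : ℕ} {T h : ℝ} (hT : 1 ≤ T) (hh : 0 < h) (hh1 : h ≤ 1) :
    (volume (Es (WW N) T h)).toReal ≤ h * ({ρ : ℂ | riemannZeta ρ = 0 ∧ ρ.re = 1/2 ∧ 0 < ρ.im ∧ ρ.im < 4 * T}.ncard : ℝ) := by
  set Z := (fin0 (4 * T)).toFinset with hZ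
  have hs : Es (WW N) T h ⊆ ⋃ ρ ∈ Z, Icc (ρ.im - h) ρ.im := by
    intro t ht
    obtain ⟨u, hu, hu0⟩ := Es_zero hh ht
    rw [mem_iUnion₂]
    refine ⟨1/2 + u * I, ?_, ?_⟩
    · rw [hZ, Set.Finite.mem_toFinset]
      obtain ⟨⟨h1, h2⟩, _⟩ := ht
      obtain ⟨h3, h4⟩ := hu
      refine ⟨Xi_zero hu0, by simp, ?_, ?_⟩
      · simp; linarith
      · simp; linarith
    · simp; constructor <;> linarith [hu.1, hu.2]
  have h1 : volume (Es (WW N) T h) ≤ ENNReal.ofReal (h * Z.card) := by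
    refine (measure_mono hs).trans ((measure_biUnion_finset_le _ _).trans ?_)
    simp only [Real.volume_Icc, sub_sub_cancel, Finset.sum_const, nsmul_eq_mul]
    rw [mul_comm h, ENNReal.ofReal_mul (by positivity)]
    simp
  rw [Set.ncard_eq_toFinset_card _ (fin0 _)]
  refine ENNReal.toReal_le_of_le_ofReal (by positivity) h1

theorem main1 : ∃ c > 0, ∃ N1 : ℕ, ∀ N ≥ N1, 1 ≤ Real.log N ∧ c * (N:ℝ) ^ 100 * Real.log N ≤
    ({ρ : ℂ | riemannZeta ρ = 0 ∧ ρ.re = 1/2 ∧ 0 < ρ.im ∧ ρ.im < 4 * (N:ℝ) ^ 100}.ncard : ℝ) := by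
  obtain ⟨K, hK, HU⟩ := W_up
  obtain ⟨c, hc, N1, HL⟩ := W_low
  set A := 4 * K / c ^ 2 with hA
  have hA0 : 0 < A := by positivity
  have hev : ∀ᶠ n : ℕ in atTop, 1 + A ≤ Real.log n :=
    (Real.tendsto_log_atTop.comp tendsto_natCast_atTop_atTop).eventually_ge_atTop _
  obtain ⟨N2, h2⟩ := eventually_atTop.1 hev
  refine ⟨c ^ 2 / (4 * K) / A, by positivity, max N1 N2, fun N hN => ?_⟩
  have hL := h2 N ((le_max_right _ _).trans hN)
  have hL1 : 1 ≤ Real.log N := by linarith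
  refine ⟨hL1, ?_⟩
  have hn1 : (1:ℝ) ≤ N := by exact_mod_cast N_pos hL1
  have hT1 : (1:ℝ) ≤ (N:ℝ) ^ 100 := one_le_pow₀ hn1
  set L := Real.log N
  have hL0 : 0 < L := by linarith
  set h := A / L with hh
  have hh0 : 0 < h := by positivity
  have hh1 : h ≤ 1 := by rw [hh, div_le_one hL0]; linarith
  have hhL : h * L = A := by rw [hh]; field_simp
  obtain ⟨⟨u1, u2⟩, u3⟩ := HU N hL1
  obtain ⟨u4, u5⟩ := u3 h hh0 hh1
  have hlow := HL N ((le_max_left _ _).trans hN) hL1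
  set x := (N:ℝ) ^ 25 with hx
  have hx0 : 0 < x := by positivity
  have x100 : (N:ℝ) ^ 100 = x ^ 4 := by rw [hx]; ring
  have x75 : (N:ℝ) ^ 75 = x ^ 3 := by rw [hx]; ring
  have x50 : (N:ℝ) ^ 50 = x ^ 2 := by rw [hx]; ring
  have cov := cover (N := N) hT1 hh0 hh1
  have em := Emeas (WW_cont N) hT1 hh0 hh1 (a := h * c / (2 * x)) (b := 2 * K / (c * x)) (by positivity) (by positivity) hlow u1 u2 u4 u5
  rw [x100] at *
  rw [x75, x50, hhL] at em
  set V := (volume (Es (WW N) (x ^ 4) h)).toReal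
  have i1 : h * c / (2 * x) * x ^ 4 / 2 = h * (c * x ^ 3 / 4) := by field_simp; ring
  have i2 : K * h ^ 2 * x ^ 2 / (1 + A) / (2 * (h * c / (2 * x))) ≤ h * (c * x ^ 3 / 4) := by
    have : K * h ^ 2 * x ^ 2 / (1 + A) / (2 * (h * c / (2 * x))) = h * x ^ 3 * (K / c / (1 + A)) := by field_simp
    rw [this]
    have : K / c / (1 + A) ≤ c / 4 := by
      rw [div_le_iff₀ (by positivity)]
      have : c / 4 * A = K / c := by rw [hA]; field_simp
      nlinarith
    calc _ ≤ h * x ^ 3 * (c / 4) := by gcongr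
      _ = _ := by ring
  have i3 : K * x ^ 2 / (2 * (2 * K / (c * x))) = c * x ^ 3 / 4 := by field_simp; ring
  rw [i1, i3] at em
  have em2 : h * (c * x ^ 3) ≤ h * (c * x ^ 3 / 4 + c * x ^ 3 / 4 + (2 * K / (c * x) * V / 2 + c * x ^ 3 / 4)) := by
    linarith
  have em3 := le_of_mul_le_mul_left em2 hh0
  have em4 : c * x ^ 3 / 4 ≤ K / (c * x) * V := by
    have : 2 * K / (c * x) * V / 2 = K / (c * x) * V := by ring
    linarith
  have em5 : c ^ 2 / (4 * K) * x ^ 4 ≤ V := by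
    have : c ^ 2 / (4 * K) * x ^ 4 = (c * x / K) * (c * x ^ 3 / 4) := by field_simp
    rw [this]
    calc _ ≤ (c * x / K) * (K / (c * x) * V) := by gcongr
      _ = V := by field_simp
  have fin := em5.trans cov
  have : c ^ 2 / (4 * K) / A * x ^ 4 * L = (c ^ 2 / (4 * K) * x ^ 4) / h := by rw [hh]; field_simp
  rw [this, div_le_iff₀' hh0]
  exact fin

theorem main2 : ∃ c > 0, ∃ T0 : ℝ, ∀ T ≥ T0, c * T * Real.log T ≤
    ({ρ : ℂ | riemannZeta ρ = 0 ∧ ρ.re = 1/2 ∧ 0 < ρ.im ∧ ρ.im < T}.ncard : ℝ) := by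
  obtain ⟨c, hc, N1, H⟩ := main1
  refine ⟨c / (4 * 2 ^ 100) / 300, by positivity, 4 * ((N1:ℝ) + 1) ^ 100, fun T hT => ?_⟩
  have hT0 : 0 < T := lt_of_lt_of_le (by positivity) hT
  set r := (T / 4) ^ (1/100:ℝ) with hr
  have hr0 : 0 < r := by positivity
  have hrp : r ^ 100 = T / 4 := by
    rw [hr, ← Real.rpow_natCast, ← Real.rpow_mul (by positivity)]; norm_num
  have hrN : (N1:ℝ) + 1 ≤ r := by
    refine le_of_pow_le_pow_left₀ (n := 100) (by norm_num) hr0.le ?_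
    rw [hrp]; linarith
  set N := ⌊r⌋₊ with hN
  have hle : (N:ℝ) ≤ r := Nat.floor_le hr0.le
  have hlt : r < N + 1 := Nat.lt_floor_add_one r
  have hNN : N1 ≤ N := Nat.le_floor (by linarith)
  obtain ⟨hL, h⟩ := H N hNN
  have hn1 : (1:ℝ) ≤ N := by exact_mod_cast N_pos hL
  have h4 : 4 * (N:ℝ) ^ 100 ≤ T := by
    have : (N:ℝ) ^ 100 ≤ r ^ 100 := by gcongr
    linarith
  have h5 : T ≤ 4 * (2 ^ 100 * (N:ℝ) ^ 100) := by
    have : r ^ 100 ≤ (2 * (N:ℝ)) ^ 100 := by gcongr; linarith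
    rw [mul_pow, hrp] at this; linarith
  have h6 : Real.log T ≤ 300 * Real.log N := by
    have l2 := Real.log_two_lt_d9
    have e4 : Real.log 4 = 2 * Real.log 2 := by rw [show (4:ℝ) = 2 ^ 2 by norm_num, Real.log_pow]; norm_num
    have := Real.log_le_log hT0 h5
    rw [Real.log_mul (by norm_num) (by positivity), Real.log_mul (by positivity) (by positivity), Real.log_pow, Real.log_pow, e4] at this
    push_cast at this
    linarith
  have hmono : ({ρ : ℂ | riemannZeta ρ = 0 ∧ ρ.re = 1/2 ∧ 0 < ρ.im ∧ ρ.im < 4 * (N:ℝ) ^ 100}.ncard : ℝ) ≤ ({ρ : ℂ | riemannZeta ρ = 0 ∧ ρ.re = 1/2 ∧ 0 < ρ.im ∧ ρ.im < T}.ncard : ℝ) := by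
    refine Nat.cast_le.2 (Set.ncard_le_ncard ?_ (fin0 T))
    exact (fun ρ hρ => ⟨hρ.1, hρ.2.1, hρ.2.2.1, hρ.2.2.2.trans_le h4⟩)
  refine le_trans ?_ (h.trans hmono)
  have h7 : 0 ≤ Real.log T := Real.log_nonneg (by linarith [one_le_pow₀ hn1 (n := 100)])
  calc _ ≤ c / (4 * 2 ^ 100) / 300 * (4 * (2 ^ 100 * (N:ℝ) ^ 100)) * (300 * Real.log N) := by gcongr
    _ = _ := by ring
end Sel

open Complex

/-- **Selberg's theorem.** A positive proportion of the non-trivial zeros of the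
Riemann zeta function lie on the critical line: there are constants `c > 0` and
`T₀` such that `N₀(T) ≥ c · T · log T` for all `T ≥ T₀`, where `N₀ T` counts
the zeros `ρ = 1/2 + it` of `ζ` with `0 < t < T`. -/
theorem selberg_positive_proportion
    (N₀ : ℝ → ℕ)
    (hN₀ : ∀ T : ℝ, N₀ T = {ρ : ℂ | riemannZeta ρ = 0 ∧ ρ.re = 1/2 ∧
      0 < ρ.im ∧ ρ.im < T}.ncard) :
    ∃ c > (0:ℝ), ∃ T₀ : ℝ, ∀ T ≥ T₀, (N₀ T : ℝ) ≥ c * T * Real.log T := by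
  obtain ⟨c, hc, T0, h⟩ := Sel.main2
  exact ⟨c, hc, T0, fun T hT => by rw [hN₀ T]; exact h T hT⟩
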